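/- arXiv:math/0701158 — 2 statements merged into one kernel-verified Lean document; each statement's English description precedes it below -/
import Mathlib

section
/- Let p ∈ [1,∞), let Q be a Dirac-form potential with real-valued q₁, q₂ ∈ L_p(0,1), and let (λ_n)_{n∈ℤ} and (μ_n)_{n∈ℤ} be the strictly increasing enumerations of the eigenvalues of A₁ and A₂ satisfying λ_n = π(n+1/2) + e_n(g₁) and μ_n = πn + e_n(g₂) with g₁,g₂ ∈ L_p(0,1). Then for every λ ∈ ℂ the symmetric partial products ∏_{n=−N}^{N} (λ_n − λ)/(π(n+1/2)) converge as N → ∞ to φ(λ) := c₁(1,λ), and the products (λ − μ₀)·∏_{n=−N, n≠0}^{N} (μ_n − λ)/(πn) converge to ψ(λ) := c₂(1,λ); in both cases the convergence is uniform on compact subsets of ℂ. -/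
open MeasureTheory Complex Filter Set
open scoped Matrix.Norms.L2Operator ENNReal

noncomputable section

abbrev M2 := Matrix (Fin 2) (Fin 2) ℂ

def Bmat : M2 := !![0, 1; -1, 0]

def Jmat : M2 := !![1, 0; 0, -1]

/-- `expB τ = e^{-τ B} = [[cos τ, -sin τ],[sin τ, cos τ]]`. -/
def expB (τ : ℂ) : M2 := !![Complex.cos τ, -Complex.sin τ; Complex.sin τ, Complex.cos τ]

/-- Lebesgue measure restricted to `(0,1)`. -/
def μ01 : Measure ℝ := volume.restrict (Set.Ioo 0 1)

/-- Lebesgue measure restricted to `(-1,1)`. -/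
def μ11 : Measure ℝ := volume.restrict (Set.Ioo (-1) 1)

/-- A Dirac-form potential `Q = [[q₁,q₂],[q₂,-q₁]]`. -/
def IsDiracForm (Q : ℝ → M2) : Prop :=
  ∃ q1 q2 : ℝ → ℂ, ∀ x, Q x = !![q1 x, q2 x; q2 x, -q1 x]

/-- A Dirac-form potential with real-valued entries. -/
def IsRealDiracForm (Q : ℝ → M2) : Prop :=
  ∃ q1 q2 : ℝ → ℝ, ∀ x, Q x = !![(q1 x : ℂ), (q2 x : ℂ); (q2 x : ℂ), -(q1 x : ℂ)]

/-- `U` is an absolutely continuous matrix solution of `B U' + Q U = λ U` a.e. on `(0,1)`. -/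
def IsMatSolution (Q : ℝ → M2) (l : ℂ) (U : ℝ → M2) : Prop :=
  ∃ U' : ℝ → M2, IntegrableOn U' (Set.Ioo 0 1) ∧
    (∀ x ∈ Set.Icc (0:ℝ) 1, U x = U 0 + ∫ t in (0:ℝ)..x, U' t) ∧
    (∀ᵐ x ∂μ01, Bmat * U' x + Q x * U x = l • U x)

/-- `u` is an absolutely continuous `ℂ²`-valued solution of `B u' + Q u = λ u` a.e. on `(0,1)`. -/
def IsVecSolution (Q : ℝ → M2) (l : ℂ) (u : ℝ → Fin 2 → ℂ) : Prop :=
  ∃ u' : ℝ → Fin 2 → ℂ, IntegrableOn u' (Set.Ioo 0 1) ∧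
    (∀ x ∈ Set.Icc (0:ℝ) 1, u x = u 0 + ∫ t in (0:ℝ)..x, u' t) ∧
    (∀ᵐ x ∂μ01, Bmat.mulVec (u' x) + (Q x).mulVec (u x) = l • u x)

/-- `λ` is an eigenvalue of the Dirac operator `A_j` (`j = 0` for `A₁`, `j = 1` for `A₂`):
there is a nonzero AC solution with `u₂(0) = 0` and `u_j(1) = 0`. -/
def IsEigenvalue (Q : ℝ → M2) (j : Fin 2) (l : ℝ) : Prop :=
  ∃ u : ℝ → Fin 2 → ℂ, IsVecSolution Q (l : ℂ) u ∧
    (∃ x ∈ Set.Icc (0:ℝ) 1, u x ≠ 0) ∧ u 0 1 = 0 ∧ u 1 j = 0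

/-- `c₀(·,λ) = (cos λx, sin λx)ᵗ`. -/
def c0 (l : ℂ) (x : ℝ) : Fin 2 → ℂ := ![Complex.cos (l * x), Complex.sin (l * x)]

/-- n-th Fourier coefficient `e_n(g) = ∫₀¹ e^{-2πinx} g(x) dx`. -/
def fc (g : ℝ → ℂ) (n : ℤ) : ℂ :=
  ∫ x in (0:ℝ)..1, Complex.exp (-2 * Real.pi * Complex.I * n * x) * g x

/-- The square of the `ℍ = L₂((0,1),ℂ²)` norm of `u`. -/
def hnormSq (u : ℝ → Fin 2 → ℂ) : ℝ :=
  ∫ x in Set.Ioo (0:ℝ) 1, (‖u x 0‖ ^ 2 + ‖u x 1‖ ^ 2)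

/-- The `ℂ²` inner product `⟨v,w⟩ = v₁ w̄₁ + v₂ w̄₂`. -/
def ip2 (v w : Fin 2 → ℂ) : ℂ := v 0 * star (w 0) + v 1 * star (w 1)

/-- The eigenvalue asymptotics `λ_n = π(n+1/2) + e_n(g)` for some `g ∈ L_p(0,1)`. -/
def LamAsymp (p : ℝ≥0∞) (lam : ℤ → ℝ) : Prop :=
  ∃ g : ℝ → ℂ, MemLp g p μ01 ∧
    ∀ n : ℤ, (lam n : ℂ) = Real.pi * (n + 1/2) + fc g n

/-- The eigenvalue asymptotics `μ_n = πn + e_n(g)` for some `g ∈ L_p(0,1)`. -/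
def MuAsymp (p : ℝ≥0∞) (mu : ℤ → ℝ) : Prop :=
  ∃ g : ℝ → ℂ, MemLp g p μ01 ∧
    ∀ n : ℤ, (mu n : ℂ) = Real.pi * n + fc g n

/-- The norming-constant asymptotics `α_n = 1 + e_n(g)` for some `g ∈ L_p(0,1)`. -/
def AlAsymp (p : ℝ≥0∞) (al : ℤ → ℝ) : Prop :=
  ∃ g : ℝ → ℂ, MemLp g p μ01 ∧ ∀ n : ℤ, (al n : ℂ) = 1 + fc g n

/-- Membership in the class `SD_p` of spectral data. -/
def MemSD (p : ℝ≥0∞) (lam mu : ℤ → ℝ) : Prop :=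
  (∀ n : ℤ, lam (n - 1) < mu n ∧ mu n < lam n) ∧ LamAsymp p lam ∧ MuAsymp p mu

/-- Membership in the kernel space `G_p(M₂)`: all slices lie in `L_p` and the slice maps are
continuous from `[0,1]` to `L_p((0,1),M₂)`. -/
def MemGp (p : ℝ≥0∞) (K : ℝ → ℝ → M2) : Prop :=
  (∀ x ∈ Set.Icc (0:ℝ) 1, MemLp (K x) p μ01) ∧
  (∀ t ∈ Set.Icc (0:ℝ) 1, MemLp (fun x => K x t) p μ01) ∧
  (∀ x₀ ∈ Set.Icc (0:ℝ) 1, ∀ ε > (0:ℝ), ∃ δ > (0:ℝ), ∀ x ∈ Set.Icc (0:ℝ) 1,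
    |x - x₀| < δ → eLpNorm (fun t => K x t - K x₀ t) p μ01 < ENNReal.ofReal ε) ∧
  (∀ t₀ ∈ Set.Icc (0:ℝ) 1, ∀ ε > (0:ℝ), ∃ δ > (0:ℝ), ∀ t ∈ Set.Icc (0:ℝ) 1,
    |t - t₀| < δ → eLpNorm (fun x => K x t - K x t₀) p μ01 < ENNReal.ofReal ε)

/-- The norm of the space `G_p(M₂)` (as an extended real number). -/
def gpNorm (p : ℝ≥0∞) (K : ℝ → ℝ → M2) : ℝ≥0∞ :=
  max (⨆ x ∈ Set.Icc (0:ℝ) 1, eLpNorm (K x) p μ01)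
      (⨆ t ∈ Set.Icc (0:ℝ) 1, eLpNorm (fun x => K x t) p μ01)

/-- `f` is absolutely continuous on `[0,1]` (second argument: the a.e. derivative). -/
def AC1 (f f' : ℝ → ℂ) : Prop :=
  IntegrableOn f' (Set.Ioo 0 1) ∧ ∀ x ∈ Set.Icc (0:ℝ) 1, f x = f 0 + ∫ t in (0:ℝ)..x, f' t

theorem ii_of_Ioo {E : Type*} [NormedAddCommGroup E] {f : ℝ → E} (h : IntegrableOn f (Set.Ioo 0 1)) :
    IntervalIntegrable f volume 0 1 := by
  rwa [intervalIntegrable_iff_integrableOn_Ioo_of_le zero_le_one]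

theorem ii_of_Ioo' {E : Type*} [NormedAddCommGroup E] {f : ℝ → E} (h : IntegrableOn f (Set.Ioo 0 1))
    {x : ℝ} (hx : x ∈ Set.Icc (0:ℝ) 1) :
    IntervalIntegrable f volume 0 x :=
  (ii_of_Ioo h).mono_set (by
    rw [uIcc_of_le hx.1, uIcc_of_le zero_le_one]; exact Icc_subset_Icc_right hx.2)

theorem AC1.continuousOn {f f' : ℝ → ℂ} (h : AC1 f f') : ContinuousOn f (Set.Icc 0 1) := by
  have h1 : ContinuousOn (fun x => f 0 + ∫ t in (0:ℝ)..x, f' t) (Set.Icc 0 1) := by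
    refine continuousOn_const.add ?_
    have := intervalIntegral.continuousOn_primitive_interval (f := f') (a := 0) (b := 1)
      (μ := volume) (by
        rw [uIcc_of_le zero_le_one]
        exact (integrableOn_Icc_iff_integrableOn_Ioo (f := f') (μ := volume)).mpr h.1)
    rwa [uIcc_of_le zero_le_one] at this
  exact h1.congr h.2

theorem ae_mem_uIoc_of_ae {p : ℝ → Prop} (h : ∀ᵐ x ∂μ01, p x) {x : ℝ} (hx : x ∈ Set.Icc (0:ℝ) 1) :
    ∀ᵐ t ∂volume, t ∈ Set.uIoc 0 x → p t := by
  unfold μ01 at h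
  rw [ae_restrict_iff' measurableSet_Ioo] at h
  have h1 : ∀ᵐ t ∂(volume : Measure ℝ), t ≠ 1 := by
    simp [ae_iff]
  filter_upwards [h, h1] with t ht ht1 hm
  rw [uIoc_of_le hx.1] at hm
  exact ht ⟨hm.1, lt_of_le_of_ne (hm.2.trans hx.2) ht1⟩

theorem AC1.congr {f f' g' : ℝ → ℂ} (h : AC1 f f') (hg : ∀ᵐ x ∂μ01, f' x = g' x) : AC1 f g' := by
  refine ⟨h.1.congr hg, fun x hx => ?_⟩
  rw [h.2 x hx, intervalIntegral.integral_congr_ae (ae_mem_uIoc_of_ae hg hx)]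

theorem AC1.add {f f' g g' : ℝ → ℂ} (h : AC1 f f') (k : AC1 g g') :
    AC1 (fun x => f x + g x) (fun x => f' x + g' x) := by
  refine ⟨h.1.add k.1, fun x hx => ?_⟩
  beta_reduce
  rw [intervalIntegral.integral_add (ii_of_Ioo' h.1 hx) (ii_of_Ioo' k.1 hx), h.2 x hx, k.2 x hx]
  ring

theorem AC1.const_mul {f f' : ℝ → ℂ} (a : ℂ) (h : AC1 f f') :
    AC1 (fun x => a * f x) (fun x => a * f' x) := by
  refine ⟨h.1.const_mul a, fun x hx => ?_⟩
  beta_reduce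
  rw [intervalIntegral.integral_const_mul, h.2 x hx]
  ring

theorem AC1.sub {f f' g g' : ℝ → ℂ} (h : AC1 f f') (k : AC1 g g') :
    AC1 (fun x => f x - g x) (fun x => f' x - g' x) := by
  have := h.add (k.const_mul (-1))
  simpa [sub_eq_add_neg] using this

theorem AC1.conj {f f' : ℝ → ℂ} (h : AC1 f f') :
    AC1 (fun x => (starRingEnd ℂ) (f x)) (fun x => (starRingEnd ℂ) (f' x)) := by
  refine ⟨?_, fun x hx => ?_⟩
  · exact (Complex.conjCLE.toContinuousLinearMap.integrable_comp h.1)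
  · beta_reduce
    rw [h.2 x hx, map_add]
    congr 1
    exact (Complex.conjCLE.toContinuousLinearMap.intervalIntegral_comp_comm
      (ii_of_Ioo' h.1 hx)).symm

theorem AC1.of_hasDerivAt {f f' : ℝ → ℂ} (h : ∀ x, HasDerivAt f (f' x) x) (hc : Continuous f') :
    AC1 f f' := by
  refine ⟨(hc.integrableOn_Icc (a := 0) (b := 1)).mono_set Ioo_subset_Icc_self, fun x hx => ?_⟩
  rw [intervalIntegral.integral_eq_sub_of_hasDerivAt (fun y _ => h y) (hc.intervalIntegrable _ _)]
  ring

theorem ac_const (a : ℂ) : AbsolutelyContinuousOnInterval (fun _ : ℝ => a) 0 1 :=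
  (LipschitzWith.const a).lipschitzOnWith.absolutelyContinuousOnInterval

theorem ac_primitive {f' : ℝ → ℂ} (h : IntegrableOn f' (Set.Ioo 0 1)) :
    AbsolutelyContinuousOnInterval (fun x => ∫ t in (0:ℝ)..x, f' t) 0 1 := by
  have hi := ii_of_Ioo h
  have hr : IntervalIntegrable (fun t => (f' t).re) volume 0 1 :=
    ⟨hi.1.re, hi.2.re⟩
  have him : IntervalIntegrable (fun t => (f' t).im) volume 0 1 :=
    ⟨hi.1.im, hi.2.im⟩
  have h1 := hr.absolutelyContinuousOnInterval_intervalIntegral (c := 0) (by simp)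
  have h2 := him.absolutelyContinuousOnInterval_intervalIntegral (c := 0) (by simp)
  have h3 := (h1.smul (ac_const 1)).add (h2.smul (ac_const I))
  rw [absolutelyContinuousOnInterval_iff] at h3 ⊢
  intro ε hε
  obtain ⟨δ, hδ, H⟩ := h3 ε hε
  refine ⟨δ, hδ, fun E hE hl => ?_⟩
  have key : ∀ x ∈ Set.uIcc (0:ℝ) 1, (∫ t in (0:ℝ)..x, f' t) =
    (((fun x => ∫ t in (0:ℝ)..x, (f' t).re) • (fun _ : ℝ => (1:ℂ))) +
      ((fun x => ∫ t in (0:ℝ)..x, (f' t).im) • (fun _ : ℝ => I))) x := by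
    intro x hx
    rw [uIcc_of_le zero_le_one] at hx
    have hix := ii_of_Ioo' h hx
    simp only [Pi.add_apply, Pi.smul_apply', Complex.real_smul, mul_one]
    rw [← intervalIntegral.integral_ofReal, ← intervalIntegral.integral_ofReal,
      ← intervalIntegral.integral_mul_const, ← intervalIntegral.integral_add]
    · simp
    · exact ⟨hix.1.re.ofReal, hix.2.re.ofReal⟩
    · exact IntervalIntegrable.mul_const ⟨hix.1.im.ofReal, hix.2.im.ofReal⟩ _
  have := H E hE hl
  refine lt_of_le_of_lt (le_of_eq (Finset.sum_congr rfl fun i hi => ?_)) this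
  have hE' := hE.1 i hi
  rw [key _ hE'.1, key _ hE'.2]

theorem AC1.mul {f f' g g' : ℝ → ℂ} (hf : AC1 f f') (hg : AC1 g g') :
    AC1 (fun x => f x * g x) (fun x => f' x * g x + f x * g' x) := by
  have hintg : IntegrableOn (fun x => f' x * g x + f x * g' x) (Set.Ioo 0 1) := by
    have e1 := (integrableOn_Icc_iff_integrableOn_Ioo (f := f') (μ := volume)).mpr hf.1
    have e2 := (integrableOn_Icc_iff_integrableOn_Ioo (f := g') (μ := volume)).mpr hg.1
    exact ((e1.mul_continuousOn hg.continuousOn isCompact_Icc).add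
      (e2.continuousOn_mul hf.continuousOn isCompact_Icc)).mono_set Ioo_subset_Icc_self
  refine ⟨hintg, ?_⟩
  set F : ℝ → ℂ := fun x => f 0 + ∫ t in (0:ℝ)..x, f' t with hF
  set G : ℝ → ℂ := fun x => g 0 + ∫ t in (0:ℝ)..x, g' t with hG
  have aF : AbsolutelyContinuousOnInterval F 0 1 := (ac_const (f 0)).add (ac_primitive hf.1)
  have aG : AbsolutelyContinuousOnInterval G 0 1 := (ac_const (g 0)).add (ac_primitive hg.1)
  have aH := (aF.smul aG).sub (ac_primitive hintg)
  have hd : ∀ᵐ x, x ∈ uIcc (0:ℝ) 1 → HasDerivAt (F • G - fun x => ∫ t in (0:ℝ)..x, (f' t * g t + f t * g' t)) 0 x := by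
    filter_upwards [(ii_of_Ioo hf.1).ae_hasDerivAt_integral,
      (ii_of_Ioo hg.1).ae_hasDerivAt_integral,
      (ii_of_Ioo hintg).ae_hasDerivAt_integral] with x h1 h2 h3 hx
    have d1 := (h1 hx 0 (by simp)).const_add (f 0)
    have d2 := (h2 hx 0 (by simp)).const_add (g 0)
    have d3 := h3 hx 0 (by simp)
    have d4 := (d1.mul d2).sub d3
    rw [uIcc_of_le zero_le_one] at hx
    rw [← hf.2 x hx, ← hg.2 x hx] at d4
    rw [← sub_self (f' x * g x + f x * g' x)]
    exact d4
  obtain ⟨C, hC⟩ := aH.const_of_ae_hasDerivAt_zero hd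
  rw [uIcc_of_le zero_le_one] at hC
  intro x hx
  have e0 := hC 0 (by simp)
  have ex := hC x hx
  simp only [Pi.sub_apply, smul_eq_mul, Pi.mul_apply, intervalIntegral.integral_same, sub_zero,
    hF, hG, add_zero] at e0 ex
  rw [← hf.2 x hx, ← hg.2 x hx, ← e0] at ex
  linear_combination ex

theorem AC1.const (a : ℂ) : AC1 (fun _ => a) (fun _ => 0) :=
  AC1.of_hasDerivAt (fun x => hasDerivAt_const x a) continuous_const

theorem AC1.pow {f f' : ℝ → ℂ} (hf : AC1 f f') (n : ℕ) :
    AC1 (fun x => f x ^ (n + 1)) (fun x => (n + 1) * f' x * f x ^ n) := by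
  induction n with
  | zero => simpa using hf
  | succ n ih =>
    have := ih.mul hf
    convert this using 2 <;> (push_cast; ring)

theorem prim_pow {k : ℝ → ℝ} (hk : IntegrableOn k (Set.Ioo 0 1)) (n : ℕ) {x : ℝ}
    (hx : x ∈ Set.Icc (0:ℝ) 1) :
    ∫ t in (0:ℝ)..x, k t * (∫ s in (0:ℝ)..t, k s) ^ n / n.factorial =
      (∫ s in (0:ℝ)..x, k s) ^ (n + 1) / (n + 1).factorial := by
  have h1 : AC1 (fun x => ((∫ s in (0:ℝ)..x, k s : ℝ) : ℂ)) (fun x => (k x : ℂ)) := by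
    refine ⟨hk.ofReal, fun x hx => ?_⟩
    simp [intervalIntegral.integral_ofReal]
  have h2 := ((h1.pow n).const_mul (1 / (n + 1).factorial)).2 x hx
  simp only [intervalIntegral.integral_same, ofReal_zero, ne_eq, Nat.add_eq_zero_iff, one_ne_zero,
    and_false, not_false_eq_true, zero_pow, mul_zero, zero_add] at h2
  have h3 : ∀ t : ℝ, (1 / ((n + 1).factorial : ℂ)) * (((n : ℂ) + 1) * (k t : ℂ) * ((∫ s in (0:ℝ)..t, k s : ℝ) : ℂ) ^ n)
     = ((k t * (∫ s in (0:ℝ)..t, k s) ^ n / n.factorial : ℝ) : ℂ) := by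
    intro t
    have h4 : (n.factorial : ℂ) ≠ 0 := by exact_mod_cast n.factorial_ne_zero
    have h5 : (n : ℂ) + 1 ≠ 0 := by exact_mod_cast n.succ_ne_zero
    rw [Nat.factorial_succ]
    push_cast
    field_simp
  simp_rw [h3] at h2
  rw [intervalIntegral.integral_ofReal] at h2
  have h6 := congrArg Complex.re h2
  rw [Complex.ofReal_re] at h6
  rw [← h6]
  have : (1 / ((n + 1).factorial : ℂ)) * ((∫ s in (0:ℝ)..x, k s : ℝ) : ℂ) ^ (n + 1) =
    (((∫ s in (0:ℝ)..x, k s) ^ (n + 1) / (n + 1).factorial : ℝ) : ℂ) := by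
    push_cast; ring
  rw [this, Complex.ofReal_re]

/-- Gronwall inequality with integrable kernel. -/
theorem gronwall_L1 {k m : ℝ → ℝ} {ε : ℝ} (hk : IntegrableOn k (Set.Ioo 0 1))
    (hk0 : ∀ x, 0 ≤ k x) (hm : ContinuousOn m (Set.Icc 0 1)) 
    (h : ∀ x ∈ Set.Icc (0:ℝ) 1, m x ≤ ε + ∫ t in (0:ℝ)..x, k t * m t) :
    ∀ x ∈ Set.Icc (0:ℝ) 1, m x ≤ ε * Real.exp (∫ t in (0:ℝ)..x, k t) := by
  obtain ⟨M, hM⟩ := isCompact_Icc.bddAbove_image hm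
  have hM' : ∀ x ∈ Set.Icc (0:ℝ) 1, m x ≤ M := fun x hx => hM (mem_image_of_mem _ hx)
  set K : ℝ → ℝ := fun x => ∫ s in (0:ℝ)..x, k s with hK
  have hkI := (integrableOn_Icc_iff_integrableOn_Ioo (f := k) (μ := volume)).mpr hk
  have hKc : ContinuousOn K (Set.Icc 0 1) := by
    have := intervalIntegral.continuousOn_primitive_interval (f := k) (a := 0) (b := 1)
      (μ := volume) (by rwa [uIcc_of_le zero_le_one])
    rwa [uIcc_of_le zero_le_one] at this
  have key : ∀ n : ℕ, ∀ x ∈ Set.Icc (0:ℝ) 1,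
      m x ≤ ε * (∑ j ∈ Finset.range n, K x ^ j / j.factorial) + M * (K x ^ n / n.factorial) := by
    intro n
    induction n with
    | zero => intro x hx; simpa using hM' x hx
    | succ n ih =>
      intro x hx
      refine (h x hx).trans ?_
      have hintg : ∀ j : ℕ, IntervalIntegrable (fun t => k t * K t ^ j / j.factorial) volume 0 x := by
        intro j
        have e := (hkI.mul_continuousOn (hKc.pow j) isCompact_Icc).div_const (j.factorial : ℝ)
        exact ii_of_Ioo' (IntegrableOn.mono_set e Ioo_subset_Icc_self) hx
      have h1 : ∫ t in (0:ℝ)..x, k t * m t ≤ ∫ t in (0:ℝ)..x,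
          (ε * (∑ j ∈ Finset.range n, k t * K t ^ j / j.factorial) +
            M * (k t * K t ^ n / n.factorial)) := by
        refine intervalIntegral.integral_mono_on hx.1 ?_ ?_ ?_
        · exact ii_of_Ioo' (IntegrableOn.mono_set (hkI.mul_continuousOn hm isCompact_Icc)
            Ioo_subset_Icc_self) hx
        · have hs := IntervalIntegrable.sum (μ := volume) (a := 0) (b := x) (Finset.range n)
            (f := fun (j : ℕ) t => k t * K t ^ j / j.factorial) (fun j _ => hintg j)
          have e : (fun t => ∑ j ∈ Finset.range n, k t * K t ^ j / j.factorial) = 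
            ∑ j ∈ Finset.range n, (fun t => k t * K t ^ j / j.factorial) := by
              ext t; simp
          exact IntervalIntegrable.add (IntervalIntegrable.const_mul (by rw [e]; exact hs) ε)
            ((hintg n).const_mul M)
        · intro t ht
          have := mul_le_mul_of_nonneg_left (ih t ⟨ht.1, ht.2.trans hx.2⟩) (hk0 t)
          refine this.trans (le_of_eq ?_)
          have e : ∑ j ∈ Finset.range n, k t * K t ^ j / j.factorial
             = k t * ∑ j ∈ Finset.range n, K t ^ j / j.factorial := by
            rw [Finset.mul_sum]; exact Finset.sum_congr rfl fun j _ => by ring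
          rw [e]; ring
      have hs : IntervalIntegrable (fun t => ∑ j ∈ Finset.range n, k t * K t ^ j / j.factorial)
          volume 0 x := by
        have hs := IntervalIntegrable.sum (μ := volume) (a := 0) (b := x) (Finset.range n)
            (f := fun (j : ℕ) t => k t * K t ^ j / j.factorial) (fun j _ => hintg j)
        have e : (fun t => ∑ j ∈ Finset.range n, k t * K t ^ j / j.factorial) = 
            ∑ j ∈ Finset.range n, (fun t => k t * K t ^ j / j.factorial) := by
              ext t; simp
        rw [e]; exact hs
      rw [intervalIntegral.integral_add (hs.const_mul ε) ((hintg n).const_mul M),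
        intervalIntegral.integral_const_mul, intervalIntegral.integral_const_mul,
        intervalIntegral.integral_finsetSum (fun j _ => hintg j), prim_pow hk n hx] at h1
      rw [Finset.sum_congr rfl (fun j _ => prim_pow hk j hx)] at h1
      rw [Finset.sum_range_succ']
      simp only [pow_zero, Nat.factorial_zero, Nat.cast_one, div_one]
      rw [mul_add, mul_one]
      linarith
  intro x hx
  have t1 : Tendsto (fun n => ∑ j ∈ Finset.range n, K x ^ j / j.factorial) atTop
      (nhds (Real.exp (K x))) := by
    have := (NormedSpace.expSeries_div_hasSum_exp (K x)).tendsto_sum_nat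
    rwa [← Real.exp_eq_exp_ℝ] at this
  have t2 : Tendsto (fun n : ℕ => K x ^ n / n.factorial) atTop (nhds 0) :=
    FloorSemiring.tendsto_pow_div_factorial_atTop (K x)
  have t3 := (t1.const_mul ε).add (t2.const_mul M)
  rw [mul_zero, add_zero] at t3
  exact ge_of_tendsto' t3 (fun n => key n x hx)

/-- Scalar form of the Dirac system on `[0,1]`. -/
def DSol (q1 q2 : ℝ → ℝ) (l : ℂ) (u1 u2 : ℝ → ℂ) : Prop :=
  AC1 u1 (fun x => -l * u2 x + q2 x * u1 x - q1 x * u2 x) ∧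
  AC1 u2 (fun x => l * u1 x - q1 x * u1 x - q2 x * u2 x)

theorem IsVecSolution.dsol {Q : ℝ → M2} {q1 q2 : ℝ → ℝ}
    (hQ : ∀ x, Q x = !![(q1 x : ℂ), (q2 x : ℂ); (q2 x : ℂ), -(q1 x : ℂ)])
    {l : ℂ} {u : ℝ → Fin 2 → ℂ} (h : IsVecSolution Q l u) :
    DSol q1 q2 l (fun x => u x 0) (fun x => u x 1) := by
  obtain ⟨u', hi, hu, he⟩ := h
  have comp : ∀ j : Fin 2, AC1 (fun x => u x j) (fun x => u' x j) := by
    intro j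
    refine ⟨(ContinuousLinearMap.proj (R := ℂ) (φ := fun _ : Fin 2 => ℂ) j).integrable_comp hi,
      fun x hx => ?_⟩
    have := (ContinuousLinearMap.proj (R := ℂ) (φ := fun _ : Fin 2 => ℂ) j).intervalIntegral_comp_comm
      (ii_of_Ioo' hi hx)
    simp only [ContinuousLinearMap.proj_apply] at this
    rw [this]
    have h2 := congrFun (hu x hx) j
    simpa using h2
  constructor
  · refine (comp 0).congr ?_
    filter_upwards [he] with x hx
    have h1 := congrFun hx 1
    rw [hQ x] at h1
    simp [Bmat, Matrix.mulVec, dotProduct, Fin.sum_univ_two] at h1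
    linear_combination -h1
  · refine (comp 1).congr ?_
    filter_upwards [he] with x hx
    have h1 := congrFun hx 0
    rw [hQ x] at h1
    simp [Bmat, Matrix.mulVec, dotProduct, Fin.sum_univ_two] at h1
    linear_combination h1

theorem DSol.conj {q1 q2 : ℝ → ℝ} {l : ℂ} {u1 u2 : ℝ → ℂ} (h : DSol q1 q2 l u1 u2) :
    DSol q1 q2 ((starRingEnd ℂ) l) (fun x => (starRingEnd ℂ) (u1 x))
      (fun x => (starRingEnd ℂ) (u2 x)) := by
  constructor
  · convert h.1.conj using 2
    simp
  · convert h.2.conj using 2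
    simp

theorem gron_pair {k : ℝ → ℝ} (hk : IntegrableOn k (Set.Ioo 0 1)) (hk0 : ∀ x, 0 ≤ k x)
    {u1 u2 d1 d2 : ℝ → ℂ} (h1 : AC1 u1 d1) (h2 : AC1 u2 d2) {δ ε : ℝ} (hε : 0 ≤ ε)
    (hδ1 : ‖u1 0‖ ≤ δ) (hδ2 : ‖u2 0‖ ≤ δ)
    (hd1 : ∀ x ∈ Set.Icc (0:ℝ) 1, ‖d1 x‖ ≤ k x * max ‖u1 x‖ ‖u2 x‖ + ε)
    (hd2 : ∀ x ∈ Set.Icc (0:ℝ) 1, ‖d2 x‖ ≤ k x * max ‖u1 x‖ ‖u2 x‖ + ε) :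
    ∀ x ∈ Set.Icc (0:ℝ) 1, max ‖u1 x‖ ‖u2 x‖ ≤ (δ + ε) * Real.exp (∫ t in (0:ℝ)..1, k t) := by
  have hm : ContinuousOn (fun x => max ‖u1 x‖ ‖u2 x‖) (Set.Icc 0 1) :=
    h1.continuousOn.norm.sup h2.continuousOn.norm
  have hkI := (integrableOn_Icc_iff_integrableOn_Ioo (f := k) (μ := volume)).mpr hk
  have hkm : IntegrableOn (fun x => k x * max ‖u1 x‖ ‖u2 x‖) (Set.Ioo 0 1) :=
    (hkI.mul_continuousOn hm isCompact_Icc).mono_set Ioo_subset_Icc_self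
  have aux : ∀ {u d : ℝ → ℂ}, AC1 u d → ‖u 0‖ ≤ δ →
      (∀ x ∈ Set.Icc (0:ℝ) 1, ‖d x‖ ≤ k x * max ‖u1 x‖ ‖u2 x‖ + ε) →
      ∀ x ∈ Set.Icc (0:ℝ) 1, ‖u x‖ ≤ (δ + ε) + ∫ t in (0:ℝ)..x, k t * max ‖u1 t‖ ‖u2 t‖ := by
    intro u d hu h0 hd x hx
    rw [hu.2 x hx]
    have e1 : ‖∫ t in (0:ℝ)..x, d t‖ ≤ ∫ t in (0:ℝ)..x, (k t * max ‖u1 t‖ ‖u2 t‖ + ε) := by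
      refine (intervalIntegral.norm_integral_le_integral_norm hx.1).trans ?_
      refine intervalIntegral.integral_mono_on hx.1 (ii_of_Ioo' hu.1 hx).norm
        ((ii_of_Ioo' hkm hx).add (by simp)) ?_
      intro t ht
      exact hd t ⟨ht.1, ht.2.trans hx.2⟩
    rw [intervalIntegral.integral_add (ii_of_Ioo' hkm hx) (by simp)] at e1
    simp only [intervalIntegral.integral_const, sub_zero, smul_eq_mul] at e1
    have e2 := norm_add_le (u 0) (∫ t in (0:ℝ)..x, d t)
    have e3 : x * ε ≤ ε := by nlinarith [hx.2]
    linarith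
  intro x hx
  refine (gronwall_L1 hk hk0 hm (ε := δ + ε) ?_ x hx).trans ?_
  · intro y hy
    exact max_le (aux h1 hδ1 hd1 y hy) (aux h2 hδ2 hd2 y hy)
  · have : 0 ≤ δ := (norm_nonneg _).trans hδ1
    gcongr
    refine intervalIntegral.integral_mono_interval le_rfl hx.1 hx.2 ?_ (ii_of_Ioo hk)
    exact Eventually.of_forall hk0

theorem DSol.add_inh {q1 q2 : ℝ → ℝ} (hq1 : IntegrableOn q1 (Set.Ioo 0 1))
    (hq2 : IntegrableOn q2 (Set.Ioo 0 1)) {l : ℂ} {u1 u2 F1 F2 : ℝ → ℂ} {δ ε : ℝ} (hε : 0 ≤ ε)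
    (h1 : AC1 u1 (fun x => -l * u2 x + q2 x * u1 x - q1 x * u2 x + F1 x))
    (h2 : AC1 u2 (fun x => l * u1 x - q1 x * u1 x - q2 x * u2 x + F2 x))
    (hδ1 : ‖u1 0‖ ≤ δ) (hδ2 : ‖u2 0‖ ≤ δ)
    (hF1 : ∀ x ∈ Set.Icc (0:ℝ) 1, ‖F1 x‖ ≤ ε) (hF2 : ∀ x ∈ Set.Icc (0:ℝ) 1, ‖F2 x‖ ≤ ε) :
    ∀ x ∈ Set.Icc (0:ℝ) 1, ‖u1 x‖ ≤ (δ + ε) * Real.exp (‖l‖ + ∫ t in (0:ℝ)..1, (|q1 t| + |q2 t|)) ∧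
      ‖u2 x‖ ≤ (δ + ε) * Real.exp (‖l‖ + ∫ t in (0:ℝ)..1, (|q1 t| + |q2 t|)) := by
  have hq : IntegrableOn (fun t => |q1 t| + |q2 t|) (Set.Ioo 0 1) := hq1.abs.add hq2.abs
  have hk : IntegrableOn (fun t => ‖l‖ + (|q1 t| + |q2 t|)) (Set.Ioo 0 1) :=
    (integrableOn_const (by simp)).add hq
  have key := gron_pair hk (fun x => by positivity) h1 h2 hε hδ1 hδ2 ?_ ?_
  · intro x hx
    have := key x hx
    rw [intervalIntegral.integral_add (by simp) (ii_of_Ioo hq)] at this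
    simp only [intervalIntegral.integral_const, sub_zero, one_smul] at this
    exact max_le_iff.mp this
  · intro x hx
    refine (norm_add_le _ _).trans (add_le_add ?_ (hF1 x hx))
    have m1 := le_max_left ‖u1 x‖ ‖u2 x‖
    have m2 := le_max_right ‖u1 x‖ ‖u2 x‖
    calc _ ≤ ‖-l * u2 x‖ + ‖q2 x * u1 x‖ + ‖q1 x * u2 x‖ :=
          (norm_sub_le _ _).trans (by gcongr; exact norm_add_le _ _)
      _ = ‖l‖ * ‖u2 x‖ + |q2 x| * ‖u1 x‖ + |q1 x| * ‖u2 x‖ := by simp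
      _ ≤ ‖l‖ * max ‖u1 x‖ ‖u2 x‖ + |q2 x| * max ‖u1 x‖ ‖u2 x‖ + |q1 x| * max ‖u1 x‖ ‖u2 x‖ := by
          gcongr
      _ = _ := by ring
  · intro x hx
    refine (norm_add_le _ _).trans (add_le_add ?_ (hF2 x hx))
    have m1 := le_max_left ‖u1 x‖ ‖u2 x‖
    have m2 := le_max_right ‖u1 x‖ ‖u2 x‖
    calc _ ≤ ‖l * u1 x‖ + ‖q1 x * u1 x‖ + ‖q2 x * u2 x‖ :=
          (norm_sub_le _ _).trans (by gcongr; exact norm_sub_le _ _)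
      _ = ‖l‖ * ‖u1 x‖ + |q1 x| * ‖u1 x‖ + |q2 x| * ‖u2 x‖ := by simp
      _ ≤ ‖l‖ * max ‖u1 x‖ ‖u2 x‖ + |q1 x| * max ‖u1 x‖ ‖u2 x‖ + |q2 x| * max ‖u1 x‖ ‖u2 x‖ := by
          gcongr
      _ = _ := by ring

theorem DSol.unique {q1 q2 : ℝ → ℝ} (hq1 : IntegrableOn q1 (Set.Ioo 0 1))
    (hq2 : IntegrableOn q2 (Set.Ioo 0 1)) {l : ℂ} {u1 u2 v1 v2 : ℝ → ℂ}
    (hu : DSol q1 q2 l u1 u2) (hv : DSol q1 q2 l v1 v2) (a : ℂ) (h1 : u1 0 = a * v1 0)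
    (h2 : u2 0 = a * v2 0) : ∀ x ∈ Set.Icc (0:ℝ) 1, u1 x = a * v1 x ∧ u2 x = a * v2 x := by
  intro x hx
  have := DSol.add_inh hq1 hq2 (l := l) (u1 := fun x => u1 x - a * v1 x)
    (u2 := fun x => u2 x - a * v2 x) (F1 := fun _ => 0) (F2 := fun _ => 0) (δ := 0) (ε := 0) le_rfl
    ?_ ?_ (by simp [h1]) (by simp [h2]) (by simp) (by simp) x hx
  · simpa [sub_eq_zero] using this
  · convert hu.1.sub (hv.1.const_mul a) using 2
    ring
  · convert hu.2.sub (hv.2.const_mul a) using 2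
    ring

theorem DSol.wronskian {q1 q2 : ℝ → ℝ} {l m : ℂ} {u1 u2 v1 v2 : ℝ → ℂ}
    (hu : DSol q1 q2 l u1 u2) (hv : DSol q1 q2 m v1 v2) :
    u1 1 * v2 1 - u2 1 * v1 1 = u1 0 * v2 0 - u2 0 * v1 0 +
      (m - l) * ∫ x in (0:ℝ)..1, (u1 x * v1 x + u2 x * v2 x) := by
  have h := ((hu.1.mul hv.2).sub (hu.2.mul hv.1)).2 1 (by simp)
  rw [← intervalIntegral.integral_const_mul]
  beta_reduce at h
  rw [h]
  congr 1
  refine intervalIntegral.integral_congr fun x _ => ?_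
  ring

/-- The family of solutions normalised at zero. -/
structure CFam (q1 q2 : ℝ → ℝ) (C1 C2 : ℂ → ℝ → ℂ) : Prop where
  hq1 : IntegrableOn q1 (Set.Ioo 0 1)
  hq2 : IntegrableOn q2 (Set.Ioo 0 1)
  sol : ∀ l, DSol q1 q2 l (C1 l) (C2 l)
  i1 : ∀ l, C1 l 0 = 1
  i2 : ∀ l, C2 l 0 = 0

namespace CFam

variable {q1 q2 : ℝ → ℝ} {C1 C2 : ℂ → ℝ → ℂ}

theorem bdd (H : CFam q1 q2 C1 C2) (ρ : ℝ) : ∃ B : ℝ, 0 ≤ B ∧ ∀ l, ‖l‖ ≤ ρ → ∀ x ∈ Set.Icc (0:ℝ) 1,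
    ‖C1 l x‖ ≤ B ∧ ‖C2 l x‖ ≤ B := by
  refine ⟨Real.exp (ρ + ∫ t in (0:ℝ)..1, (|q1 t| + |q2 t|)), (Real.exp_pos _).le, fun l hl x hx => ?_⟩
  have := DSol.add_inh H.hq1 H.hq2 (l := l) (u1 := C1 l) (u2 := C2 l) (F1 := fun _ => 0)
    (F2 := fun _ => 0) (δ := 1) (ε := 0) le_rfl (by simpa using (H.sol l).1)
    (by simpa using (H.sol l).2) (by simp [H.i1]) (by simp [H.i2]) (by simp) (by simp) x hx
  have hle : Real.exp (‖l‖ + ∫ t in (0:ℝ)..1, (|q1 t| + |q2 t|)) ≤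
    Real.exp (ρ + ∫ t in (0:ℝ)..1, (|q1 t| + |q2 t|)) := by gcongr
  simp only [add_zero, one_mul] at this
  exact ⟨this.1.trans hle, this.2.trans hle⟩

theorem lip (H : CFam q1 q2 C1 C2) (ρ : ℝ) : ∃ B : ℝ, 0 ≤ B ∧ ∀ l m, ‖l‖ ≤ ρ → ‖m‖ ≤ ρ →
    ∀ x ∈ Set.Icc (0:ℝ) 1,
    ‖C1 m x - C1 l x‖ ≤ B * ‖m - l‖ ∧ ‖C2 m x - C2 l x‖ ≤ B * ‖m - l‖ := by
  obtain ⟨B, hB, hb⟩ := H.bdd ρ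
  refine ⟨B * Real.exp (ρ + ∫ t in (0:ℝ)..1, (|q1 t| + |q2 t|)), by positivity,
    fun l m hl hm x hx => ?_⟩
  have := DSol.add_inh H.hq1 H.hq2 (l := l) (u1 := fun x => C1 m x - C1 l x)
    (u2 := fun x => C2 m x - C2 l x) (F1 := fun x => -(m - l) * C2 m x)
    (F2 := fun x => (m - l) * C1 m x) (δ := 0) (ε := ‖m - l‖ * B) (by positivity) ?_ ?_
    (by simp [H.i1]) (by simp [H.i2]) ?_ ?_ x hx
  · have hle : Real.exp (‖l‖ + ∫ t in (0:ℝ)..1, (|q1 t| + |q2 t|)) ≤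
      Real.exp (ρ + ∫ t in (0:ℝ)..1, (|q1 t| + |q2 t|)) := by gcongr
    have e : (0 + ‖m - l‖ * B) * Real.exp (‖l‖ + ∫ t in (0:ℝ)..1, (|q1 t| + |q2 t|)) ≤
      B * Real.exp (ρ + ∫ t in (0:ℝ)..1, (|q1 t| + |q2 t|)) * ‖m - l‖ := by
      rw [zero_add]
      calc _ ≤ ‖m - l‖ * B * Real.exp (ρ + ∫ t in (0:ℝ)..1, (|q1 t| + |q2 t|)) := by gcongr
        _ = _ := by ring
    exact ⟨this.1.trans e, this.2.trans e⟩
  · convert (H.sol m).1.sub (H.sol l).1 using 2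
    ring
  · convert (H.sol m).2.sub (H.sol l).2 using 2
    ring
  · intro y hy
    rw [norm_mul, norm_neg]
    gcongr
    exact (hb m hm y hy).2
  · intro y hy
    rw [norm_mul]
    gcongr
    exact (hb m hm y hy).1

theorem slope_lip (H : CFam q1 q2 C1 C2) (l : ℂ) : ∃ B : ℝ, 0 ≤ B ∧ ∀ m n, m ≠ l → n ≠ l →
    ‖m - l‖ ≤ 1 → ‖n - l‖ ≤ 1 →
    ‖(C1 m 1 - C1 l 1) / (m - l) - (C1 n 1 - C1 l 1) / (n - l)‖ ≤ B * ‖m - n‖ ∧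
    ‖(C2 m 1 - C2 l 1) / (m - l) - (C2 n 1 - C2 l 1) / (n - l)‖ ≤ B * ‖m - n‖ := by
  obtain ⟨B, hB, hb⟩ := H.lip (‖l‖ + 1)
  refine ⟨B * Real.exp (‖l‖ + ∫ t in (0:ℝ)..1, (|q1 t| + |q2 t|)), by positivity,
    fun m n hm hn hm1 hn1 => ?_⟩
  have hml : m - l ≠ 0 := sub_ne_zero.mpr hm
  have hnl : n - l ≠ 0 := sub_ne_zero.mpr hn
  have hm2 : ‖m‖ ≤ ‖l‖ + 1 := by
    have := norm_add_le (m - l) l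
    simp only [sub_add_cancel] at this; linarith
  have hn2 : ‖n‖ ≤ ‖l‖ + 1 := by
    have := norm_add_le (n - l) l
    simp only [sub_add_cancel] at this; linarith
  have := DSol.add_inh H.hq1 H.hq2 (l := l)
    (u1 := fun x => (m - l)⁻¹ * (C1 m x - C1 l x) - (n - l)⁻¹ * (C1 n x - C1 l x))
    (u2 := fun x => (m - l)⁻¹ * (C2 m x - C2 l x) - (n - l)⁻¹ * (C2 n x - C2 l x))
    (F1 := fun x => -(C2 m x - C2 n x))
    (F2 := fun x => C1 m x - C1 n x) (δ := 0) (ε := B * ‖m - n‖) (by positivity) ?_ ?_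
    (by simp [H.i1]) (by simp [H.i2]) ?_ ?_ 1 (by simp)
  · simp only [zero_add] at this
    rw [div_eq_inv_mul, div_eq_inv_mul, div_eq_inv_mul, div_eq_inv_mul]
    refine ⟨this.1.trans (le_of_eq (by ring)), this.2.trans (le_of_eq (by ring))⟩
  · convert (((H.sol m).1.sub (H.sol l).1).const_mul (m - l)⁻¹).sub
      (((H.sol n).1.sub (H.sol l).1).const_mul (n - l)⁻¹) using 2
    field_simp
    ring
  · convert (((H.sol m).2.sub (H.sol l).2).const_mul (m - l)⁻¹).sub
      (((H.sol n).2.sub (H.sol l).2).const_mul (n - l)⁻¹) using 2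
    field_simp
    ring
  · intro y hy
    rw [norm_neg]
    exact (hb n m hn2 hm2 y hy).2
  · intro y hy
    exact (hb n m hn2 hm2 y hy).1

theorem _root_.differentiableAt_of_slope_lip {f : ℂ → ℂ} {l : ℂ} {B : ℝ} (hB : 0 ≤ B)
    (h : ∀ m n, m ≠ l → n ≠ l → ‖m - l‖ ≤ 1 → ‖n - l‖ ≤ 1 →
      ‖(f m - f l) / (m - l) - (f n - f l) / (n - l)‖ ≤ B * ‖m - n‖) : DifferentiableAt ℂ f l := by
  have hc : Cauchy (map (slope f l) (nhdsWithin l {l}ᶜ)) := by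
    rw [Metric.cauchy_iff]
    refine ⟨inferInstance, fun ε hε => ?_⟩
    set r := min 1 (ε / (4 * (B + 1))) with hr
    have hr0 : 0 < r := lt_min one_pos (by positivity)
    refine ⟨slope f l '' (Metric.ball l r ∩ {l}ᶜ), image_mem_map ?_, ?_⟩
    · exact inter_mem (mem_nhdsWithin_of_mem_nhds (Metric.ball_mem_nhds l hr0)) self_mem_nhdsWithin
    · rintro _ ⟨m, ⟨hm, hm'⟩, rfl⟩ _ ⟨n, ⟨hn, hn'⟩, rfl⟩
      rw [Metric.mem_ball, dist_eq_norm] at hm hn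
      have := h m n hm' hn' (hm.le.trans (min_le_left _ _)) (hn.le.trans (min_le_left _ _))
      rw [slope_def_field, slope_def_field, dist_eq_norm]
      have h3 : ‖m - n‖ ≤ 2 * r := by
        have := norm_sub_le (m - l) (n - l)
        simp only [sub_sub_sub_cancel_right] at this; linarith
      have h4 : r ≤ ε / (4 * (B + 1)) := min_le_right _ _
      rw [le_div_iff₀ (by positivity)] at h4
      have : B * ‖m - n‖ ≤ B * (2 * r) := by gcongr
      nlinarith
  obtain ⟨d, hd⟩ := CompleteSpace.complete hc
  exact (hasDerivAt_iff_tendsto_slope.mpr hd).differentiableAt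

theorem diff1 (H : CFam q1 q2 C1 C2) : Differentiable ℂ (fun l => C1 l 1) := by
  intro l
  obtain ⟨B, hB, hb⟩ := H.slope_lip l
  exact differentiableAt_of_slope_lip hB fun m n a b c d => (hb m n a b c d).1

theorem diff2 (H : CFam q1 q2 C1 C2) : Differentiable ℂ (fun l => C2 l 1) := by
  intro l
  obtain ⟨B, hB, hb⟩ := H.slope_lip l
  exact differentiableAt_of_slope_lip hB fun m n a b c d => (hb m n a b c d).2

theorem wr (H : CFam q1 q2 C1 C2) (l m : ℂ) :
    (starRingEnd ℂ) (C1 l 1) * C2 m 1 - (starRingEnd ℂ) (C2 l 1) * C1 m 1 =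
      (m - (starRingEnd ℂ) l) * ∫ x in (0:ℝ)..1, ((starRingEnd ℂ) (C1 l x) * C1 m x +
        (starRingEnd ℂ) (C2 l x) * C2 m x) := by
  have := (H.sol l).conj.wronskian (H.sol m)
  simpa [H.i1, H.i2] using this

theorem int_ne (H : CFam q1 q2 C1 C2) (l : ℂ) :
    ∫ x in (0:ℝ)..1, ((starRingEnd ℂ) (C1 l x) * C1 l x +
        (starRingEnd ℂ) (C2 l x) * C2 l x) ≠ 0 := by
  have e : ∀ x, ((starRingEnd ℂ) (C1 l x) * C1 l x + (starRingEnd ℂ) (C2 l x) * C2 l x) =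
    ((‖C1 l x‖ ^ 2 + ‖C2 l x‖ ^ 2 : ℝ) : ℂ) := by
    intro x
    rw [← Complex.normSq_eq_conj_mul_self, ← Complex.normSq_eq_conj_mul_self,
      Complex.normSq_eq_norm_sq, Complex.normSq_eq_norm_sq]
    push_cast; rfl
  simp_rw [e]
  rw [intervalIntegral.integral_ofReal]
  have : 0 < ∫ x in (0:ℝ)..1, (‖C1 l x‖ ^ 2 + ‖C2 l x‖ ^ 2) := by
    refine intervalIntegral.integral_pos one_pos ?_ (fun x _ => by positivity) ⟨0, by simp, by simp [H.i1, H.i2]⟩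
    exact ((H.sol l).1.continuousOn.norm.pow 2).add ((H.sol l).2.continuousOn.norm.pow 2)
  exact_mod_cast this.ne'

theorem real_zero (H : CFam q1 q2 C1 C2) {l : ℂ} (h : C1 l 1 = 0 ∨ C2 l 1 = 0) : l.im = 0 := by
  have h1 := H.wr l l
  have h2 : (l - (starRingEnd ℂ) l) = 0 := by
    have : (starRingEnd ℂ) (C1 l 1) * C2 l 1 - (starRingEnd ℂ) (C2 l 1) * C1 l 1 = 0 := by
      rcases h with h | h <;> simp [h]
    rw [this] at h1
    exact (mul_eq_zero.mp h1.symm).resolve_right (H.int_ne l)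
  have := congrArg Complex.im h2
  simp at this
  linarith

theorem cont_int (H : CFam q1 q2 C1 C2) (l : ℂ) :
    Tendsto (fun m => ∫ x in (0:ℝ)..1, ((starRingEnd ℂ) (C1 l x) * C1 m x +
        (starRingEnd ℂ) (C2 l x) * C2 m x)) (nhds l) (nhds (∫ x in (0:ℝ)..1, ((starRingEnd ℂ) (C1 l x) * C1 l x +
        (starRingEnd ℂ) (C2 l x) * C2 l x))) := by
  obtain ⟨B, hB, hb⟩ := H.lip (‖l‖ + 1)
  obtain ⟨D, hD, hd⟩ := H.bdd ‖l‖
  rw [tendsto_iff_norm_sub_tendsto_zero]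
  have t : Tendsto (fun m : ℂ => (D * (B * ‖m - l‖) + D * (B * ‖m - l‖)) * |(1:ℝ) - 0|) (nhds l) (nhds 0) := by
    have : Continuous (fun m : ℂ => (D * (B * ‖m - l‖) + D * (B * ‖m - l‖)) * |(1:ℝ) - 0|) := by fun_prop
    simpa using this.tendsto l
  refine squeeze_zero' (Eventually.of_forall fun _ => norm_nonneg _) ?_ t
  filter_upwards [Metric.ball_mem_nhds l one_pos] with m hm
  rw [Metric.mem_ball, dist_eq_norm] at hm
  have hm2 : ‖m‖ ≤ ‖l‖ + 1 := by
    have := norm_add_le (m - l) l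
    simp only [sub_add_cancel] at this; linarith
  have hci : ∀ n, IntervalIntegrable (fun x => (starRingEnd ℂ) (C1 l x) * C1 n x +
        (starRingEnd ℂ) (C2 l x) * C2 n x) volume 0 1 := by
    intro n
    apply ContinuousOn.intervalIntegrable
    rw [uIcc_of_le zero_le_one]
    exact ((H.sol l).conj.1.continuousOn.mul (H.sol n).1.continuousOn).add
      ((H.sol l).conj.2.continuousOn.mul (H.sol n).2.continuousOn)
  rw [← intervalIntegral.integral_sub (hci m) (hci l)]
  refine intervalIntegral.norm_integral_le_of_norm_le_const fun x hx => ?_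
  rw [uIoc_of_le zero_le_one] at hx
  have hx' : x ∈ Set.Icc (0:ℝ) 1 := ⟨hx.1.le, hx.2⟩
  have e1 := hb l m (by linarith) hm2 x hx'
  have e2 := hd l le_rfl x hx'
  calc _ = ‖(starRingEnd ℂ) (C1 l x) * (C1 m x - C1 l x) +
      (starRingEnd ℂ) (C2 l x) * (C2 m x - C2 l x)‖ := by congr 1; ring
    _ ≤ ‖C1 l x‖ * ‖C1 m x - C1 l x‖ + ‖C2 l x‖ * ‖C2 m x - C2 l x‖ := by
      refine (norm_add_le _ _).trans (le_of_eq ?_)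
      simp
    _ ≤ _ := by gcongr; exacts [e2.1, e1.1, e2.2, e1.2]

theorem simple (H : CFam q1 q2 C1 C2) {l : ℂ} :
    (C1 l 1 = 0 → deriv (fun l => C1 l 1) l ≠ 0) ∧ (C2 l 1 = 0 → deriv (fun l => C2 l 1) l ≠ 0) := by
  have tI := (H.cont_int l).mono_left (nhdsWithin_le_nhds (s := {l}ᶜ))
  constructor
  · intro h hd
    have hre : (starRingEnd ℂ) l = l := Complex.conj_eq_iff_im.mpr (H.real_zero (Or.inl h))
    have h1 := hasDerivAt_iff_tendsto_slope.mp (H.diff1 l).hasDerivAt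
    rw [hd] at h1
    have h2 := h1.const_mul (-(starRingEnd ℂ) (C2 l 1))
    rw [mul_zero] at h2
    refine H.int_ne l (tendsto_nhds_unique tI (h2.congr' ?_))
    filter_upwards [self_mem_nhdsWithin] with m hm
    have hm : m - l ≠ 0 := sub_ne_zero.mpr hm
    have w := H.wr l m
    rw [h, hre] at w
    rw [slope_def_field, h]
    field_simp
    simp at w
    linear_combination w
  · intro h hd
    have hre : (starRingEnd ℂ) l = l := Complex.conj_eq_iff_im.mpr (H.real_zero (Or.inr h))
    have h1 := hasDerivAt_iff_tendsto_slope.mp (H.diff2 l).hasDerivAt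
    rw [hd] at h1
    have h2 := h1.const_mul ((starRingEnd ℂ) (C1 l 1))
    rw [mul_zero] at h2
    refine H.int_ne l (tendsto_nhds_unique tI (h2.congr' ?_))
    filter_upwards [self_mem_nhdsWithin] with m hm
    have hm : m - l ≠ 0 := sub_ne_zero.mpr hm
    have w := H.wr l m
    rw [h, hre] at w
    rw [slope_def_field, h]
    field_simp
    simp at w
    linear_combination w

theorem conj_eq (H : CFam q1 q2 C1 C2) (l : ℂ) :
    C1 ((starRingEnd ℂ) l) 1 = (starRingEnd ℂ) (C1 l 1) ∧
    C2 ((starRingEnd ℂ) l) 1 = (starRingEnd ℂ) (C2 l 1) := by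
  have := DSol.unique H.hq1 H.hq2 (H.sol ((starRingEnd ℂ) l)) (H.sol l).conj 1 (by simp [H.i1])
    (by simp [H.i2]) 1 (by simp)
  simpa using this

end CFam

theorem rl_unif {r : ℝ → ℂ} (hr : IntegrableOn r (Set.Ioo 0 1)) {ε : ℝ} (hε : 0 < ε) :
    ∃ R : ℝ, 0 < R ∧ ∀ a s : ℂ, R ≤ ‖s‖ → ∀ x ∈ Set.Icc (0:ℝ) 1,
      (∀ t ∈ Set.Icc (0:ℝ) x, ‖cexp (a + s * t)‖ ≤ 1) →
      ‖∫ t in (0:ℝ)..x, cexp (a + s * t) * r t‖ ≤ ε := by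
  have hm : MemLp ((Set.Ioo (0:ℝ) 1).indicator r) 1 volume := by
    rw [memLp_one_iff_integrable, integrable_indicator_iff measurableSet_Ioo]
    exact hr
  obtain ⟨g, hgs, hgc, hg⟩ := hm.exist_eLpNorm_sub_le (by simp) le_rfl (ε := ε / 2) (by positivity)
  have hg1 : Continuous (deriv g) := hgc.continuous_deriv (by simp)
  have hgd : ∀ x, HasDerivAt g (deriv g x) x := fun x =>
    ((hgc.differentiable (by simp)) x).hasDerivAt
  have hgi : IntegrableOn g (Set.Ioo 0 1) :=
    (hgc.continuous.integrableOn_Icc (a := 0) (b := 1)).mono_set Ioo_subset_Icc_self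
  obtain ⟨M, hM⟩ := (isCompact_Icc (a := (0:ℝ)) (b := 1)).exists_bound_of_continuousOn hgc.continuous.continuousOn
  obtain ⟨M', hM'⟩ := (isCompact_Icc (a := (0:ℝ)) (b := 1)).exists_bound_of_continuousOn hg1.continuousOn
  have hM0 : 0 ≤ M := (norm_nonneg _).trans (hM 0 (by simp))
  have hM'0 : 0 ≤ M' := (norm_nonneg _).trans (hM' 0 (by simp))
  -- L1 distance
  have hL1 : ∫ t in Set.Ioo (0:ℝ) 1, ‖r t - g t‖ ≤ ε / 2 := by
    have i0 : Integrable ((Set.Ioo (0:ℝ) 1).indicator r - g) volume :=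
      (memLp_one_iff_integrable.mp hm).sub (hgc.continuous.integrable_of_hasCompactSupport hgs)
    have h2 : ∫ t, ‖((Set.Ioo (0:ℝ) 1).indicator r - g) t‖ ≤ ε / 2 := by
      rw [eLpNorm_one_eq_lintegral_enorm] at hg
      rw [integral_norm_eq_lintegral_enorm i0.aestronglyMeasurable]
      exact ENNReal.toReal_le_of_le_ofReal (by positivity) hg
    refine le_trans ?_ h2
    calc ∫ t in Set.Ioo (0:ℝ) 1, ‖r t - g t‖
        = ∫ t in Set.Ioo (0:ℝ) 1, ‖((Set.Ioo (0:ℝ) 1).indicator r - g) t‖ := by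
          refine setIntegral_congr_fun measurableSet_Ioo fun t ht => ?_
          simp [indicator_of_mem ht]
      _ ≤ _ := setIntegral_le_integral i0.norm (Eventually.of_forall fun _ => norm_nonneg _)
  refine ⟨(2 * M + M' + 1) / (ε / 2), by positivity, fun a s hs x hx hE => ?_⟩
  have hs0 : 0 < ‖s‖ := lt_of_lt_of_le (by positivity) hs
  have hsne : s ≠ 0 := norm_pos_iff.mp hs0
  have hEd : ∀ t : ℝ, HasDerivAt (fun t : ℝ => cexp (a + s * t) / s) (cexp (a + s * t)) t := by
    intro t
    have h1 : HasDerivAt (fun t : ℝ => a + s * (t:ℂ)) (s * 1) t :=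
      ((hasDerivAt_id (t:ℂ)).comp_ofReal.const_mul s).const_add a
    have := (h1.cexp).div_const s
    rwa [mul_one, mul_div_cancel_right₀ _ hsne] at this
  have hEc : Continuous fun t : ℝ => cexp (a + s * t) := by fun_prop
  have hac := ((AC1.of_hasDerivAt hEd hEc).mul (AC1.of_hasDerivAt hgd hg1)).2 x hx
  have hI1 : IntervalIntegrable (fun t : ℝ => cexp (a + s * t) * g t) volume 0 x :=
    (hEc.mul hgc.continuous).intervalIntegrable _ _
  have hI2 : IntervalIntegrable (fun t : ℝ => cexp (a + s * t) / s * deriv g t) volume 0 x :=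
    ((hEc.div_const s).mul hg1).intervalIntegrable _ _
  beta_reduce at hac
  rw [intervalIntegral.integral_add hI1 hI2] at hac
  have b1 : ‖∫ t in (0:ℝ)..x, cexp (a + s * t) / s * deriv g t‖ ≤ M' / ‖s‖ := by
    have := intervalIntegral.norm_integral_le_of_norm_le_const (a := 0) (b := x)
      (f := fun t : ℝ => cexp (a + s * t) / s * deriv g t) (C := M' / ‖s‖) ?_
    · refine this.trans ?_
      rw [sub_zero, abs_of_nonneg hx.1]
      exact mul_le_of_le_one_right (by positivity) hx.2
    · intro t ht
      rw [uIoc_of_le hx.1] at ht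
      rw [norm_mul, norm_div, div_mul_eq_mul_div]
      gcongr
      calc _ ≤ 1 * M' := by
            gcongr
            · exact hE t ⟨ht.1.le, ht.2⟩
            · exact hM' t ⟨ht.1.le, ht.2.trans hx.2⟩
        _ = M' := one_mul _
  have b2 : ∀ t ∈ Set.Icc (0:ℝ) x, ‖cexp (a + s * t) / s * g t‖ ≤ M / ‖s‖ := by
    intro t ht
    rw [norm_mul, norm_div, div_mul_eq_mul_div]
    gcongr
    calc _ ≤ 1 * M := by
          gcongr
          · exact hE t ht
          · exact hM t ⟨ht.1, ht.2.trans hx.2⟩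
      _ = M := one_mul _
  have b3 : ‖∫ t in (0:ℝ)..x, cexp (a + s * t) * g t‖ ≤ ε / 2 := by
    have e : ∫ t in (0:ℝ)..x, cexp (a + s * t) * g t =
        cexp (a + s * x) / s * g x - cexp (a + s * (0:ℝ)) / s * g 0 -
          ∫ t in (0:ℝ)..x, cexp (a + s * t) / s * deriv g t := by
      rw [hac]; ring
    rw [e]
    have h1 := b2 x ⟨hx.1, le_rfl⟩
    have h2 := b2 0 ⟨le_rfl, hx.1⟩
    have h3 : M / ‖s‖ + M / ‖s‖ + M' / ‖s‖ ≤ ε / 2 := by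
      rw [← add_div, ← add_div, div_le_iff₀ hs0]
      rw [div_le_iff₀ (by positivity)] at hs
      linarith
    exact ((norm_sub_le _ _).trans (add_le_add ((norm_sub_le _ _).trans (add_le_add h1 h2)) b1)).trans h3
  have hrx := ii_of_Ioo' hr hx
  have hgx := ii_of_Ioo' hgi hx
  have e : ∫ t in (0:ℝ)..x, cexp (a + s * t) * r t =
      (∫ t in (0:ℝ)..x, cexp (a + s * t) * (r t - g t)) + ∫ t in (0:ℝ)..x, cexp (a + s * t) * g t := by
    rw [← intervalIntegral.integral_add]
    · congr 1; ext t; ring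
    · exact (hrx.sub hgx).continuousOn_mul hEc.continuousOn
    · exact hI1
  have b4 : ‖∫ t in (0:ℝ)..x, cexp (a + s * t) * (r t - g t)‖ ≤ ε / 2 := by
    refine le_trans ?_ hL1
    rw [intervalIntegral.integral_of_le hx.1]
    have hsub : Set.Ioc 0 x ⊆ Set.Ioc 0 1 := Ioc_subset_Ioc_right hx.2
    have hI : IntegrableOn (fun t => ‖r t - g t‖) (Set.Ioc 0 1) :=
      (integrableOn_Ioc_iff_integrableOn_Ioo (f := fun t => ‖r t - g t‖) (μ := volume)).mpr (hr.sub hgi).norm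
    rw [← integral_Ioc_eq_integral_Ioo]
    calc _ ≤ ∫ t in Set.Ioc 0 x, ‖r t - g t‖ := by
          refine norm_integral_le_of_norm_le (hI.mono_set hsub) ?_
          refine (ae_restrict_iff' measurableSet_Ioc).mpr (Eventually.of_forall fun t ht => ?_)
          rw [norm_mul]
          exact mul_le_of_le_one_left (norm_nonneg _) (hE t ⟨ht.1.le, ht.2⟩)
      _ ≤ _ := setIntegral_mono_set hI (Eventually.of_forall fun _ => norm_nonneg _) hsub.eventuallyLE
  rw [e]
  exact (norm_add_le _ _).trans (by linarith)

theorem expI_ac (a : ℂ) : AC1 (fun x : ℝ => cexp (a * x)) (fun x : ℝ => a * cexp (a * x)) := by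
  refine AC1.of_hasDerivAt (fun t => ?_) (by fun_prop)
  have h1 : HasDerivAt (fun t : ℝ => a * (t:ℂ)) (a * 1) t :=
      ((hasDerivAt_id (t:ℂ)).comp_ofReal.const_mul a)
  have := h1.cexp
  rwa [mul_one, mul_comm] at this

theorem CFam.growth_aux {q1 q2 : ℝ → ℝ} {C1 C2 : ℂ → ℝ → ℂ} (H : CFam q1 q2 C1 C2) {ε : ℝ}
    (hε : 0 < ε) : ∃ R : ℝ, ∀ l : ℂ, 0 ≤ l.im → R ≤ ‖l‖ →
      ‖cexp (I * l) * (C1 l 1 - Complex.cos l)‖ ≤ ε ∧ ‖cexp (I * l) * (C2 l 1 - Complex.sin l)‖ ≤ ε := by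
  set r : ℝ → ℂ := fun x => q2 x - I * q1 x with hr
  set r' : ℝ → ℂ := fun x => q2 x + I * q1 x with hr'
  set k : ℝ → ℝ := fun x => |q2 x| + |q1 x| with hk
  have hki : IntegrableOn k (Set.Ioo 0 1) := H.hq2.abs.add H.hq1.abs
  have hri : IntegrableOn r (Set.Ioo 0 1) := H.hq2.ofReal.sub (H.hq1.ofReal.const_mul I)
  have hr'i : IntegrableOn r' (Set.Ioo 0 1) := H.hq2.ofReal.add (H.hq1.ofReal.const_mul I)
  have hrk : ∀ x, ‖r x‖ ≤ k x := fun x => (norm_sub_le _ _).trans (by simp [hk])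
  have hr'k : ∀ x, ‖r' x‖ ≤ k x := fun x => (norm_add_le _ _).trans (by simp [hk])
  have hk0 : ∀ x, 0 ≤ k x := fun x => by positivity
  set K := ∫ t in (0:ℝ)..1, k t
  set ε' := ε / Real.exp K with hε'
  have hε'0 : 0 < ε' := by positivity
  obtain ⟨R1, hR1, h1⟩ := rl_unif hri hε'0
  obtain ⟨R2, hR2, h2⟩ := rl_unif hr'i hε'0
  refine ⟨max R1 R2, fun l hl hR => ?_⟩
  set wp : ℝ → ℂ := fun x => C1 l x + I * C2 l x with hwp
  set wm : ℝ → ℂ := fun x => C1 l x - I * C2 l x with hwm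
  have hpa : AC1 wp (fun x => I * l * wp x + r x * wm x) := by
    have := (H.sol l).1.add ((H.sol l).2.const_mul I)
    convert this using 2 with x
    simp only [hwp, hwm, hr]
    linear_combination (l * C2 l x + q1 x * C2 l x) * I_sq
  have hma : AC1 wm (fun x => -I * l * wm x + r' x * wp x) := by
    have := (H.sol l).1.sub ((H.sol l).2.const_mul I)
    convert this using 2 with x
    simp only [hwp, hwm, hr']
    linear_combination (l * C2 l x + q1 x * C2 l x) * I_sq
  set Dp : ℝ → ℂ := fun x => cexp (I * l * x) * wp x - cexp (2 * I * l * x) with hDp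
  set Dm : ℝ → ℂ := fun x => cexp (I * l * x) * wm x - 1 with hDm
  have hcp : ContinuousOn Dp (Set.Icc 0 1) :=
    (((by fun_prop : Continuous fun x : ℝ => cexp (I * l * x)).continuousOn).mul hpa.continuousOn).sub
      (by fun_prop : Continuous fun x : ℝ => cexp (2 * I * l * x)).continuousOn
  have hcm : ContinuousOn Dm (Set.Icc 0 1) :=
    (((by fun_prop : Continuous fun x : ℝ => cexp (I * l * x)).continuousOn).mul hma.continuousOn).sub
      continuousOn_const
  have ha := (expI_ac (-(I * l))).mul hpa
  have hb := (expI_ac (I * l)).mul hma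
  have w0 : wp 0 = 1 ∧ wm 0 = 1 := by simp [hwp, hwm, H.i1, H.i2]
  have hDpe : ∀ x ∈ Set.Icc (0:ℝ) 1, Dp x = ∫ t in (0:ℝ)..x, cexp (2 * I * l * x + (-(2 * I * l)) * t) * (r t * (1 + Dm t)) := by
    intro x hx
    have := ha.2 x hx
    beta_reduce at this
    have e1 : Dp x = cexp (2 * I * l * x) * (cexp (-(I * l) * x) * wp x - 1) := by
      simp only [hDp]
      rw [mul_sub, ← mul_assoc, ← Complex.exp_add]
      ring_nf
    rw [e1, this, w0.1]
    simp only [Complex.ofReal_zero, mul_zero, Complex.exp_zero, mul_one, add_sub_cancel_left]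
    rw [← intervalIntegral.integral_const_mul]
    congr 1; ext t
    simp only [hDm]
    have e2 : cexp (2 * I * l * x + (-(2 * I * l)) * t) * cexp (I * l * t) = cexp (2 * I * l * x) * cexp (-(I * l) * t) := by
      rw [← Complex.exp_add, ← Complex.exp_add]; ring_nf
    linear_combination (-r t * wm t) * e2
  have hDme : ∀ x ∈ Set.Icc (0:ℝ) 1, Dm x = ∫ t in (0:ℝ)..x, r' t * (cexp (0 + 2 * I * l * t) + Dp t) := by
    intro x hx
    have := hb.2 x hx
    beta_reduce at this
    simp only [hDm]
    rw [this, w0.2]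
    simp only [Complex.ofReal_zero, mul_zero, Complex.exp_zero, mul_one, add_sub_cancel_left]
    congr 1; ext t
    simp only [hDp, zero_add]
    ring
  have hre : ∀ y : ℝ, 0 ≤ y → (2 * I * l * y).re ≤ 0 := by
    intro y hy; simp; positivity
  have hkI := (integrableOn_Icc_iff_integrableOn_Ioo (f := k) (μ := volume)).mpr hki
  have hrI := (integrableOn_Icc_iff_integrableOn_Ioo (f := r) (μ := volume)).mpr hri
  have hr'I := (integrableOn_Icc_iff_integrableOn_Ioo (f := r') (μ := volume)).mpr hr'i
  have hmc : ContinuousOn (fun x => max ‖Dp x‖ ‖Dm x‖) (Set.Icc 0 1) := hcp.norm.sup hcm.norm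
  have hl2 : ‖2 * I * l‖ = 2 * ‖l‖ := by simp
  have hl0 := norm_nonneg l
  have key : ∀ x ∈ Set.Icc (0:ℝ) 1, max ‖Dp x‖ ‖Dm x‖ ≤ ε' + ∫ t in (0:ℝ)..x, k t * max ‖Dp t‖ ‖Dm t‖ := by
    intro x hx
    have hsub : Set.Ioo (0:ℝ) 1 ⊆ Set.Icc 0 1 := Ioo_subset_Icc_self
    have hkm : IntervalIntegrable (fun t => k t * max ‖Dp t‖ ‖Dm t‖) volume 0 x :=
      ii_of_Ioo' ((hkI.mul_continuousOn hmc isCompact_Icc).mono_set hsub) hx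
    refine max_le ?_ ?_
    · have hEc : Continuous fun t : ℝ => cexp (2 * I * l * x + (-(2 * I * l)) * t) := by fun_prop
      have hE : ∀ t ∈ Set.Icc (0:ℝ) x, ‖cexp (2 * I * l * x + (-(2 * I * l)) * t)‖ ≤ 1 := by
        intro t ht
        rw [Complex.norm_exp, Real.exp_le_one_iff]
        have := hre (x - t) (by linarith [ht.2])
        convert this using 2
        push_cast; ring
      have i1 : IntervalIntegrable (fun t : ℝ => cexp (2 * I * l * x + (-(2 * I * l)) * t) * r t) volume 0 x :=
        (ii_of_Ioo' hri hx).continuousOn_mul hEc.continuousOn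
      have i2 : IntervalIntegrable (fun t : ℝ => cexp (2 * I * l * x + (-(2 * I * l)) * t) * (r t * Dm t)) volume 0 x :=
        (ii_of_Ioo' ((hrI.mul_continuousOn hcm isCompact_Icc).mono_set hsub) hx).continuousOn_mul hEc.continuousOn
      have e : Dp x = (∫ t in (0:ℝ)..x, cexp (2 * I * l * x + (-(2 * I * l)) * t) * r t) +
          ∫ t in (0:ℝ)..x, cexp (2 * I * l * x + (-(2 * I * l)) * t) * (r t * Dm t) := by
        rw [hDpe x hx, ← intervalIntegral.integral_add i1 i2]
        congr 1; ext t; ring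
      rw [e]
      refine (norm_add_le _ _).trans (add_le_add (h1 _ _ ?_ x hx hE) ?_)
      · rw [norm_neg, hl2]; linarith [le_max_left R1 R2]
      · refine intervalIntegral.norm_integral_le_of_norm_le hx.1 ?_ hkm
        refine Eventually.of_forall fun t ht => ?_
        rw [norm_mul, norm_mul]
        calc _ ≤ 1 * (k t * max ‖Dp t‖ ‖Dm t‖) := by
              gcongr
              · exact hE t ⟨ht.1.le, ht.2⟩
              · exact hrk t
              · exact le_max_right _ _
          _ = _ := one_mul _
    · have hEc : Continuous fun t : ℝ => cexp (0 + 2 * I * l * t) := by fun_prop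
      have hE : ∀ t ∈ Set.Icc (0:ℝ) x, ‖cexp (0 + 2 * I * l * t)‖ ≤ 1 := by
        intro t ht
        rw [Complex.norm_exp, Real.exp_le_one_iff, zero_add]
        exact hre t ht.1
      have i1 : IntervalIntegrable (fun t : ℝ => cexp (0 + 2 * I * l * t) * r' t) volume 0 x :=
        (ii_of_Ioo' hr'i hx).continuousOn_mul hEc.continuousOn
      have i2 : IntervalIntegrable (fun t : ℝ => (r' t * Dp t)) volume 0 x :=
        (ii_of_Ioo' ((hr'I.mul_continuousOn hcp isCompact_Icc).mono_set hsub) hx)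
      have e : Dm x = (∫ t in (0:ℝ)..x, cexp (0 + 2 * I * l * t) * r' t) +
          ∫ t in (0:ℝ)..x, (r' t * Dp t) := by
        rw [hDme x hx, ← intervalIntegral.integral_add i1 i2]
        congr 1; ext t; ring
      rw [e]
      refine (norm_add_le _ _).trans (add_le_add (h2 _ _ ?_ x hx hE) ?_)
      · rw [hl2]; linarith [le_max_right R1 R2]
      · refine intervalIntegral.norm_integral_le_of_norm_le hx.1 ?_ hkm
        refine Eventually.of_forall fun t ht => ?_
        rw [norm_mul]
        gcongr
        · exact hr'k t
        · exact le_max_left _ _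
  have fin := gronwall_L1 hki hk0 hmc key 1 (by simp)
  have fe : ε' * Real.exp (∫ t in (0:ℝ)..1, k t) = ε := by
    rw [hε']; exact div_mul_cancel₀ _ (Real.exp_pos _).ne'
  rw [fe] at fin
  have fp : ‖Dp 1‖ ≤ ε := (le_max_left _ _).trans fin
  have fm : ‖Dm 1‖ ≤ ε := (le_max_right _ _).trans fin
  have x1 : cexp (I * l) * cexp (-l * I) = 1 := by rw [← Complex.exp_add]; ring_nf; simp
  have x2 : cexp (I * l) * cexp (l * I) = cexp (2 * I * l) := by rw [← Complex.exp_add]; ring_nf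
  constructor
  · have : cexp (I * l) * (C1 l 1 - Complex.cos l) = (Dp 1 + Dm 1) / 2 := by
      simp only [hDp, hDm, hwp, hwm, Complex.cos, Complex.ofReal_one, mul_one]
      linear_combination (-1/2) * x1 - 1/2 * x2
    rw [this, norm_div]
    have := norm_add_le (Dp 1) (Dm 1)
    simp only [Complex.norm_ofNat]
    linarith
  · have : cexp (I * l) * (C2 l 1 - Complex.sin l) = (Dp 1 - Dm 1) * (-I) / 2 := by
      simp only [hDp, hDm, hwp, hwm, Complex.sin, Complex.ofReal_one, mul_one]
      linear_combination (-1/2) * I * x1 + 1/2 * I * x2 + cexp (I * l) * C2 l 1 * I_sq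
    rw [this, norm_div]
    have := norm_sub_le (Dp 1) (Dm 1)
    simp only [Complex.norm_ofNat, norm_mul, norm_neg, norm_I, mul_one]
    linarith

theorem CFam.growth {q1 q2 : ℝ → ℝ} {C1 C2 : ℂ → ℝ → ℂ} (H : CFam q1 q2 C1 C2) {ε : ℝ}
    (hε : 0 < ε) : ∃ R : ℝ, ∀ l : ℂ, R ≤ ‖l‖ →
      ‖C1 l 1 - Complex.cos l‖ ≤ ε * Real.exp |l.im| ∧
      ‖C2 l 1 - Complex.sin l‖ ≤ ε * Real.exp |l.im| := by
  obtain ⟨R, hR⟩ := H.growth_aux hε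
  have up : ∀ l : ℂ, 0 ≤ l.im → R ≤ ‖l‖ → ‖C1 l 1 - Complex.cos l‖ ≤ ε * Real.exp |l.im| ∧
      ‖C2 l 1 - Complex.sin l‖ ≤ ε * Real.exp |l.im| := by
    intro l hl h
    have := hR l hl h
    have e : ‖cexp (I * l)‖ = (Real.exp |l.im|)⁻¹ := by
      rw [Complex.norm_exp, abs_of_nonneg hl, ← Real.exp_neg]; simp
    rw [norm_mul, norm_mul, e, inv_mul_le_iff₀ (Real.exp_pos _), inv_mul_le_iff₀ (Real.exp_pos _)] at this
    rwa [mul_comm ε]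
  refine ⟨R, fun l hl => ?_⟩
  rcases le_total 0 l.im with h | h
  · exact up l h hl
  · have := up ((starRingEnd ℂ) l) (by simpa using h) (by simpa using hl)
    rw [(H.conj_eq l).1, (H.conj_eq l).2, Complex.cos_conj, Complex.sin_conj, ← map_sub, ← map_sub,
      RCLike.norm_conj, RCLike.norm_conj] at this
    simpa using this

/-- Entire functions with simple zeros `a n`, close to `sin`. -/
structure ZF (f : ℂ → ℂ) (a : ℤ → ℂ) : Prop where
  diff : Differentiable ℂ f
  inj : Function.Injective a
  zero : ∀ z, f z = 0 ↔ ∃ n, a n = z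
  simple : ∀ n, deriv f (a n) ≠ 0
  asym : Tendsto (fun n => a n - Real.pi * n) cofinite (nhds 0)
  growth : ∀ ε : ℝ, 0 < ε → ∃ R : ℝ, ∀ z : ℂ, R ≤ ‖z‖ →
    ‖f z - Complex.sin z‖ ≤ ε * Real.exp |z.im|

theorem ZF_sin : ZF Complex.sin (fun n : ℤ => (Real.pi * n : ℂ)) where
  diff := Complex.differentiable_sin
  inj := fun m n h => by
    have h' : (Real.pi : ℂ) ≠ 0 := by exact_mod_cast Real.pi_ne_zero
    have := mul_left_cancel₀ h' h
    exact_mod_cast this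
  zero := fun z => by
    rw [Complex.sin_eq_zero_iff]
    constructor
    · rintro ⟨k, rfl⟩; exact ⟨k, mul_comm _ _⟩
    · rintro ⟨k, rfl⟩; exact ⟨k, mul_comm _ _⟩
  simple := fun n => by
    rw [Complex.deriv_sin]
    intro h
    have h1 : Complex.sin (Real.pi * n) = 0 := by
      rw [Complex.sin_eq_zero_iff]; exact ⟨n, mul_comm _ _⟩
    have := Complex.sin_sq_add_cos_sq (Real.pi * n)
    rw [h, h1] at this; simp at this
  asym := by simp
  growth := fun ε hε => ⟨0, fun z _ => by simp; positivity⟩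

theorem ZF.div_exists {f : ℂ → ℂ} {a : ℤ → ℂ} (h : ZF f a) (S : Finset ℤ) :
    ∃ u : ℂ → ℂ, Differentiable ℂ u ∧ (∀ z, f z = (∏ n ∈ S, (z - a n)) * u z) ∧
      ∀ z, u z = 0 → ∃ n, n ∉ S ∧ a n = z := by
  have ex : ∃ u : ℂ → ℂ, Differentiable ℂ u ∧ (∀ z, f z = (∏ n ∈ S, (z - a n)) * u z) := by
    classical
    induction S using Finset.induction_on with
    | empty => exact ⟨f, h.diff, by simp⟩
    | insert m S hm ih =>
      obtain ⟨u, hu, hf⟩ := ih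
      have hu0 : u (a m) = 0 := by
        have h0 := (h.zero (a m)).mpr ⟨m, rfl⟩
        rw [hf, mul_eq_zero] at h0
        refine h0.resolve_left ?_
        rw [Finset.prod_eq_zero_iff]
        rintro ⟨n, hn, he⟩
        have := h.inj (sub_eq_zero.mp he)
        exact hm (this ▸ hn)
      refine ⟨dslope u (a m), ?_, fun z => ?_⟩
      · rw [← differentiableOn_univ] at hu ⊢
        exact (Complex.differentiableOn_dslope Filter.univ_mem).mpr hu
      · have := sub_smul_dslope u (a m) z
        rw [hu0, sub_zero, smul_eq_mul] at this
        rw [hf, Finset.prod_insert hm, ← this]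
        ring
  obtain ⟨u, hu, hf⟩ := ex
  refine ⟨u, hu, hf, fun z hz => ?_⟩
  obtain ⟨n, hn⟩ := (h.zero z).mp (by rw [hf, hz, mul_zero])
  refine ⟨n, fun hnS => ?_, hn⟩
  apply h.simple n
  have hp : DifferentiableAt ℂ (fun z => ∏ n ∈ S, (z - a n)) (a n) := by fun_prop
  have e : f = fun z => (∏ n ∈ S, (z - a n)) * u z := funext hf
  rw [e]
  have : deriv (fun z => (∏ n ∈ S, (z - a n)) * u z) (a n) = _ := deriv_mul hp (hu (a n))
  rw [this]
  have e2 : ∏ m ∈ S, (a n - a m) = 0 := Finset.prod_eq_zero hnS (sub_self _)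
  rw [e2, hn, hz]; simp

theorem logDeriv_div_exists {f u : ℂ → ℂ} {a : ℤ → ℂ} {S : Finset ℤ} (hu : Differentiable ℂ u)
    (hf : ∀ z, f z = (∏ n ∈ S, (z - a n)) * u z) {z : ℂ} (hz : f z ≠ 0) :
    logDeriv f z = (∑ n ∈ S, 1 / (z - a n)) + logDeriv u z := by
  have e : f = fun z => (∏ n ∈ S, (z - a n)) * u z := funext hf
  have h0 := hz
  rw [hf] at h0
  have h1 := left_ne_zero_of_mul h0
  have h2 := right_ne_zero_of_mul h0
  rw [e, logDeriv_mul z h1 h2 (by fun_prop) (hu z), logDeriv_prod]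
  · congr 1
    refine Finset.sum_congr rfl fun n _ => ?_
    simp [logDeriv_apply]
  · intro n hn h
    exact h1 (Finset.prod_eq_zero hn h)
  · intro n _; fun_prop

theorem norm_sin_le (z : ℂ) : ‖Complex.sin z‖ ≤ Real.exp |z.im| := by
  have h1 : ‖cexp (-z * I)‖ ≤ Real.exp |z.im| := by
    rw [Complex.norm_exp]; simp; exact le_abs_self _
  have h2 : ‖cexp (z * I)‖ ≤ Real.exp |z.im| := by
    rw [Complex.norm_exp]; simp; exact neg_le_abs _
  have := norm_sub_le (cexp (-z * I)) (cexp (z * I))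
  rw [Complex.sin, norm_div, norm_mul, norm_I, Complex.norm_ofNat]
  linarith

theorem norm_cos_le (z : ℂ) : ‖Complex.cos z‖ ≤ Real.exp |z.im| := by
  have h1 : ‖cexp (-z * I)‖ ≤ Real.exp |z.im| := by
    rw [Complex.norm_exp]; simp; exact le_abs_self _
  have h2 : ‖cexp (z * I)‖ ≤ Real.exp |z.im| := by
    rw [Complex.norm_exp]; simp; exact neg_le_abs _
  have := norm_add_le (cexp (z * I)) (cexp (-z * I))
  rw [Complex.cos, norm_div, Complex.norm_ofNat]
  linarith

theorem norm_sin_ge_of_im {z : ℂ} (hz : 1 ≤ |z.im|) : Real.exp |z.im| / 8 ≤ ‖Complex.sin z‖ := by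
  have h1 : ‖cexp (-z * I)‖ = Real.exp z.im := by
    rw [Complex.norm_exp]; simp
  have h2 : ‖cexp (z * I)‖ = Real.exp (-z.im) := by
    rw [Complex.norm_exp]; simp
  have := abs_norm_sub_norm_le (cexp (-z * I)) (cexp (z * I))
  rw [h1, h2] at this
  rw [Complex.sin, norm_div, norm_mul, norm_I, Complex.norm_ofNat]
  have key : Real.exp |z.im| / 4 ≤ |Real.exp z.im - Real.exp (-z.im)| := by
    have gen : ∀ y : ℝ, 1 ≤ y → Real.exp y / 4 ≤ Real.exp y - Real.exp (-y) := by
      intro y hy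
      have e1 : 2 ≤ Real.exp y := by linarith [Real.add_one_le_exp y]
      have e2 : Real.exp (-y) ≤ 1 := Real.exp_le_one_iff.mpr (by linarith)
      linarith
    rcases le_total 0 z.im with h | h
    · rw [abs_of_nonneg h] at hz ⊢
      exact (gen _ hz).trans (le_abs_self _)
    · rw [abs_of_nonpos h] at hz ⊢
      have := gen _ hz
      rw [neg_neg] at this
      rw [abs_sub_comm]
      exact this.trans (le_abs_self _)
  linarith

theorem norm_sin_ge_circle {M : ℕ} {z : ℂ} (hz : ‖z‖ = Real.pi * (M + 1/2)) :
    Real.exp |z.im| / 8 ≤ ‖Complex.sin z‖ := by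
  rcases le_or_gt 1 |z.im| with h | h
  · exact norm_sin_ge_of_im h
  set ρ := Real.pi * (M + 1/2) with hρ
  have hρ1 : 1 ≤ ρ := by
    have : (0:ℝ) ≤ M := Nat.cast_nonneg M
    have := Real.pi_gt_three
    nlinarith
  have hsq : z.re ^ 2 + z.im ^ 2 = ρ ^ 2 := by
    rw [← hz, ← Complex.normSq_eq_norm_sq, Complex.normSq_apply]; ring
  have hx0 := abs_nonneg z.re
  have hxρ : |z.re| ≤ ρ := hz ▸ Complex.abs_re_le_norm z
  have him : z.im ^ 2 ≤ 1 := by rw [← sq_abs]; nlinarith [abs_nonneg z.im]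
  have hd : ρ - |z.re| ≤ 1 := by
    have : (ρ - |z.re|) * (ρ + |z.re|) ≤ 1 := by nlinarith [sq_abs z.re]
    nlinarith
  have hcos : 1/2 ≤ Real.cos (ρ - |z.re|) := by
    have := Real.one_sub_sq_div_two_le_cos (x := ρ - |z.re|)
    nlinarith
  have hsin : |Real.sin z.re| = |Real.cos (ρ - |z.re|)| := by
    have e1 : |Real.sin z.re| = |Real.sin (|z.re|)| := by
      rcases le_total 0 z.re with h | h
      · rw [abs_of_nonneg h]
      · rw [abs_of_nonpos h, Real.sin_neg, abs_neg]
    have e2 : ρ - |z.re| = (Real.pi / 2 - |z.re|) + M * Real.pi := by rw [hρ]; ring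
    rw [e1, e2, Real.cos_add_nat_mul_pi, abs_mul, abs_pow, abs_neg, abs_one, one_pow, one_mul,
      Real.cos_pi_div_two_sub]
  have hre : (Complex.sin z).re = Real.sin z.re * Real.cosh z.im := by
    conv_lhs => rw [← Complex.re_add_im z]
    rw [Complex.sin_add_mul_I]
    simp [← Complex.ofReal_sin, ← Complex.ofReal_cosh, ← Complex.ofReal_cos, ← Complex.ofReal_sinh]
  have h2 : 1/2 ≤ ‖Complex.sin z‖ := by
    refine le_trans ?_ (Complex.abs_re_le_norm _)
    rw [hre, abs_mul, hsin]
    have := Real.one_le_cosh z.im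
    calc (1:ℝ)/2 ≤ |Real.cos (ρ - |z.re|)| * 1 := by rw [mul_one]; exact hcos.trans (le_abs_self _)
      _ ≤ _ := by gcongr; exact this.trans (le_abs_self _)
  have h3 : Real.exp |z.im| ≤ 3 := (Real.exp_le_exp.mpr h.le).trans (by linarith [Real.exp_one_lt_d9])
  linarith

@[simp] theorem Icc_zero_sym : Finset.Icc (-((0:ℕ):ℤ)) ((0:ℕ):ℤ) = {0} := by simp

theorem Icc_succ_sym (M : ℕ) : Finset.Icc (-((M + 1 : ℕ):ℤ)) ((M + 1 : ℕ):ℤ) =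
    insert ((M + 1 : ℕ):ℤ) (insert (-((M + 1 : ℕ):ℤ)) (Finset.Icc (-(M:ℤ)) (M:ℤ))) := by
  ext n
  simp only [Finset.mem_Icc, Finset.mem_insert]
  omega

theorem sum_Icc_succ_sym {E : Type*} [AddCommMonoid E] (g : ℤ → E) (M : ℕ) :
    ∑ n ∈ Finset.Icc (-((M + 1 : ℕ):ℤ)) ((M + 1 : ℕ):ℤ), g n =
      (∑ n ∈ Finset.Icc (-(M:ℤ)) (M:ℤ), g n) + (g ((M + 1 : ℕ):ℤ) + g (-((M + 1 : ℕ):ℤ))) := by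
  rw [Icc_succ_sym, Finset.sum_insert, Finset.sum_insert]
  · abel
  · simp
  · simp only [Finset.mem_Icc, Finset.mem_insert]; omega

theorem sum_Icc_le_sym {g : ℤ → ℝ} (hg : ∀ n, 0 ≤ g n) (M : ℕ) :
    ∑ n ∈ Finset.Icc (-(M:ℤ)) (M:ℤ), g n ≤ ∑ k ∈ Finset.range (M + 1), (g k + g (-k)) := by
  induction M with
  | zero => simp [hg]
  | succ M ih =>
    rw [sum_Icc_succ_sym, Finset.sum_range_succ]
    gcongr

theorem tannery_conv {w : ℕ → ℝ} (hw : Tendsto w atTop (nhds 0)) :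
    Tendsto (fun M : ℕ => ∑ k ∈ Finset.range (M + 1), w k / ((M:ℝ) - k + 1) ^ 2) atTop (nhds 0) := by
  obtain ⟨E, hE⟩ := (hw.norm.bddAbove_range)
  have hE' : ∀ k, ‖w k‖ ≤ E := fun k => hE (mem_range_self k)
  have hE0 : 0 ≤ E := (norm_nonneg _).trans (hE' 0)
  have hs : Summable (fun k : ℕ => E / ((k:ℝ) + 1) ^ 2) := by
    have h1 : Summable (fun n : ℕ => 1 / (n:ℝ) ^ 2) := Real.summable_one_div_nat_pow.mpr (by norm_num)
    have := ((summable_nat_add_iff 1).mpr h1).mul_left E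
    simpa [mul_one_div, div_eq_mul_inv] using this
  have t := tendsto_tsum_of_dominated_convergence (𝓕 := atTop)
    (f := fun (M : ℕ) (k : ℕ) => if k < M + 1 then w (M - k) / ((k:ℝ) + 1) ^ 2 else 0)
    (g := fun _ => (0:ℝ)) hs ?_ ?_
  · rw [tsum_zero] at t
    refine t.congr fun M => ?_
    rw [tsum_eq_sum (s := Finset.range (M + 1)) (by intro b hb; simp at hb; simp; omega)]
    rw [← Finset.sum_range_reflect]
    refine Finset.sum_congr rfl fun k hk => ?_
    rw [Finset.mem_range] at hk
    rw [if_pos (by omega)]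
    have e1 : M - (M + 1 - 1 - k) = k := by omega
    have e2 : ((M + 1 - 1 - k : ℕ) : ℝ) = M - k := by
      rw [Nat.cast_sub (by omega)]; simp
    rw [e1, e2]
  · intro k
    have h1 : Tendsto (fun M : ℕ => w (M - k) / ((k:ℝ) + 1) ^ 2) atTop (nhds 0) := by
      have := (hw.comp (tendsto_sub_atTop_nat k)).div_const (((k:ℝ) + 1) ^ 2)
      simpa using this
    refine h1.congr' ?_
    filter_upwards [eventually_ge_atTop k] with M hM
    rw [if_pos (by omega)]
  · refine Eventually.of_forall fun M k => ?_
    split_ifs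
    · rw [norm_div, Real.norm_of_nonneg (by positivity : (0:ℝ) ≤ ((k:ℝ) + 1) ^ 2)]
      gcongr
      exact hE' _
    · simp; positivity

/-- Partial sums of the difference of the two partial-fraction expansions. -/
def Rsum (a : ℤ → ℂ) (M : ℕ) (z : ℂ) : ℂ :=
  ∑ n ∈ Finset.Icc (-(M:ℤ)) (M:ℤ), (1 / (z - a n) - 1 / (z - Real.pi * n))

namespace ZF

variable {f : ℂ → ℂ} {a : ℤ → ℂ}

theorem small (h : ZF f a) {δ : ℝ} (hδ : 0 < δ) :
    ∃ n0 : ℕ, ∀ n : ℤ, (n0 : ℤ) ≤ |n| → ‖a n - Real.pi * n‖ ≤ δ := by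
  have h1 := h.asym
  rw [Metric.tendsto_nhds] at h1
  have h2 := h1 δ hδ
  rw [Int.cofinite_eq, eventually_sup, eventually_atBot, eventually_atTop] at h2
  obtain ⟨⟨A, hA⟩, ⟨B, hB⟩⟩ := h2
  refine ⟨A.natAbs + B.natAbs, fun n hn => ?_⟩
  simp only [dist_zero_right] at hA hB
  rcases le_total 0 n with h0 | h0
  · exact (hB n (by rw [abs_of_nonneg h0] at hn; omega)).le
  · exact (hA n (by rw [abs_of_nonpos h0] at hn; omega)).le

theorem bounded (h : ZF f a) : ∃ E : ℝ, 0 ≤ E ∧ ∀ n, ‖a n - Real.pi * n‖ ≤ E := by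
  obtain ⟨E, hE⟩ := h.asym.norm.bddAbove_range_of_cofinite
  exact ⟨E, (norm_nonneg _).trans (hE (mem_range_self 0)), fun n => hE (mem_range_self n)⟩

theorem wlim (h : ZF f a) : Tendsto (fun k : ℕ => ‖a k - Real.pi * (k:ℤ)‖ +
    ‖a (-(k:ℤ)) - Real.pi * ((-(k:ℤ) : ℤ) : ℂ)‖) atTop (nhds 0) := by
  have i1 : Tendsto (fun k : ℕ => (k:ℤ)) atTop cofinite := by
    rw [← Nat.cofinite_eq_atTop]; exact Nat.cast_injective.tendsto_cofinite
  have i2 : Tendsto (fun k : ℕ => -(k:ℤ)) atTop cofinite := by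
    rw [← Nat.cofinite_eq_atTop]
    exact (neg_injective.comp Nat.cast_injective).tendsto_cofinite
  have := (h.asym.comp i1).norm.add (h.asym.comp i2).norm
  simpa using this

theorem term_eq {z b c : ℂ} (h1 : z - b ≠ 0) (h2 : z - c ≠ 0) :
    1 / (z - b) - 1 / (z - c) = (b - c) / ((z - b) * (z - c)) := by
  field_simp; ring

theorem circle_R (h : ZF f a) {η : ℝ} (hη : 0 < η) : ∃ M0 : ℕ, ∀ M ≥ M0, ∀ z : ℂ,
    ‖z‖ = Real.pi * (M + 1/2) → ‖Rsum a M z‖ ≤ η := by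
  obtain ⟨n0, hn0⟩ := h.small (δ := 1/2) (by norm_num)
  obtain ⟨E, hE0, hE⟩ := h.bounded
  have t := (tannery_conv h.wlim).const_mul 2
  rw [mul_zero] at t
  obtain ⟨M1, hM1⟩ := eventually_atTop.mp (t.eventually (gt_mem_nhds hη))
  refine ⟨max M1 (n0 + ⌈2 * E⌉₊), fun M hM z hz => ?_⟩
  have hMa : M1 ≤ M := (le_max_left _ _).trans hM
  have hMb : n0 + ⌈2 * E⌉₊ ≤ M := (le_max_right _ _).trans hM
  have hMc : (n0:ℝ) + 2 * E ≤ M := by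
    have h1 : ((n0 + ⌈2 * E⌉₊ : ℕ) : ℝ) ≤ M := Nat.cast_le.mpr hMb
    push_cast at h1
    linarith [Nat.le_ceil (2 * E)]
  refine le_trans ?_ (hM1 M hMa).le
  set g : ℤ → ℝ := fun n => 2 * (‖a n - Real.pi * n‖ / ((M:ℝ) - |(n:ℝ)| + 1) ^ 2) with hg
  have hterm : ∀ n ∈ Finset.Icc (-(M:ℤ)) (M:ℤ), ‖1 / (z - a n) - 1 / (z - Real.pi * n)‖ ≤ g n := by
    intro n hn
    rw [Finset.mem_Icc] at hn
    have hnM : |(n:ℝ)| ≤ M := by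
      rw [abs_le]; constructor
      · have := hn.1; exact_mod_cast this
      · have := hn.2; exact_mod_cast this
    set d := (M:ℝ) - |(n:ℝ)| + 1 with hd
    have hd1 : 1 ≤ d := by linarith
    have he : ‖a n - Real.pi * n‖ ≤ d / 2 := by
      by_cases hc : (n0:ℤ) ≤ |n|
      · exact (hn0 n hc).trans (by linarith)
      · refine (hE n).trans ?_
        have : |(n:ℝ)| ≤ n0 := by
          have : |n| ≤ n0 := by omega
          exact_mod_cast this
        linarith
    have b1 : d ≤ ‖z - Real.pi * n‖ := by
      have h1 := norm_sub_norm_le z (Real.pi * n)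
      rw [hz, norm_mul, Complex.norm_real, Complex.norm_intCast, Real.norm_of_nonneg Real.pi_pos.le] at h1
      have h2 := Real.pi_gt_three
      nlinarith
    have b2 : d / 2 ≤ ‖z - a n‖ := by
      have h1 : z - Real.pi * n = (z - a n) + (a n - Real.pi * n) := by ring
      have h2 := norm_add_le (z - a n) (a n - Real.pi * n)
      rw [← h1] at h2
      linarith
    have d0 : 0 < d := by linarith
    rw [term_eq (norm_pos_iff.mp (by linarith)) (norm_pos_iff.mp (by linarith)), norm_div, norm_mul]
    calc _ ≤ ‖a n - Real.pi * n‖ / (d / 2 * d) := by gcongr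
      _ = g n := by simp only [hg, ← hd]; field_simp
  calc ‖Rsum a M z‖ ≤ ∑ n ∈ Finset.Icc (-(M:ℤ)) (M:ℤ), g n :=
        (norm_sum_le _ _).trans (Finset.sum_le_sum hterm)
    _ ≤ ∑ k ∈ Finset.range (M + 1), (g k + g (-k)) := sum_Icc_le_sym (fun n => by positivity) M
    _ = _ := by
        rw [Finset.mul_sum]
        refine Finset.sum_congr rfl fun k _ => ?_
        simp only [hg]
        push_cast
        rw [abs_neg, Nat.abs_cast]
        ring

theorem circle_log (h : ZF f a) {η : ℝ} (hη : 0 < η) : ∃ M0 : ℕ, ∀ M ≥ M0, ∀ z : ℂ,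
    ‖z‖ = Real.pi * (M + 1/2) → f z ≠ 0 ∧ Complex.sin z ≠ 0 ∧
      ‖logDeriv f z - logDeriv Complex.sin z‖ ≤ η := by
  set ε := min (1/16) (η / 512) with hε
  have hε0 : 0 < ε := lt_min (by norm_num) (by positivity)
  obtain ⟨R, hR⟩ := h.growth ε hε0
  refine ⟨⌈R⌉₊ + 1, fun M hM z hz => ?_⟩
  have hzR : R + 1 ≤ ‖z‖ := by
    have h1 : ((⌈R⌉₊ + 1 : ℕ) : ℝ) ≤ M := Nat.cast_le.mpr hM
    push_cast at h1
    have := Nat.le_ceil R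
    rw [hz]
    nlinarith [Real.pi_gt_three]
  set X := Real.exp |z.im| with hX
  have hX0 : 0 < X := Real.exp_pos _
  have hs := norm_sin_ge_circle hz
  have hfs := hR z (by linarith)
  have hsX := norm_sin_le z
  have hcX := norm_cos_le z
  have hff : X / 16 ≤ ‖f z‖ := by
    have h1 : Complex.sin z = f z - (f z - Complex.sin z) := by ring
    have h2 := norm_sub_le (f z) (f z - Complex.sin z)
    rw [← h1] at h2
    have h3 : ε * X ≤ 1/16 * X := by gcongr; exact min_le_left _ _
    linarith
  have hs0 : Complex.sin z ≠ 0 := norm_pos_iff.mp (by linarith)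
  have hf0 : f z ≠ 0 := norm_pos_iff.mp (by linarith)
  refine ⟨hf0, hs0, ?_⟩
  have hder : ‖deriv f z - Complex.cos z‖ ≤ 3 * (ε * X) := by
    have h1 : deriv (fun z => f z - Complex.sin z) z = deriv f z - Complex.cos z := by
      rw [deriv_fun_sub (h.diff z) Complex.differentiableAt_sin, Complex.deriv_sin]
    rw [← h1]
    have hd : Differentiable ℂ (fun z => f z - Complex.sin z) := h.diff.sub Complex.differentiable_sin
    have := Complex.norm_deriv_le_of_forall_mem_sphere_norm_le (c := z) (R := 1) (C := 3 * (ε * X))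
      one_pos hd.diffContOnCl ?_
    · simpa using this
    · intro y hy
      rw [mem_sphere_iff_norm] at hy
      have h2 : ‖z‖ ≤ ‖y‖ + 1 := by
        rw [← hy, norm_sub_rev]
        calc ‖z‖ = ‖y + (z - y)‖ := by ring_nf
          _ ≤ _ := norm_add_le _ _
      refine (hR y (by linarith)).trans ?_
      have h3 : |y.im| ≤ |z.im| + 1 := by
        have : |(y - z).im| ≤ 1 := hy ▸ Complex.abs_im_le_norm (y - z)
        rw [Complex.sub_im] at this
        have := abs_sub_abs_le_abs_sub y.im z.im
        linarith
      have h4 : Real.exp |y.im| ≤ X * 3 := by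
        refine (Real.exp_le_exp.mpr h3).trans ?_
        rw [Real.exp_add]
        gcongr
        linarith [Real.exp_one_lt_d9]
      calc ε * Real.exp |y.im| ≤ ε * (X * 3) := by gcongr
        _ = _ := by ring
  have e : logDeriv f z - logDeriv Complex.sin z =
      ((deriv f z - Complex.cos z) * Complex.sin z - (f z - Complex.sin z) * Complex.cos z) /
        (f z * Complex.sin z) := by
    rw [logDeriv_apply, logDeriv_apply, Complex.deriv_sin]
    field_simp
    ring
  rw [e, norm_div, div_le_iff₀ (norm_pos_iff.mpr (mul_ne_zero hf0 hs0)), norm_mul]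
  calc _ ≤ ‖deriv f z - Complex.cos z‖ * ‖Complex.sin z‖ + ‖f z - Complex.sin z‖ * ‖Complex.cos z‖ := by
        rw [← norm_mul, ← norm_mul]; exact norm_sub_le _ _
    _ ≤ 3 * (ε * X) * X + ε * X * X := by gcongr
    _ = 4 * ε * X ^ 2 := by ring
    _ ≤ 4 * (η / 512) * X ^ 2 := by gcongr; exact min_le_right _ _
    _ = η * ((X / 16) * (X / 8)) := by ring
    _ ≤ η * (‖f z‖ * ‖Complex.sin z‖) := by gcongr

end ZF

theorem norm_le_of_sphere {g : ℂ → ℂ} {ρ C : ℝ} (hg : ∀ z, ‖z‖ ≤ ρ → DifferentiableAt ℂ g z)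
    (hC : ∀ z, ‖z‖ = ρ → ‖g z‖ ≤ C) (hρ : 0 < ρ) {z : ℂ} (hz : ‖z‖ ≤ ρ) : ‖g z‖ ≤ C := by
  have hd : DiffContOnCl ℂ g (Metric.ball 0 ρ) := by
    refine DifferentiableOn.diffContOnCl ?_
    rw [closure_ball _ hρ.ne']
    intro w hw
    exact (hg w (by simpa using hw)).differentiableWithinAt
  refine Complex.norm_le_of_forall_mem_frontier_norm_le Metric.isBounded_ball hd ?_ ?_
  · intro w hw
    rw [frontier_ball _ hρ.ne'] at hw
    exact hC w (by simpa using hw)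
  · rw [closure_ball _ hρ.ne']; simpa using hz

namespace ZF

variable {f : ℂ → ℂ} {a : ℤ → ℂ}

/-- The quotient of `f` by its first zeros. -/
def U (h : ZF f a) (N : ℕ) : ℂ → ℂ := (h.div_exists (Finset.Icc (-(N:ℤ)) (N:ℤ))).choose

theorem U_diff (h : ZF f a) (N : ℕ) : Differentiable ℂ (h.U N) :=
  (h.div_exists (Finset.Icc (-(N:ℤ)) (N:ℤ))).choose_spec.1

theorem U_eq (h : ZF f a) (N : ℕ) (z : ℂ) :
    f z = (∏ n ∈ Finset.Icc (-(N:ℤ)) (N:ℤ), (z - a n)) * h.U N z :=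
  (h.div_exists (Finset.Icc (-(N:ℤ)) (N:ℤ))).choose_spec.2.1 z

theorem U_zero (h : ZF f a) (N : ℕ) {z : ℂ} (hz : h.U N z = 0) :
    ∃ n, n ∉ Finset.Icc (-(N:ℤ)) (N:ℤ) ∧ a n = z :=
  (h.div_exists (Finset.Icc (-(N:ℤ)) (N:ℤ))).choose_spec.2.2 z hz

theorem U_ne (h : ZF f a) : ∃ N0 : ℕ, ∀ N ≥ N0, ∀ z : ℂ, ‖z‖ ≤ Real.pi * (N + 1/2) →
    h.U N z ≠ 0 := by
  obtain ⟨n0, hn0⟩ := h.small (δ := 1) one_pos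
  refine ⟨n0, fun N hN z hz h0 => ?_⟩
  obtain ⟨n, hn, rfl⟩ := h.U_zero N h0
  have hn1 : (N:ℤ) + 1 ≤ |n| := by
    rw [Finset.mem_Icc] at hn
    rcases le_total 0 n with h | h
    · rw [abs_of_nonneg h]; omega
    · rw [abs_of_nonpos h]; omega
  have h1 := hn0 n (by omega)
  have h2 : (N:ℝ) + 1 ≤ |(n:ℝ)| := by exact_mod_cast hn1
  have h3 : ‖(Real.pi * n : ℂ)‖ = Real.pi * |(n:ℝ)| := by
    rw [norm_mul, Complex.norm_real, Complex.norm_intCast, Real.norm_of_nonneg Real.pi_pos.le]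
  have h4 := norm_sub_norm_le (Real.pi * n : ℂ) (a n)
  rw [norm_sub_rev, h3] at h4
  nlinarith [Real.pi_gt_three]

theorem logDeriv_U_sub (h : ZF f a) (N : ℕ) {z : ℂ} (hf : f z ≠ 0) (hs : Complex.sin z ≠ 0) :
    logDeriv (h.U N) z - logDeriv (ZF_sin.U N) z =
      logDeriv f z - logDeriv Complex.sin z - Rsum a N z := by
  rw [logDeriv_div_exists (h.U_diff N) (h.U_eq N) hf,
    logDeriv_div_exists (ZF_sin.U_diff N) (ZF_sin.U_eq N) hs, Rsum, Finset.sum_sub_distrib]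
  ring

theorem logDeriv_diffAt {u : ℂ → ℂ} (hu : Differentiable ℂ u) {z : ℂ} (hz : u z ≠ 0) :
    DifferentiableAt ℂ (logDeriv u) z := by
  have : DifferentiableAt ℂ (deriv u) z := by
    have := (hu.analyticAt z).deriv
    exact this.differentiableAt
  exact this.div (hu z) hz

theorem claimA (h : ZF f a) {η : ℝ} (hη : 0 < η) : ∃ M0 : ℕ, ∀ M ≥ M0, ∀ z : ℂ,
    ‖z‖ ≤ Real.pi * (M + 1/2) → f z ≠ 0 → Complex.sin z ≠ 0 →
      ‖logDeriv f z - logDeriv Complex.sin z - Rsum a M z‖ ≤ η := by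
  obtain ⟨M1, h1⟩ := h.circle_log (half_pos hη)
  obtain ⟨M2, h2⟩ := h.circle_R (half_pos hη)
  obtain ⟨M3, h3⟩ := h.U_ne
  obtain ⟨M4, h4⟩ := ZF_sin.U_ne
  refine ⟨M1 + M2 + M3 + M4, fun M hM z hz hf hs => ?_⟩
  rw [← h.logDeriv_U_sub M hf hs]
  refine norm_le_of_sphere (g := fun z => logDeriv (h.U M) z - logDeriv (ZF_sin.U M) z)
    (ρ := Real.pi * (M + 1/2)) ?_ ?_ (by positivity) hz
  · intro w hw
    exact (logDeriv_diffAt (h.U_diff M) (h3 M (by omega) w hw)).sub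
      (logDeriv_diffAt (ZF_sin.U_diff M) (h4 M (by omega) w hw))
  · intro w hw
    obtain ⟨a1, a2, a3⟩ := h1 M (by omega) w hw
    have a4 := h2 M (by omega) w hw
    rw [h.logDeriv_U_sub M a1 a2]
    exact (norm_sub_le _ _).trans (by linarith)

theorem claimB (h : ZF f a) {δ : ℝ} (hδ : 0 < δ) : ∃ N0 : ℕ, 1 ≤ N0 ∧ ∀ N ≥ N0, ∀ z : ℂ,
    ‖z‖ < N + 1 → f z ≠ 0 → Complex.sin z ≠ 0 →
      ‖logDeriv f z - logDeriv Complex.sin z - Rsum a N z‖ ≤ δ / N := by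
  obtain ⟨n0, hn0⟩ := h.small (δ := min 1 δ) (lt_min one_pos hδ)
  refine ⟨n0 + 1, by omega, fun N hN z hz hf hs => ?_⟩
  have hN1 : 1 ≤ N := by omega
  have hN1' : (1:ℝ) ≤ N := by exact_mod_cast hN1
  have term : ∀ n : ℤ, (N:ℤ) + 1 ≤ |n| → ‖1 / (z - a n) - 1 / (z - Real.pi * n)‖ ≤
      δ / 2 / |(n:ℝ)| ^ 2 := by
    intro n hn
    have h1 := hn0 n (by omega)
    have h2 : (N:ℝ) + 1 ≤ |(n:ℝ)| := by exact_mod_cast hn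
    have h3 : ‖(Real.pi * n : ℂ)‖ = Real.pi * |(n:ℝ)| := by
      rw [norm_mul, Complex.norm_real, Complex.norm_intCast, Real.norm_of_nonneg Real.pi_pos.le]
    have h4 := norm_sub_norm_le (Real.pi * n : ℂ) z
    rw [norm_sub_rev, h3] at h4
    have h5 : 2 * |(n:ℝ)| ≤ ‖z - Real.pi * n‖ := by nlinarith [Real.pi_gt_three]
    have h6 : |(n:ℝ)| ≤ ‖z - a n‖ := by
      have e1 : z - Real.pi * n = (z - a n) + (a n - Real.pi * n) := by ring
      have e2 := norm_add_le (z - a n) (a n - Real.pi * n)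
      rw [← e1] at e2
      linarith [min_le_left 1 δ]
    have h7 : 0 < |(n:ℝ)| := by linarith
    rw [term_eq (norm_pos_iff.mp (by linarith)) (norm_pos_iff.mp (by linarith)), norm_div, norm_mul]
    calc _ ≤ δ / (|(n:ℝ)| * (2 * |(n:ℝ)|)) := by
          gcongr
          exact h1.trans (min_le_right _ _)
      _ = _ := by field_simp
  have tele : ∀ j : ℕ, ‖Rsum a (N + j) z - Rsum a N z‖ ≤ δ * (1 / (N:ℝ) - 1 / ((N + j : ℕ):ℝ)) := by
    intro j
    induction j with
    | zero => simp
    | succ j ih =>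
      have e : Rsum a (N + (j + 1)) z - Rsum a N z = (Rsum a (N + j) z - Rsum a N z) +
          ((1 / (z - a ((N + j + 1 : ℕ):ℤ)) - 1 / (z - Real.pi * (((N + j + 1 : ℕ):ℤ):ℂ))) +
           (1 / (z - a (-((N + j + 1 : ℕ):ℤ))) - 1 / (z - Real.pi * ((-((N + j + 1 : ℕ):ℤ) : ℤ):ℂ)))) := by
        have := sum_Icc_succ_sym (fun n : ℤ => 1 / (z - a n) - 1 / (z - Real.pi * n)) (N + j)
        simp only [Rsum]
        rw [show N + (j + 1) = N + j + 1 from rfl, this]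
        ring
      rw [e]
      have t1 := term ((N + j + 1 : ℕ):ℤ) (by rw [Nat.abs_cast]; push_cast; omega)
      have t2 := term (-((N + j + 1 : ℕ):ℤ)) (by rw [abs_neg, Nat.abs_cast]; push_cast; omega)
      have c1 : |(((N + j + 1 : ℕ):ℤ):ℝ)| = (N + j : ℕ) + 1 := by
        rw [Int.cast_natCast, Nat.abs_cast]; push_cast; ring
      have c2 : |((-((N + j + 1 : ℕ):ℤ) : ℤ):ℝ)| = (N + j : ℕ) + 1 := by
        rw [Int.cast_neg, abs_neg, c1]
      rw [c1] at t1
      rw [c2] at t2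
      have hx : (0:ℝ) < (N + j : ℕ) := by exact_mod_cast (by omega : 0 < N + j)
      have c3 : ((N + (j + 1) : ℕ) : ℝ) = (N + j : ℕ) + 1 := by push_cast; ring
      rw [c3]
      generalize ((N + j : ℕ) : ℝ) = x at *
      have key : δ / 2 / (x + 1) ^ 2 + δ / 2 / (x + 1) ^ 2 ≤ δ * (1 / x - 1 / (x + 1)) := by
        have : 1 / (x + 1) ^ 2 ≤ 1 / x - 1 / (x + 1) := by
          rw [div_sub_div _ _ hx.ne' (by positivity), div_le_div_iff₀ (by positivity) (by positivity)]
          nlinarith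
        calc _ = δ * (1 / (x + 1) ^ 2) := by ring
          _ ≤ _ := by gcongr
      refine (norm_add_le _ _).trans ((add_le_add ih ((norm_add_le _ _).trans (add_le_add t1 t2))).trans ?_)
      linarith
  refine le_of_forall_pos_le_add fun η hη => ?_
  obtain ⟨M0, hM0⟩ := h.claimA hη
  have hA := hM0 (N + M0) (by omega) z ?_ hf hs
  · have hT := tele M0
    have : logDeriv f z - logDeriv Complex.sin z - Rsum a N z =
      (Rsum a (N + M0) z - Rsum a N z) + (logDeriv f z - logDeriv Complex.sin z - Rsum a (N + M0) z) := by ring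
    rw [this]
    refine (norm_add_le _ _).trans (add_le_add (hT.trans ?_) hA)
    have : 0 ≤ 1 / ((N + M0 : ℕ):ℝ) := by positivity
    calc _ ≤ δ * (1 / (N:ℝ)) := by gcongr; linarith
      _ = _ := by ring
  · push_cast
    have : (0:ℝ) ≤ M0 := Nat.cast_nonneg _
    nlinarith [Real.pi_gt_three]

theorem claimB' (h : ZF f a) {δ : ℝ} (hδ : 0 < δ) : ∃ N0 : ℕ, 1 ≤ N0 ∧ ∀ N ≥ N0, ∀ z : ℂ,
    ‖z‖ < N + 1 → h.U N z ≠ 0 ∧ ZF_sin.U N z ≠ 0 ∧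
      ‖logDeriv (h.U N) z - logDeriv (ZF_sin.U N) z‖ ≤ δ / N := by
  obtain ⟨N1, h11, h1⟩ := h.claimB hδ
  obtain ⟨M3, h3⟩ := h.U_ne
  obtain ⟨M4, h4⟩ := ZF_sin.U_ne
  refine ⟨N1 + M3 + M4, by omega, fun N hN => ?_⟩
  have hrad : ∀ z : ℂ, ‖z‖ < N + 1 → ‖z‖ ≤ Real.pi * (N + 1/2) := by
    intro z hz
    have : (0:ℝ) ≤ N := Nat.cast_nonneg _
    nlinarith [Real.pi_gt_three]
  have hcount : ((range a) ∪ range (fun n : ℤ => (Real.pi * n : ℂ))).Countable :=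
    (countable_range _).union (countable_range _)
  have hdense := hcount.dense_compl ℂ
  intro z hz
  refine ⟨h3 N (by omega) z (hrad z hz), h4 N (by omega) z (hrad z hz), ?_⟩
  by_contra hcon
  rw [not_le] at hcon
  have hcont : ContinuousAt (fun z => ‖logDeriv (h.U N) z - logDeriv (ZF_sin.U N) z‖) z :=
    ((logDeriv_diffAt (h.U_diff N) (h3 N (by omega) z (hrad z hz))).sub
      (logDeriv_diffAt (ZF_sin.U_diff N) (h4 N (by omega) z (hrad z hz)))).continuousAt.norm
  have ev : ∀ᶠ w in nhds z, δ / N < ‖logDeriv (h.U N) w - logDeriv (ZF_sin.U N) w‖ ∧ ‖w‖ < N + 1 :=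
    (hcont.eventually (lt_mem_nhds hcon)).and
      (continuous_norm.continuousAt.eventually (gt_mem_nhds hz))
  obtain ⟨w, ⟨hw1, hw2⟩, hw3⟩ := mem_closure_iff_nhds.mp (hdense z) _ ev
  have hfw : f w ≠ 0 := fun h0 => hw3 (Or.inl ((h.zero w).mp h0))
  have hsw : Complex.sin w ≠ 0 := fun h0 => hw3 (Or.inr ((ZF_sin.zero w).mp h0))
  have := h1 N (by omega) w hw2 hfw hsw
  rw [← h.logDeriv_U_sub N hfw hsw] at this
  linarith

end ZF

namespace ZF

variable {f : ℂ → ℂ} {a : ℤ → ℂ}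

theorem q_lim (h : ZF f a) : Tendsto (fun N : ℕ => ∏ n ∈ Finset.Icc (-(N:ℤ)) (N:ℤ),
    ((I * N - a n) / (I * N - Real.pi * n))) atTop (nhds 1) := by
  have ces := h.wlim.cesaro
  have ces1 := (ces.comp (tendsto_add_atTop_nat 1)).const_mul 2
  rw [mul_zero] at ces1
  have ces2 := (Real.continuous_exp.tendsto 0).comp ces1
  rw [Real.exp_zero] at ces2
  have ces3 := ces2.sub_const 1
  rw [sub_self] at ces3
  rw [tendsto_iff_norm_sub_tendsto_zero]
  refine squeeze_zero' (Eventually.of_forall fun _ => norm_nonneg _) ?_ ces3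
  filter_upwards [eventually_ge_atTop 1] with N hN
  have hN' : (1:ℝ) ≤ N := by exact_mod_cast hN
  have hlow : ∀ n : ℤ, (N:ℝ) ≤ ‖I * N - Real.pi * n‖ := by
    intro n
    have := Complex.abs_im_le_norm (I * N - Real.pi * n)
    simpa using this
  have e : ∏ n ∈ Finset.Icc (-(N:ℤ)) (N:ℤ), ((I * N - a n) / (I * N - Real.pi * n)) =
      ∏ n ∈ Finset.Icc (-(N:ℤ)) (N:ℤ), (1 + (Real.pi * n - a n) / (I * N - Real.pi * n)) := by
    refine Finset.prod_congr rfl fun n _ => ?_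
    have : I * N - Real.pi * n ≠ 0 := norm_pos_iff.mp (by linarith [hlow n])
    field_simp
    ring
  rw [e]
  refine (Finset.norm_prod_one_add_sub_one_le _ _).trans ?_
  simp only [Function.comp]
  gcongr
  set W : ℕ → ℝ := fun k : ℕ => ‖a k - Real.pi * (k:ℤ)‖ +
    ‖a (-(k:ℤ)) - Real.pi * ((-(k:ℤ) : ℤ) : ℂ)‖ with hW
  have hS0 : 0 ≤ ∑ k ∈ Finset.range (N + 1), W k := Finset.sum_nonneg fun k _ => by positivity
  calc ∑ n ∈ Finset.Icc (-(N:ℤ)) (N:ℤ), ‖(Real.pi * n - a n) / (I * N - Real.pi * n)‖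
      ≤ ∑ n ∈ Finset.Icc (-(N:ℤ)) (N:ℤ), ‖a n - Real.pi * n‖ / N := by
        refine Finset.sum_le_sum fun n _ => ?_
        rw [norm_div, norm_sub_rev]
        gcongr
        exact hlow n
    _ = (∑ n ∈ Finset.Icc (-(N:ℤ)) (N:ℤ), ‖a n - Real.pi * n‖) / N := by rw [Finset.sum_div]
    _ ≤ (∑ k ∈ Finset.range (N + 1), W k) / N := by
        gcongr
        exact sum_Icc_le_sym (g := fun n => ‖a n - Real.pi * n‖) (fun n => norm_nonneg _) N
    _ ≤ 2 * ((((N + 1 : ℕ) : ℝ))⁻¹ * ∑ k ∈ Finset.range (N + 1), W k) := by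
        rw [← mul_assoc, div_eq_inv_mul]
        gcongr
        rw [← div_eq_mul_inv, inv_eq_one_div, div_le_div_iff₀ (by linarith) (by positivity)]
        push_cast
        linarith

theorem F_lim (h : ZF f a) : Tendsto (fun N : ℕ => f (I * N) / Complex.sin (I * N)) atTop (nhds 1) := by
  rw [Metric.tendsto_atTop]
  intro ε hε
  obtain ⟨R, hR⟩ := h.growth (ε / 16) (by positivity)
  refine ⟨⌈R⌉₊ + 1, fun N hN => ?_⟩
  have hN1 : ((⌈R⌉₊ + 1 : ℕ) : ℝ) ≤ N := Nat.cast_le.mpr hN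
  push_cast at hN1
  have hRR := Nat.le_ceil R
  have hR0 : (0:ℝ) ≤ ⌈R⌉₊ := Nat.cast_nonneg _
  have him : (I * (N:ℂ)).im = N := by simp
  have h1 := hR (I * N) (by simp; linarith)
  have h2 := norm_sin_ge_of_im (z := I * N) (by rw [him, Nat.abs_cast]; linarith)
  set X := Real.exp |(I * (N:ℂ)).im|
  have hX : 0 < X := Real.exp_pos _
  have hs : Complex.sin (I * N) ≠ 0 := norm_pos_iff.mp (by linarith)
  rw [dist_eq_norm, div_sub_one hs, norm_div, div_lt_iff₀ (norm_pos_iff.mpr hs)]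
  calc _ ≤ ε / 16 * X := h1
    _ < ε * (X / 8) := by nlinarith
    _ ≤ _ := by gcongr

theorem G_lim (h : ZF f a) : Tendsto (fun N : ℕ => h.U N (I * N) / ZF_sin.U N (I * N)) atTop (nhds 1) := by
  have t := h.F_lim.div h.q_lim one_ne_zero
  rw [div_one] at t
  refine t.congr' ?_
  filter_upwards [h.q_lim.eventually_ne one_ne_zero, h.F_lim.eventually_ne one_ne_zero] with N h1 h2
  rw [Finset.prod_div_distrib] at h1
  have hp : ∏ n ∈ Finset.Icc (-(N:ℤ)) (N:ℤ), (I * (N:ℂ) - a n) ≠ 0 := by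
    intro h0; rw [h0, zero_div] at h1; exact h1 rfl
  have hs : ∏ n ∈ Finset.Icc (-(N:ℤ)) (N:ℤ), (I * (N:ℂ) - Real.pi * n) ≠ 0 := by
    intro h0; rw [h0, div_zero] at h1; exact h1 rfl
  have hsin : Complex.sin (I * N) ≠ 0 := by
    intro h0; rw [h0, div_zero] at h2; exact h2 rfl
  simp only [Pi.div_apply]
  rw [Finset.prod_div_distrib, h.U_eq N (I * N), ZF_sin.U_eq N (I * N)]
  rw [ZF_sin.U_eq N (I * N)] at hsin
  have hV := right_ne_zero_of_mul hsin
  field_simp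

theorem claimG (h : ZF f a) {η : ℝ} (hη : 0 < η) : ∃ N0 : ℕ, ∀ N ≥ N0, ∀ z : ℂ, ‖z‖ < N + 1 →
    h.U N z ≠ 0 ∧ ZF_sin.U N z ≠ 0 ∧ ‖h.U N z / ZF_sin.U N z - 1‖ ≤ η := by
  set δ := min (1/6) (η / 24) with hδ
  have hδ0 : 0 < δ := lt_min (by norm_num) (by positivity)
  obtain ⟨N1, hN1, h1⟩ := h.claimB' hδ0
  obtain ⟨N2, h2⟩ := Metric.tendsto_atTop.mp h.G_lim (η / 4) (by positivity)
  refine ⟨N1 + N2, fun N hN => ?_⟩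
  have hB := h1 N (by omega)
  have hG := h2 N (by omega)
  have hNr : (1:ℝ) ≤ N := by exact_mod_cast (by omega : 1 ≤ N)
  intro z hz
  refine ⟨(hB z hz).1, (hB z hz).2.1, ?_⟩
  have hLd : DifferentiableOn ℂ (fun z => logDeriv (h.U N) z - logDeriv (ZF_sin.U N) z)
      (Metric.ball 0 (N + 1)) := by
    intro w hw
    have hw' : ‖w‖ < N + 1 := by simpa using hw
    exact ((logDeriv_diffAt (h.U_diff N) (hB w hw').1).sub
      (logDeriv_diffAt (ZF_sin.U_diff N) (hB w hw').2.1)).differentiableWithinAt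
  obtain ⟨g, hg⟩ := hLd.isExactOn_ball
  have hK : ∀ w ∈ Metric.ball (0:ℂ) (N + 1),
      HasDerivAt (fun w => h.U N w / ZF_sin.U N w * cexp (-g w)) 0 w := by
    intro w hw
    have hw' : ‖w‖ < N + 1 := by simpa using hw
    obtain ⟨b1, b2, -⟩ := hB w hw'
    have d1 := ((h.U_diff N w).hasDerivAt.div (ZF_sin.U_diff N w).hasDerivAt b2).mul (hg w hw).neg.cexp
    refine HasDerivAt.congr_deriv d1 ?_
    simp only [logDeriv_apply, Pi.div_apply, Pi.neg_apply]
    field_simp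
    ring
  have hconst : ∀ w ∈ Metric.ball (0:ℂ) (N + 1), ∀ w' ∈ Metric.ball (0:ℂ) (N + 1),
      h.U N w / ZF_sin.U N w * cexp (-g w) = h.U N w' / ZF_sin.U N w' * cexp (-g w') := by
    intro w hw w' hw'
    exact Metric.isOpen_ball.is_const_of_deriv_eq_zero (convex_ball _ _).isPreconnected
      (fun y hy => (hK y hy).differentiableAt.differentiableWithinAt) (fun y hy => (hK y hy).deriv) hw hw'
  have hzb : z ∈ Metric.ball (0:ℂ) (N + 1) := by simpa using hz
  have hib : I * (N:ℂ) ∈ Metric.ball (0:ℂ) (N + 1) := by simp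
  have hmv : ‖g z - g (I * N)‖ ≤ 3 * δ := by
    have := (convex_ball (0:ℂ) (N + 1)).norm_image_sub_le_of_norm_hasDerivWithin_le
      (f := g) (C := δ / N) (fun y hy => (hg y hy).hasDerivWithinAt)
      (fun y hy => (hB y (by simpa using hy)).2.2) hib hzb
    refine this.trans ?_
    have d : ‖z - I * N‖ ≤ 3 * N := by
      refine (norm_sub_le _ _).trans ?_
      simp only [norm_mul, norm_I, one_mul, Complex.norm_natCast]
      linarith
    calc δ / N * ‖z - I * N‖ ≤ δ / N * (3 * N) := by gcongr
      _ = 3 * δ := by field_simp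
  have hG' : ‖h.U N (I * N) / ZF_sin.U N (I * N) - 1‖ ≤ η / 4 := by
    rw [← dist_eq_norm]; exact hG.le
  have hδ1 : δ ≤ 1/6 := min_le_left _ _
  have hδ2 : δ ≤ η / 24 := min_le_right _ _
  have hexp := Complex.norm_exp_sub_one_le (x := g z - g (I * N)) (by linarith)
  have e : h.U N z / ZF_sin.U N z = h.U N (I * N) / ZF_sin.U N (I * N) * cexp (g z - g (I * N)) := by
    have := hconst z hzb _ hib
    calc _ = h.U N z / ZF_sin.U N z * cexp (-g z) * cexp (g z) := by
          rw [mul_assoc, ← Complex.exp_add]; simp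
      _ = _ := by rw [this, mul_assoc, ← Complex.exp_add]; ring_nf
  rw [e]
  set G0 := h.U N (I * N) / ZF_sin.U N (I * N)
  set E := cexp (g z - g (I * N))
  have e2 : G0 * E - 1 = (G0 - 1) * (E - 1) + (G0 - 1) + (E - 1) := by ring
  rw [e2]
  have hE : ‖E - 1‖ ≤ 6 * δ := by linarith
  have hm : ‖(G0 - 1) * (E - 1)‖ ≤ η / 4 * 1 := by
    rw [norm_mul]; gcongr; linarith
  refine (norm_add_le _ _).trans ((add_le_add_left (norm_add_le _ _) _).trans ?_)
  linarith

end ZF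

theorem prod_Icc_succ_sym {E : Type*} [CommMonoid E] (g : ℤ → E) (M : ℕ) :
    ∏ n ∈ Finset.Icc (-((M + 1 : ℕ):ℤ)) ((M + 1 : ℕ):ℤ), g n =
      (∏ n ∈ Finset.Icc (-(M:ℤ)) (M:ℤ), g n) * (g ((M + 1 : ℕ):ℤ) * g (-((M + 1 : ℕ):ℤ))) := by
  rw [Icc_succ_sym, Finset.prod_insert, Finset.prod_insert]
  · rw [← mul_assoc, mul_comm]
  · simp
  · simp only [Finset.mem_Icc, Finset.mem_insert]; omega

theorem prod_erase_succ_sym {E : Type*} [CommMonoid E] (g : ℤ → E) (M : ℕ) :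
    ∏ n ∈ (Finset.Icc (-((M + 1 : ℕ):ℤ)) ((M + 1 : ℕ):ℤ)).erase 0, g n =
      (∏ n ∈ (Finset.Icc (-(M:ℤ)) (M:ℤ)).erase 0, g n) *
        (g ((M + 1 : ℕ):ℤ) * g (-((M + 1 : ℕ):ℤ))) := by
  have e : (Finset.Icc (-((M + 1 : ℕ):ℤ)) ((M + 1 : ℕ):ℤ)).erase 0 =
      insert ((M + 1 : ℕ):ℤ) (insert (-((M + 1 : ℕ):ℤ)) ((Finset.Icc (-(M:ℤ)) (M:ℤ)).erase 0)) := by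
    ext n
    simp only [Finset.mem_Icc, Finset.mem_insert, Finset.mem_erase]
    omega
  rw [e, Finset.prod_insert, Finset.prod_insert]
  · rw [← mul_assoc, mul_comm]
  · simp
  · simp only [Finset.mem_Icc, Finset.mem_insert, Finset.mem_erase]; omega

/-- The normalising constants `∏_{0<|n|≤N} 1/(π n)`. -/
def kap (N : ℕ) : ℂ := ∏ k ∈ Finset.range N, (-1 / ((Real.pi : ℂ) * (k + 1)) ^ 2)

theorem pi_ne_zero_C : (Real.pi : ℂ) ≠ 0 := by exact_mod_cast Real.pi_ne_zero

theorem natsucc_ne_zero_C (k : ℕ) : (k : ℂ) + 1 ≠ 0 := by exact_mod_cast Nat.succ_ne_zero k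

theorem kap_sin (N : ℕ) (z : ℂ) : kap N * ∏ n ∈ Finset.Icc (-(N:ℤ)) (N:ℤ), (z - Real.pi * n) =
    z * ∏ k ∈ Finset.range N, (1 + sineTerm (z / Real.pi) k) := by
  have hpi := pi_ne_zero_C
  induction N with
  | zero => simp [kap]
  | succ M ih =>
    have hk : kap (M + 1) = kap M * (-1 / ((Real.pi : ℂ) * (M + 1)) ^ 2) := by
      rw [kap, kap, Finset.prod_range_succ]
    rw [prod_Icc_succ_sym, hk, Finset.prod_range_succ, ← mul_assoc z, ← ih]
    have := natsucc_ne_zero_C M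
    simp only [sineTerm]
    push_cast
    field_simp
    ring

theorem kap_psi (b : ℤ → ℂ) (N : ℕ) (l : ℂ) : (l - b 0) *
    ∏ n ∈ (Finset.Icc (-(N:ℤ)) (N:ℤ)).erase 0, (b n - l) / (Real.pi * (n : ℂ)) =
    kap N * ∏ n ∈ Finset.Icc (-(N:ℤ)) (N:ℤ), (l - b n) := by
  have hpi := pi_ne_zero_C
  induction N with
  | zero => simp [kap]
  | succ M ih =>
    have hk : kap (M + 1) = kap M * (-1 / ((Real.pi : ℂ) * (M + 1)) ^ 2) := by
      rw [kap, kap, Finset.prod_range_succ]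
    rw [prod_Icc_succ_sym, prod_erase_succ_sym, hk, ← mul_assoc, ih]
    have := natsucc_ne_zero_C M
    push_cast
    have e : -((M:ℂ) + 1) = (-1) * (M + 1) := by ring
    rw [e]
    field_simp
    ring

theorem prod_neg_sym (b : ℤ → ℂ) (N : ℕ) : ∏ n ∈ Finset.Icc (-(N:ℤ)) (N:ℤ), (-b n) =
    - ∏ n ∈ Finset.Icc (-(N:ℤ)) (N:ℤ), b n := by
  induction N with
  | zero => simp
  | succ M ih => rw [prod_Icc_succ_sym, prod_Icc_succ_sym, ih]; ring

theorem kap_ne (N : ℕ) : kap N ≠ 0 := by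
  rw [kap, Finset.prod_ne_zero_iff]
  intro k _
  have := natsucc_ne_zero_C k
  have := pi_ne_zero_C
  simp [*]

theorem sphere_sub (K : ℕ) : Metric.sphere (0:ℂ) (K + 1/2) ⊆ (Complex.integerComplement) := by
  intro z hz
  rw [Complex.mem_integerComplement_iff]
  rintro ⟨n, rfl⟩
  simp only [mem_sphere_iff_norm, sub_zero] at hz
  rw [Complex.norm_intCast] at hz
  have h2 : (2:ℝ) * |(n:ℝ)| = 2 * K + 1 := by linarith
  have h3 : 2 * |n| = 2 * (K:ℤ) + 1 := by exact_mod_cast h2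
  omega

theorem kap_unif (K : ℕ) {δ : ℝ} (hδ : 0 < δ) : ∃ N0 : ℕ, ∀ N ≥ N0, ∀ z : ℂ,
    ‖z‖ = Real.pi * (K + 1/2) →
    ‖kap N * ∏ n ∈ Finset.Icc (-(N:ℤ)) (N:ℤ), (z - Real.pi * n) - Complex.sin z‖ ≤ δ := by
  have hpi := pi_ne_zero_C
  have hρ : 0 < Real.pi * (K + 1/2) := by positivity
  have h1 := (HasProdUniformlyOn_sineTerm_prod_on_compact (sphere_sub K)
    (isCompact_sphere _ _)).tendstoUniformlyOn_finsetRange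
  rw [Metric.tendstoUniformlyOn_iff] at h1
  obtain ⟨N0, hN0⟩ := Filter.eventually_atTop.mp (h1 (δ / (Real.pi * (K + 1/2))) (by positivity))
  refine ⟨N0, fun N hN z hz => ?_⟩
  have hz0 : z ≠ 0 := norm_pos_iff.mp (by rw [hz]; exact hρ)
  have h2 := hN0 N hN (z / Real.pi) (by
    simp only [mem_sphere_iff_norm, sub_zero, norm_div, hz]
    simp only [Complex.norm_real, Real.norm_eq_abs, abs_of_pos Real.pi_pos]
    field_simp)
  have e : (Real.pi:ℂ) * (z / Real.pi) = z := by field_simp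
  rw [e, dist_comm, dist_eq_norm] at h2
  rw [kap_sin]
  have e2 : z * ∏ k ∈ Finset.range N, (1 + sineTerm (z / Real.pi) k) - Complex.sin z
    = z * (∏ k ∈ Finset.range N, (1 + sineTerm (z / Real.pi) k) - Complex.sin z / z) := by
    field_simp
  rw [e2, norm_mul, hz]
  rw [lt_div_iff₀ hρ] at h2
  linarith

theorem kap_half : Tendsto (fun N : ℕ => kap N * ∏ n ∈ Finset.Icc (-(N:ℤ)) (N:ℤ),
    (-(Real.pi / 2 : ℂ) - Real.pi * n)) atTop (nhds (-1)) := by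
  rw [Metric.tendsto_atTop]
  intro ε hε
  obtain ⟨N0, h⟩ := kap_unif 0 (half_pos hε)
  refine ⟨N0, fun N hN => ?_⟩
  have := h N hN (-(Real.pi / 2 : ℂ)) (by
    rw [norm_neg, norm_div]
    simp only [Complex.norm_real, Real.norm_eq_abs, abs_of_pos Real.pi_pos]
    norm_num
    ring)
  rw [Complex.sin_neg, Complex.sin_pi_div_two] at this
  rw [dist_eq_norm]
  linarith

/-- Normalising constants for `φ`. -/
def kap' (N : ℕ) : ℂ := ∏ n ∈ Finset.Icc (-(N:ℤ)) (N:ℤ), (1 / (Real.pi * ((n : ℂ) + 1/2)))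

theorem intHalf_ne (n : ℤ) : (n : ℂ) + 1/2 ≠ 0 := by
  intro h
  have : (2:ℂ) * n + 1 = 0 := by linear_combination 2 * h
  have : 2 * n + 1 = 0 := by exact_mod_cast this
  omega

theorem kap'_lim : Tendsto (fun N => kap' N / kap N) atTop (nhds 1) := by
  have t := kap_half.inv₀ (by norm_num) |>.neg
  have e1 : -((-1:ℂ))⁻¹ = 1 := by norm_num
  rw [e1] at t
  refine t.congr fun N => ?_
  have hpi := pi_ne_zero_C
  have e : kap' N * ∏ n ∈ Finset.Icc (-(N:ℤ)) (N:ℤ), (-(Real.pi / 2 : ℂ) - Real.pi * n) = -1 := by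
    rw [kap', ← Finset.prod_mul_distrib]
    have := prod_neg_sym (fun _ => 1) N
    simp only [Finset.prod_const_one] at this
    rw [← this]
    refine Finset.prod_congr rfl fun n _ => ?_
    have h2 := intHalf_ne n
    have e2 : -(Real.pi / 2 : ℂ) - Real.pi * n = -(Real.pi * ((n:ℂ) + 1/2)) := by ring
    rw [e2, mul_neg, one_div, inv_mul_cancel₀ (mul_ne_zero hpi h2)]
  have hk := kap_ne N
  set s := ∏ n ∈ Finset.Icc (-(N:ℤ)) (N:ℤ), (-(Real.pi / 2 : ℂ) - Real.pi * n)
  have hs : s ≠ 0 := by intro h; rw [h] at e; simp at e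
  field_simp
  rw [← e]
  ring

theorem ZF.main {f : ℂ → ℂ} {a : ℤ → ℂ} (h : ZF f a) {κ : ℕ → ℂ}
    (hκ : Tendsto (fun N => κ N / kap N) atTop (nhds 1)) {S : Set ℂ} (hS : IsCompact S) :
    TendstoUniformlyOn (fun (N : ℕ) z => κ N * ∏ n ∈ Finset.Icc (-(N:ℤ)) (N:ℤ), (z - a n))
      f atTop S := by
  obtain ⟨R, hR⟩ := hS.isBounded.exists_norm_le
  obtain ⟨K, hK⟩ := exists_nat_ge R
  set ρ : ℝ := Real.pi * (K + 1/2) with hρd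
  have hρ : 0 < ρ := by positivity
  have hRρ : R ≤ ρ := by
    have := Real.pi_gt_three
    have hK0 : (0:ℝ) ≤ K := by positivity
    nlinarith
  obtain ⟨M, hM⟩ := (isCompact_sphere (0:ℂ) ρ).exists_bound_of_continuousOn h.diff.continuous.continuousOn
  obtain ⟨M', hM'⟩ := (isCompact_sphere (0:ℂ) ρ).exists_bound_of_continuousOn
    Complex.differentiable_sin.continuous.continuousOn
  rw [Metric.tendstoUniformlyOn_iff]
  intro ε hε
  -- the tolerance
  obtain ⟨δ, hδ0, hδ1, hδ2⟩ : ∃ δ : ℝ, 0 < δ ∧ δ ≤ 1/2 ∧ |M| * (100 * (1 + |M'|) * δ) < ε := by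
    refine ⟨min (1/2) (ε / (200 * (1 + |M|) * (1 + |M'|))), lt_min (by norm_num) (by positivity),
      min_le_left _ _, ?_⟩
    calc |M| * (100 * (1 + |M'|) * min (1/2) (ε / (200 * (1 + |M|) * (1 + |M'|))))
        ≤ (1 + |M|) * (100 * (1 + |M'|) * (ε / (200 * (1 + |M|) * (1 + |M'|)))) := by
          gcongr
          · linarith
          · exact min_le_right _ _
      _ = ε / 2 := by
          have : (1 + |M|) ≠ 0 := by positivity
          have : (1 + |M'|) ≠ 0 := by positivity
          field_simp; norm_num
      _ < ε := by linarith
  obtain ⟨N1, h1⟩ := kap_unif K hδ0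
  obtain ⟨N2, h2⟩ := h.claimG hδ0
  obtain ⟨N3, h3⟩ := Metric.tendsto_atTop.mp hκ δ hδ0
  obtain ⟨N4, h4⟩ := exists_nat_gt ρ
  rw [Filter.eventually_atTop]
  refine ⟨N1 + N2 + N3 + N4, fun N hN z hz => ?_⟩
  have g1 := h1 N (by omega)
  have g2 := h2 N (by omega)
  have g3 := h3 N (by omega)
  rw [dist_eq_norm] at g3
  have g4 : ρ < N + 1 := by
    have : (N4:ℝ) ≤ N := by exact_mod_cast (by omega : N4 ≤ N)
    linarith
  rw [dist_eq_norm]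
  refine lt_of_le_of_lt (norm_le_of_sphere (g := fun z => f z - κ N * ∏ n ∈ Finset.Icc (-(N:ℤ)) (N:ℤ), (z - a n))
    (ρ := ρ) (C := |M| * (100 * (1 + |M'|) * δ)) ?_ ?_ hρ ((hR z hz).trans hRρ)) hδ2
  · intro w _
    refine (h.diff w).sub (DifferentiableAt.const_mul ?_ _)
    fun_prop
  · intro w hw
    have hws : w ∈ Metric.sphere (0:ℂ) ρ := by simpa using hw
    have hf := hM w hws
    have hs := hM' w hws
    have hfM : ‖f w‖ ≤ |M| := hf.trans (le_abs_self _)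
    have hsM : ‖Complex.sin w‖ ≤ |M'| := hs.trans (le_abs_self _)
    obtain ⟨b1, b2, b3⟩ := g2 w (by rw [hw]; exact g4)
    have a1 := g1 w hw
    have hsin : 1/8 ≤ ‖Complex.sin w‖ := by
      refine le_trans ?_ (norm_sin_ge_circle hw)
      have := Real.one_le_exp (abs_nonneg w.im)
      linarith
    have hsin0 : Complex.sin w ≠ 0 := norm_pos_iff.mp (by linarith)
    have hk := kap_ne N
    have eU := h.U_eq N w
    have eV := ZF_sin.U_eq N w
    set p := ∏ n ∈ Finset.Icc (-(N:ℤ)) (N:ℤ), (w - a n)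
    set s := ∏ n ∈ Finset.Icc (-(N:ℤ)) (N:ℤ), (w - Real.pi * n)
    set U := h.U N w
    set V := ZF_sin.U N w
    have hs0 : s ≠ 0 := by intro h0; rw [h0, zero_mul] at eV; exact hsin0 eV
    set r := κ N / kap N with hr
    have hκe : κ N = r * kap N := by rw [hr]; field_simp
    set A := r * (kap N * s) with hA
    set G := U / V with hG
    have hAe : ‖A - Complex.sin w‖ ≤ (2 + |M'|) * δ := by
      have e : A - Complex.sin w = r * (kap N * s - Complex.sin w) + (r - 1) * Complex.sin w := by
        rw [hA]; ring
      have hr2 : ‖r‖ ≤ 2 := by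
        have : ‖r‖ ≤ ‖r - 1‖ + ‖(1:ℂ)‖ := by simpa using norm_add_le (r - 1) 1
        rw [norm_one] at this
        linarith
      rw [e]
      refine (norm_add_le _ _).trans ?_
      rw [norm_mul, norm_mul]
      calc _ ≤ 2 * δ + δ * |M'| := by gcongr
        _ = _ := by ring
    have hG0 : G ≠ 0 := div_ne_zero b1 b2
    have hGn : 1/2 ≤ ‖G‖ := by
      have : ‖(1:ℂ)‖ ≤ ‖G‖ + ‖G - 1‖ := by simpa using norm_sub_le G (G - 1)
      rw [norm_one] at this
      linarith
    have e : f w - κ N * p = f w * (((G - 1) - (A - Complex.sin w) / Complex.sin w) / G) := by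
      rw [hκe, hA, hG, eU, eV]
      field_simp
      ring
    rw [e, norm_mul, norm_div]
    have n1 : ‖(G - 1) - (A - Complex.sin w) / Complex.sin w‖ ≤ δ + 8 * ((2 + |M'|) * δ) := by
      refine (norm_sub_le _ _).trans (add_le_add b3 ?_)
      rw [norm_div, div_le_iff₀ (by linarith)]
      have : 0 ≤ (2 + |M'|) * δ := by positivity
      nlinarith
    have n2 : ‖(G - 1) - (A - Complex.sin w) / Complex.sin w‖ / ‖G‖ ≤ 100 * (1 + |M'|) * δ := by
      rw [div_le_iff₀ (by linarith)]
      have hm : 0 ≤ |M'| * δ := by positivity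
      have h5 : 100 * (1 + |M'|) * δ * (1/2) ≤ 100 * (1 + |M'|) * δ * ‖G‖ := by gcongr
      nlinarith
    gcongr

theorem fin01 : IsFiniteMeasure μ01 := by
  unfold μ01; infer_instance

theorem entry_int {Q : ℝ → M2} {p : ℝ≥0∞} (hp : 1 ≤ p) (hQ : MemLp Q p μ01) (i j : Fin 2) :
    Integrable (fun x => (Q x i j).re) μ01 := by
  have := fin01
  have h1 : Integrable Q μ01 := memLp_one_iff_integrable.mp (hQ.mono_exponent hp)
  have h2 := (LinearMap.toContinuousLinearMap (Matrix.entryLinearMap ℂ ℂ i j : M2 →ₗ[ℂ] ℂ)).integrable_comp h1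
  exact Complex.reCLM.integrable_comp h2

theorem fc_lim {g : ℝ → ℂ} {p : ℝ≥0∞} (hp : 1 ≤ p) (hg : MemLp g p μ01) :
    Tendsto (fun n : ℤ => fc g n) cofinite (nhds 0) := by
  have := fin01
  have h1 : IntegrableOn g (Set.Ioo 0 1) := memLp_one_iff_integrable.mp (hg.mono_exponent hp)
  rw [Metric.tendsto_nhds]
  intro ε hε
  obtain ⟨R, hR0, hR⟩ := rl_unif h1 (half_pos hε)
  obtain ⟨K, hK⟩ := exists_nat_ge R
  rw [Filter.eventually_cofinite]
  refine (Set.finite_Icc (-(K:ℤ)) K).subset fun n hn => ?_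
  by_contra hc
  apply hn
  have hn1 : (K:ℤ) ≤ |n| := by
    simp only [Set.mem_Icc, not_and_or, not_le] at hc
    rcases hc with hc | hc
    · have := neg_le_abs n; omega
    · have := le_abs_self n; omega
  have hn2 : (K:ℝ) ≤ |(n:ℝ)| := by exact_mod_cast hn1
  have := hR 0 (-2 * Real.pi * Complex.I * n) (by
    simp only [norm_mul, norm_neg, Complex.norm_I, Complex.norm_ofNat, Complex.norm_real,
      Complex.norm_intCast, Real.norm_eq_abs, abs_of_pos Real.pi_pos]
    have := Real.pi_gt_three
    have h0 := abs_nonneg (n:ℝ)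
    nlinarith) 1 (by simp) (by
    intro t _
    rw [Complex.norm_exp]
    simp)
  simp only [zero_add] at this
  rw [dist_zero_right, fc]
  linarith

theorem eig_iff {Q : ℝ → M2} {q1 q2 : ℝ → ℝ}
    (hQ : ∀ x, Q x = !![(q1 x : ℂ), (q2 x : ℂ); (q2 x : ℂ), -(q1 x : ℂ)])
    {c : ℂ → ℝ → Fin 2 → ℂ} (hc : ∀ l : ℂ, IsVecSolution Q l (c l) ∧ c l 0 = ![1, 0])
    (H : CFam q1 q2 (fun l x => c l x 0) (fun l x => c l x 1)) (j : Fin 2) (l : ℝ) :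
    IsEigenvalue Q j l ↔ c l 1 j = 0 := by
  constructor
  · rintro ⟨u, hu, ⟨x, hx, hne⟩, h0, h1⟩
    have huq := DSol.unique H.hq1 H.hq2 (hu.dsol hQ) (H.sol l) (u 0 0)
      (by simp [(hc l).2]) (by simp [(hc l).2, h0])
    have ha : u 0 0 ≠ 0 := by
      intro ha
      apply hne
      obtain ⟨e1, e2⟩ := huq x hx
      rw [ha, zero_mul] at e1 e2
      ext k; fin_cases k
      · exact e1
      · exact e2
    obtain ⟨e1, e2⟩ := huq 1 (by simp)
    have : u 1 j = u 0 0 * c l 1 j := by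
      fin_cases j
      · exact e1
      · exact e2
    rw [h1] at this
    exact (mul_eq_zero.mp this.symm).resolve_left ha
  · intro h
    refine ⟨c l, (hc l).1, ⟨0, by simp, ?_⟩, by simp [(hc l).2], h⟩
    rw [(hc l).2]
    intro h'
    simpa using congrFun h' 0

theorem zero_iff {Q : ℝ → M2} {q1 q2 : ℝ → ℝ}
    (hQ : ∀ x, Q x = !![(q1 x : ℂ), (q2 x : ℂ); (q2 x : ℂ), -(q1 x : ℂ)])
    {c : ℂ → ℝ → Fin 2 → ℂ} (hc : ∀ l : ℂ, IsVecSolution Q l (c l) ∧ c l 0 = ![1, 0])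
    (H : CFam q1 q2 (fun l x => c l x 0) (fun l x => c l x 1)) (j : Fin 2) {lam : ℤ → ℝ}
    (hlam : ∀ l : ℝ, IsEigenvalue Q j l ↔ ∃ n : ℤ, lam n = l) (z : ℂ) :
    c z 1 j = 0 ↔ ∃ n, (lam n : ℂ) = z := by
  constructor
  · intro h
    have hz : z.im = 0 := H.real_zero (l := z) (by
      fin_cases j
      · exact Or.inl h
      · exact Or.inr h)
    have e : ((z.re : ℝ) : ℂ) = z := by
      apply Complex.ext <;> simp [hz]
    rw [← e] at h
    obtain ⟨n, hn⟩ := (hlam z.re).mp ((eig_iff hQ hc H j z.re).mpr h)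
    exact ⟨n, by rw [hn, e]⟩
  · rintro ⟨n, rfl⟩
    exact (eig_iff hQ hc H j _).mp ((hlam _).mpr ⟨n, rfl⟩)

/-- The symmetric partial products converge, uniformly on compact subsets
of `ℂ`, to `φ(λ) = c₁(1,λ)` and `ψ(λ) = c₂(1,λ)` respectively. -/
theorem statement7 (p : ℝ≥0∞) (hp : 1 ≤ p) (hp' : p ≠ ∞)
    (Q : ℝ → M2) (hQform : IsRealDiracForm Q) (hQp : MemLp Q p μ01)
    (lam mu : ℤ → ℝ)
    (hmono1 : StrictMono lam) (hmono2 : StrictMono mu)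
    (hlam : ∀ l : ℝ, IsEigenvalue Q 0 l ↔ ∃ n : ℤ, lam n = l)
    (hmu : ∀ l : ℝ, IsEigenvalue Q 1 l ↔ ∃ n : ℤ, mu n = l)
    (hla : LamAsymp p lam) (hma : MuAsymp p mu)
    (c : ℂ → ℝ → Fin 2 → ℂ)
    (hc : ∀ l : ℂ, IsVecSolution Q l (c l) ∧ c l 0 = ![1, 0]) :
    (∀ S : Set ℂ, IsCompact S →
      TendstoUniformlyOn
        (fun (N : ℕ) (l : ℂ) =>
          ∏ n ∈ Finset.Icc (-(N:ℤ)) (N:ℤ), ((lam n : ℂ) - l) / (Real.pi * ((n : ℂ) + 1/2)))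
        (fun l : ℂ => c l 1 0) atTop S) ∧
    (∀ S : Set ℂ, IsCompact S →
      TendstoUniformlyOn
        (fun (N : ℕ) (l : ℂ) => (l - (mu 0 : ℂ)) *
          ∏ n ∈ (Finset.Icc (-(N:ℤ)) (N:ℤ)).erase 0, ((mu n : ℂ) - l) / (Real.pi * (n : ℂ)))
        (fun l : ℂ => c l 1 1) atTop S) := by
  obtain ⟨q1, q2, hQ⟩ := hQform
  have i1 : IntegrableOn q1 (Set.Ioo 0 1) := by
    have := entry_int hp hQp 0 0
    simp only [hQ] at this
    simp only [μ01] at this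
    exact this.congr (Filter.Eventually.of_forall fun x => by simp)
  have i2 : IntegrableOn q2 (Set.Ioo 0 1) := by
    have := entry_int hp hQp 0 1
    simp only [hQ] at this
    simp only [μ01] at this
    exact this.congr (Filter.Eventually.of_forall fun x => by simp)
  have H : CFam q1 q2 (fun l x => c l x 0) (fun l x => c l x 1) :=
    ⟨i1, i2, fun l => (hc l).1.dsol hQ, fun l => by simp [(hc l).2], fun l => by simp [(hc l).2]⟩
  have Z0 := zero_iff hQ hc H 0 hlam
  have Z1 := zero_iff hQ hc H 1 hmu
  constructor
  · -- the function `φ`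
    obtain ⟨g, hg, hgl⟩ := hla
    have hd : Differentiable ℂ (fun l => c l 1 0) := H.diff1
    have hZ : ZF (fun z => -(c (z + Real.pi / 2) 1 0)) (fun n => (lam n : ℂ) - Real.pi / 2) := by
      refine ⟨?_, ?_, ?_, ?_, ?_, ?_⟩
      · exact (hd.comp (differentiable_id.add_const _)).neg
      · intro m n h
        have : (lam m : ℂ) = lam n := sub_left_inj.mp h
        exact hmono1.injective (by exact_mod_cast this)
      · intro z
        rw [neg_eq_zero, Z0]
        exact exists_congr fun n => sub_eq_iff_eq_add.symm
      · intro n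
        have h0 : c (lam n) 1 0 = 0 := (Z0 _).mpr ⟨n, rfl⟩
        have hs := (H.simple (l := lam n)).1 h0
        have e : deriv (fun z => -(c (z + Real.pi / 2) 1 0)) ((lam n : ℂ) - Real.pi / 2)
            = - deriv (fun l => c l 1 0) (lam n) := by
          rw [deriv.fun_neg]
          congr 1
          have := deriv_comp_add_const (fun l => c l 1 0) (Real.pi / 2 : ℂ) ((lam n : ℂ) - Real.pi / 2)
          rw [sub_add_cancel] at this
          exact this
        rw [e]
        exact neg_ne_zero.mpr hs
      · refine (fc_lim hp hg).congr fun n => ?_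
        rw [hgl n]; ring
      · intro ε hε
        obtain ⟨R, hR⟩ := H.growth hε
        refine ⟨R + Real.pi, fun z hz => ?_⟩
        have hw : R ≤ ‖z + Real.pi / 2‖ := by
          have h1 : ‖z‖ ≤ ‖z + Real.pi / 2‖ + ‖(Real.pi / 2 : ℂ)‖ := by
            simpa using norm_sub_le (z + Real.pi / 2) (Real.pi / 2 : ℂ)
          have h2 : ‖(Real.pi / 2 : ℂ)‖ = Real.pi / 2 := by
            rw [norm_div, Complex.norm_real, Real.norm_eq_abs, abs_of_pos Real.pi_pos]; simp
          have := Real.pi_pos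
          linarith
        have h1 := (hR _ hw).1
        have e1 : (z + Real.pi / 2).im = z.im := by
          have : (Real.pi / 2 : ℂ) = ((Real.pi / 2 : ℝ) : ℂ) := by push_cast; rfl
          rw [this, Complex.add_im, Complex.ofReal_im, add_zero]
        rw [e1, Complex.cos_add_pi_div_two, ← norm_neg] at h1
        have e2 : -(c (z + Real.pi / 2) 1 0) - Complex.sin z =
            -(c (z + Real.pi / 2) 1 0 - -Complex.sin z) := by ring
        beta_reduce
        rw [e2]
        exact h1
    intro S hS
    have hS' : IsCompact ((fun l : ℂ => l - Real.pi / 2) '' S) := hS.image (by fun_prop)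
    have T := hZ.main kap'_lim hS'
    rw [Metric.tendstoUniformlyOn_iff] at T ⊢
    intro ε hε
    filter_upwards [T ε hε] with N hN l hl
    have := hN (l - Real.pi / 2) ⟨l, hl, rfl⟩
    rw [sub_add_cancel] at this
    rw [← dist_neg_neg]
    convert this using 2
    rw [kap', ← Finset.prod_mul_distrib, ← prod_neg_sym]
    refine Finset.prod_congr rfl fun n _ => ?_
    ring
  · -- the function `ψ`
    obtain ⟨g, hg, hgl⟩ := hma
    have hZ : ZF (fun z => c z 1 1) (fun n => (mu n : ℂ)) := by
      refine ⟨H.diff2, ?_, Z1, ?_, ?_, ?_⟩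
      · intro m n h
        have h' : (mu m : ℂ) = mu n := h
        exact hmono2.injective (by exact_mod_cast h')
      · intro n
        exact (H.simple (l := mu n)).2 ((Z1 _).mpr ⟨n, rfl⟩)
      · refine (fc_lim hp hg).congr fun n => ?_
        rw [hgl n]; ring
      · intro ε hε
        obtain ⟨R, hR⟩ := H.growth hε
        exact ⟨R, fun z hz => (hR z hz).2⟩
    intro S hS
    have hk : Tendsto (fun N => kap N / kap N) atTop (nhds 1) := by
      refine tendsto_const_nhds.congr fun N => ?_
      rw [div_self (kap_ne N)]
    have T := hZ.main hk hS
    refine T.congr (Filter.Eventually.of_forall fun N l _ => ?_)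
    exact (kap_psi (fun n => (mu n : ℂ)) N l).symm
end
end

section
/- Let p ∈ [1,∞), let Q be a Dirac-form potential with real-valued q₁, q₂ ∈ L_p(0,1), let (λ_n)_{n∈ℤ} be the eigenvalues of A₁, and set φ(λ) := c₁(1,λ) and ψ(λ) := c₂(1,λ) (both entire functions of λ). Then the norming constants α_n := ‖c(·,λ_n)‖_ℍ^{−2} satisfy α_n = −1/(φ′(λ_n) ψ(λ_n)) for every n ∈ ℤ. -/
open MeasureTheory Complex Filter Set
open scoped Matrix.Norms.L2Operator ENNReal

noncomputable section

theorem s8_ii_ofReal {f : ℝ → ℝ} {a b : ℝ} (h : IntervalIntegrable f volume a b) :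
    IntervalIntegrable (fun x => (f x : ℂ)) volume a b := 
  ⟨Integrable.ofReal h.1, Integrable.ofReal h.2⟩

theorem s8_lip_comp {f : ℝ → ℝ} {a b : ℝ} (hf : AbsolutelyContinuousOnInterval f a b)
    (g : ℝ → ℝ) (hg : ∀ x ∈ uIcc a b, ∀ y ∈ uIcc a b, dist (g (f x)) (g (f y)) ≤ dist (f x) (f y)) :
    AbsolutelyContinuousOnInterval (fun x => g (f x)) a b := by
  rw [absolutelyContinuousOnInterval_iff] at hf ⊢
  intro ε hε
  obtain ⟨δ, hδ, h⟩ := hf ε hε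
  refine ⟨δ, hδ, fun E hE hs => lt_of_le_of_lt (Finset.sum_le_sum fun i hi => ?_) (h E hE hs)⟩
  have := hE.1 i hi
  exact hg _ this.1 _ this.2

theorem s8_const_ac {F : Type*} [PseudoMetricSpace F] (z : F) (a b : ℝ) :
    AbsolutelyContinuousOnInterval (fun _ : ℝ => z) a b :=
  (LipschitzWith.const z).lipschitzOnWith.absolutelyContinuousOnInterval (K := 0)

theorem s8_ofReal_ac {f : ℝ → ℝ} {a b : ℝ} (hf : AbsolutelyContinuousOnInterval f a b) :
    AbsolutelyContinuousOnInterval (fun x => (f x : ℂ)) a b := by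
  have := hf.smul (s8_const_ac (1:ℂ) a b)
  refine cast ?_ this
  congr 1
  ext x
  simp

theorem s8_prim_ac {f : ℝ → ℂ} {a b : ℝ} (hf : IntervalIntegrable f volume a b) :
    AbsolutelyContinuousOnInterval (fun x => ∫ t in a..x, f t) a b := by
  have h1 : IntervalIntegrable (fun t => (f t).re) volume a b := ⟨hf.1.re, hf.2.re⟩
  have h2 : IntervalIntegrable (fun t => (f t).im) volume a b := ⟨hf.1.im, hf.2.im⟩
  have a1 := s8_ofReal_ac (h1.absolutelyContinuousOnInterval_intervalIntegral (c := a) (by simp))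
  have a2 := s8_ofReal_ac (h2.absolutelyContinuousOnInterval_intervalIntegral (c := a) (by simp))
  have a3 := a1.add (a2.const_smul Complex.I)
  rw [absolutelyContinuousOnInterval_iff] at a3 ⊢
  intro ε hε
  obtain ⟨δ, hδ, h⟩ := a3 ε hε
  refine ⟨δ, hδ, fun E hE hs => lt_of_le_of_lt (Finset.sum_le_sum fun i hi => ?_) (h E hE hs)⟩
  have key : ∀ x ∈ uIcc a b, (∫ t in a..x, f t) = 
     ((fun x => ((∫ t in a..x, (f t).re : ℝ) : ℂ)) + Complex.I • fun x => ((∫ t in a..x, (f t).im : ℝ) : ℂ)) x := by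
    intro x hx
    have hi : IntervalIntegrable f volume a x := hf.mono_set (uIcc_subset_uIcc_left hx)
    have h1 : IntervalIntegrable (fun t => (f t).re) volume a x := ⟨hi.1.re, hi.2.re⟩
    have h2 : IntervalIntegrable (fun t => (f t).im) volume a x := ⟨hi.1.im, hi.2.im⟩
    simp only [Pi.add_apply, Pi.smul_apply, smul_eq_mul]
    rw [← intervalIntegral.integral_ofReal, ← intervalIntegral.integral_ofReal,
      ← intervalIntegral.integral_const_mul, ← intervalIntegral.integral_add (s8_ii_ofReal h1)
        ((s8_ii_ofReal h2).const_mul _)]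
    refine intervalIntegral.integral_congr fun t _ => ?_
    simp only [mul_comm Complex.I]
    exact (Complex.re_add_im _).symm
  have := hE.1 i hi
  rw [key _ this.1, key _ this.2]
  exact le_rfl

/-- FTC for complex absolutely continuous functions. -/
theorem s8_ftc {F F' : ℝ → ℂ} {a b : ℝ} (hF : AbsolutelyContinuousOnInterval F a b)
    (hF' : IntervalIntegrable F' volume a b)
    (hd : ∀ᵐ x, x ∈ uIcc a b → HasDerivAt F (F' x) x) :
    F b - F a = ∫ x in a..b, F' x := by
  have h1 := hF.sub (s8_prim_ac hF')
  obtain ⟨C, hC⟩ := h1.const_of_ae_hasDerivAt_zero (by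
    filter_upwards [hd, hF'.ae_hasDerivAt_integral] with x h1 h2 h3
    have := (h1 h3).sub (h2 h3 a left_mem_uIcc)
    rwa [sub_self] at this)
  have ha := hC a left_mem_uIcc
  have hb := hC b right_mem_uIcc
  simp only [Pi.sub_apply, intervalIntegral.integral_same, sub_zero] at ha hb
  rw [← ha] at hb
  rw [← sub_eq_iff_eq_add'.mpr (sub_eq_iff_eq_add.mp hb)]

/-- product rule -/
theorem s8_mul {u u' v v' : ℝ → ℂ} 
    (hu' : IntervalIntegrable u' volume 0 1) (hv' : IntervalIntegrable v' volume 0 1)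
    (hu : ∀ x ∈ Icc (0:ℝ) 1, u x = u 0 + ∫ t in (0:ℝ)..x, u' t)
    (hv : ∀ x ∈ Icc (0:ℝ) 1, v x = v 0 + ∫ t in (0:ℝ)..x, v' t) :
    IntervalIntegrable (fun x => u' x * v x + u x * v' x) volume 0 1 ∧
    u 1 * v 1 - u 0 * v 0 = ∫ x in (0:ℝ)..1, (u' x * v x + u x * v' x) := by
  set U : ℝ → ℂ := fun x => u 0 + ∫ t in (0:ℝ)..x, u' t with hU
  set V : ℝ → ℂ := fun x => v 0 + ∫ t in (0:ℝ)..x, v' t with hV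
  have aU : AbsolutelyContinuousOnInterval U 0 1 := (s8_const_ac (u 0) 0 1).add (s8_prim_ac hu')
  have aV : AbsolutelyContinuousOnInterval V 0 1 := (s8_const_ac (v 0) 0 1).add (s8_prim_ac hv')
  have hint : IntervalIntegrable (fun x => u' x * V x + U x * v' x) volume 0 1 :=
    (hu'.mul_continuousOn aV.continuousOn).add (hv'.continuousOn_mul aU.continuousOn)
  have h := s8_ftc (aU.smul aV) hint (by
    filter_upwards [hu'.ae_hasDerivAt_integral, hv'.ae_hasDerivAt_integral] with x h1 h2 h3
    exact ((h1 h3 0 (by simp)).const_add (u 0)).mul ((h2 h3 0 (by simp)).const_add (v 0)))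
  have e : ∀ x ∈ uIcc (0:ℝ) 1, u' x * V x + U x * v' x = u' x * v x + u x * v' x := by
    intro x hx
    rw [uIcc_of_le zero_le_one] at hx
    rw [hu x hx, hv x hx]
  constructor
  · exact hint.congr fun x hx => e x (uIoc_subset_uIcc hx)
  · rw [← intervalIntegral.integral_congr e, ← h]
    simp only [Pi.smul_apply', smul_eq_mul]
    rw [hu 1 (by simp), hv 1 (by simp)]
    simp [hU, hV]

/-- Gronwall -/
theorem s8_gronwall {f : ℝ → ℝ} {k : ℝ → ℝ} {ε : ℝ} (hε : 0 ≤ ε)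
    (hf : ContinuousOn f (Icc 0 1)) (hf0 : ∀ x ∈ Icc (0:ℝ) 1, 0 ≤ f x)
    (hk : IntervalIntegrable k volume 0 1) (hk0 : ∀ x, 0 ≤ k x)
    (h : ∀ x ∈ Icc (0:ℝ) 1, f x ≤ ε + ∫ t in (0:ℝ)..x, k t * f t) :
    ∀ x ∈ Icc (0:ℝ) 1, f x ≤ ε * Real.exp (∫ t in (0:ℝ)..1, k t) := by
  intro x hx
  have hI : uIcc (0:ℝ) x ⊆ uIcc (0:ℝ) 1 := by
    rw [uIcc_of_le hx.1, uIcc_of_le zero_le_one]; exact Icc_subset_Icc le_rfl hx.2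
  have hII : ∀ y ∈ uIcc (0:ℝ) x, y ∈ Icc (0:ℝ) 1 := fun y hy => by
    have := hI hy; rwa [uIcc_of_le zero_le_one] at this
  have hkx := hk.mono_set hI
  have hkf : IntervalIntegrable (fun t => k t * f t) volume 0 x :=
    hkx.mul_continuousOn (hf.mono hII)
  set K : ℝ → ℝ := fun x => ∫ t in (0:ℝ)..x, k t with hK
  set G : ℝ → ℝ := fun x => ε + ∫ t in (0:ℝ)..x, k t * f t with hG
  have aK : AbsolutelyContinuousOnInterval K 0 x :=
    hkx.absolutelyContinuousOnInterval_intervalIntegral (by simp)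
  have aG : AbsolutelyContinuousOnInterval G 0 x :=
    (s8_const_ac ε 0 x).add (hkf.absolutelyContinuousOnInterval_intervalIntegral (by simp))
  have K0 : ∀ y, 0 ≤ y → 0 ≤ K y := fun y hy => intervalIntegral.integral_nonneg hy fun t _ => hk0 t
  have aE : AbsolutelyContinuousOnInterval (fun x => Real.exp (- K x)) 0 x := by
    refine s8_lip_comp aK (fun y => Real.exp (-y)) ?_
    have aux : ∀ a b : ℝ, 0 ≤ a → a ≤ b → |Real.exp (-a) - Real.exp (-b)| ≤ |a - b| := by
      intro a b ha hab
      have h1 : Real.exp (-b) ≤ Real.exp (-a) := Real.exp_le_exp.mpr (by linarith)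
      have h2 : Real.exp (-b) = Real.exp (-a) * Real.exp (-(b-a)) := by
        rw [← Real.exp_add]; ring_nf
      have h3 := Real.add_one_le_exp (-(b-a))
      have h4 : Real.exp (-a) ≤ 1 := Real.exp_le_one_iff.mpr (by linarith)
      have h5 := Real.exp_pos (-a)
      rw [abs_of_nonneg (by linarith), abs_of_nonpos (by linarith), h2]
      nlinarith
    intro y hy z hz
    rw [uIcc_of_le hx.1] at hy hz
    rw [Real.dist_eq, Real.dist_eq]
    rcases le_total (K y) (K z) with hh | hh
    · exact aux _ _ (K0 y hy.1) hh
    · rw [abs_sub_comm, abs_sub_comm (K y)]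
      exact aux _ _ (K0 z hz.1) hh
  have hmul := (aG.mul aE).integral_deriv_eq_sub
  have hle : ∫ t in (0:ℝ)..x, deriv (G * fun x => Real.exp (- K x)) t ≤ 0 := by
    rw [intervalIntegral.integral_of_le hx.1]
    refine integral_nonpos_of_ae ?_
    rw [EventuallyLE, ae_restrict_iff' measurableSet_Ioc]
    filter_upwards [hkx.ae_hasDerivAt_integral, hkf.ae_hasDerivAt_integral] with t h1 h2 h3
    have ht : t ∈ uIcc (0:ℝ) x := by rw [uIcc_of_le hx.1]; exact ⟨h3.1.le, h3.2⟩
    have d1 : HasDerivAt K (k t) t := h1 ht 0 (by simp)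
    have d2 : HasDerivAt G (k t * f t) t := (h2 ht 0 (by simp)).const_add ε
    have d3 : HasDerivAt (G * fun x => Real.exp (- K x)) (k t * f t * Real.exp (- K t) + G t * (Real.exp (- K t) * -k t)) t :=
      d2.mul (d1.neg.exp)
    rw [HasDerivAt.deriv d3]
    have := h t (hII t ht)
    have e1 := Real.exp_pos (-K t)
    have : k t * f t ≤ k t * G t := mul_le_mul_of_nonneg_left this (hk0 t)
    simp only [Pi.zero_apply, Pi.neg_apply]
    nlinarith
  rw [hmul] at hle
  simp only [Pi.mul_apply, hK, hG, intervalIntegral.integral_same, neg_zero, Real.exp_zero, add_zero, mul_one] at hle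
  have h6 := h x hx
  have h7 : G x ≤ ε * Real.exp (K x) := by
    have e1 := Real.exp_pos (K x)
    have e2 : Real.exp (-K x) * Real.exp (K x) = 1 := by rw [← Real.exp_add]; simp
    have : G x * Real.exp (-K x) ≤ ε := by simpa [hG, hK] using hle
    calc G x = (G x * Real.exp (-K x)) * Real.exp (K x) := by rw [mul_assoc, e2, mul_one]
      _ ≤ _ := mul_le_mul_of_nonneg_right this e1.le
  refine h6.trans (h7.trans (mul_le_mul_of_nonneg_left (Real.exp_le_exp.mpr ?_) hε))
  have hadd := intervalIntegral.integral_add_adjacent_intervals hkx (hk.mono_set (a := 0) (b := 1) (c := x) (d := 1) 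
    (uIcc_subset_uIcc_right (by rw [uIcc_of_le zero_le_one]; exact hx)))
  have : 0 ≤ ∫ t in x..1, k t := intervalIntegral.integral_nonneg hx.2 fun t _ => hk0 t
  simp only [hK]; linarith

theorem s8_vec_gronwall {f f' : ℝ → Fin 2 → ℂ} {k : ℝ → ℝ} {ε : ℝ} (hε : 0 ≤ ε)
    (hf' : IntervalIntegrable f' volume 0 1)
    (hf : ∀ x ∈ Icc (0:ℝ) 1, f x = ∫ t in (0:ℝ)..x, f' t)
    (hk : IntervalIntegrable k volume 0 1) (hk0 : ∀ x, 0 ≤ k x)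
    (hb : ∀ᵐ x, x ∈ Ioo (0:ℝ) 1 → ‖f' x‖ ≤ k x * ‖f x‖ + ε) :
    ∀ x ∈ Icc (0:ℝ) 1, ‖f x‖ ≤ ε * Real.exp (∫ t in (0:ℝ)..1, k t) := by
  have hcont : ContinuousOn f (Icc 0 1) := by
    have := intervalIntegral.continuousOn_primitive_interval' hf' (a := 0) (by simp)
    rw [uIcc_of_le zero_le_one] at this
    exact this.congr hf
  refine s8_gronwall (f := fun x => ‖f x‖) hε hcont.norm (fun _ _ => norm_nonneg _) hk hk0 ?_
  intro x hx
  have hI : uIcc (0:ℝ) x ⊆ uIcc (0:ℝ) 1 := by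
    rw [uIcc_of_le hx.1, uIcc_of_le zero_le_one]; exact Icc_subset_Icc le_rfl hx.2
  have hkf : IntervalIntegrable (fun t => k t * ‖f t‖) volume 0 x := by
    refine (hk.mono_set hI).mul_continuousOn (hcont.norm.mono ?_)
    rw [uIcc_of_le zero_le_one] at hI; exact hI
  calc ‖f x‖ = ‖∫ t in (0:ℝ)..x, f' t‖ := by rw [hf x hx]
    _ ≤ ∫ t in (0:ℝ)..x, ‖f' t‖ := intervalIntegral.norm_integral_le_integral_norm hx.1
    _ ≤ ∫ t in (0:ℝ)..x, (k t * ‖f t‖ + ε) := by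
        refine intervalIntegral.integral_mono_ae_restrict hx.1 (hf'.mono_set hI).norm
          (hkf.add intervalIntegrable_const) ?_
        have hne0 : ∀ᵐ x : ℝ, x ≠ 0 := by simp [ae_iff, measure_singleton]
        have hne1 : ∀ᵐ x : ℝ, x ≠ 1 := by simp [ae_iff, measure_singleton]
        rw [EventuallyLE, ae_restrict_iff' measurableSet_Icc]
        filter_upwards [hb, hne0, hne1] with t h1 h2 h3 h4
        exact h1 ⟨lt_of_le_of_ne h4.1 (Ne.symm h2), lt_of_le_of_ne (h4.2.trans hx.2) h3⟩
    _ = (∫ t in (0:ℝ)..x, k t * ‖f t‖) + x * ε := by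
        rw [intervalIntegral.integral_add hkf intervalIntegrable_const]; simp
    _ ≤ _ := by nlinarith [hx.2]

/-- Componentwise form of the vector solutions. -/
structure S8Sol (q1 q2 : ℝ → ℝ) (l : ℂ) (u u' : ℝ → Fin 2 → ℂ) : Prop where
  int : IntervalIntegrable u' volume 0 1
  eq : ∀ x ∈ Icc (0:ℝ) 1, u x = u 0 + ∫ t in (0:ℝ)..x, u' t
  ode : ∀ᵐ x, x ∈ Ioo (0:ℝ) 1 →
    u' x 0 = q2 x * u x 0 - q1 x * u x 1 - l * u x 1 ∧
    u' x 1 = l * u x 0 - q1 x * u x 0 - q2 x * u x 1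

theorem s8_sol_of {Q : ℝ → M2} {q1 q2 : ℝ → ℝ}
    (hQ : ∀ x, Q x = !![(q1 x : ℂ), (q2 x : ℂ); (q2 x : ℂ), -(q1 x : ℂ)]) {l : ℂ}
    {u : ℝ → Fin 2 → ℂ} (h : IsVecSolution Q l u) : ∃ u', S8Sol q1 q2 l u u' := by
  obtain ⟨u', h1, h2, h3⟩ := h
  refine ⟨u', ?_, h2, ?_⟩
  · rw [intervalIntegrable_iff_integrableOn_Ioo_of_le zero_le_one]; exact h1
  · rw [μ01, ae_restrict_iff' measurableSet_Ioo] at h3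
    filter_upwards [h3] with x hx hx'
    have := hx hx'
    have e0 := congrFun this 0
    have e1 := congrFun this 1
    simp [Bmat, hQ, Matrix.mulVec, dotProduct, Fin.sum_univ_two] at e0 e1
    constructor
    · linear_combination -e1
    · linear_combination e0

namespace S8Sol
variable {q1 q2 : ℝ → ℝ} {l m : ℂ} {u u' v v' : ℝ → Fin 2 → ℂ}

theorem cont (h : S8Sol q1 q2 l u u') : ContinuousOn u (Icc 0 1) := by
  have := intervalIntegral.continuousOn_primitive_interval' h.int (a := 0) (by simp)
  rw [uIcc_of_le zero_le_one] at this
  exact (continuousOn_const.add this).congr h.eq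

theorem intc (h : S8Sol q1 q2 l u u') (i : Fin 2) :
    IntervalIntegrable (fun x => u' x i) volume 0 1 :=
  ⟨Integrable.eval h.int.1 i, Integrable.eval h.int.2 i⟩

theorem eqc (h : S8Sol q1 q2 l u u') (i : Fin 2) :
    ∀ x ∈ Icc (0:ℝ) 1, u x i = u 0 i + ∫ t in (0:ℝ)..x, u' t i := by
  intro x hx
  have hI : uIcc (0:ℝ) x ⊆ uIcc (0:ℝ) 1 := by
    rw [uIcc_of_le hx.1, uIcc_of_le zero_le_one]; exact Icc_subset_Icc le_rfl hx.2
  rw [h.eq x hx, Pi.add_apply]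
  congr 1
  exact ((ContinuousLinearMap.proj (R := ℝ) (φ := fun _ : Fin 2 => ℂ) i).intervalIntegral_comp_comm
    (h.int.mono_set hI)).symm

theorem star (h : S8Sol q1 q2 l u u') :
    S8Sol q1 q2 (starRingEnd ℂ l) (fun x i => starRingEnd ℂ (u x i))
      (fun x i => starRingEnd ℂ (u' x i)) where
  int := by
    have : ∀ s : Set ℝ, IntegrableOn u' s volume →
        IntegrableOn (fun x i => starRingEnd ℂ (u' x i)) s volume := fun s hs =>
      Integrable.of_eval fun i => 
        (Complex.conjCLE.toContinuousLinearMap.integrable_comp (Integrable.eval hs i))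
    exact ⟨this _ h.int.1, this _ h.int.2⟩
  eq := by
    intro x hx
    have hI : uIcc (0:ℝ) x ⊆ uIcc (0:ℝ) 1 := by
      rw [uIcc_of_le hx.1, uIcc_of_le zero_le_one]; exact Icc_subset_Icc le_rfl hx.2
    have key := (ContinuousLinearMap.pi (fun i : Fin 2 =>
      Complex.conjCLE.toContinuousLinearMap.comp
        (ContinuousLinearMap.proj (R := ℝ) (φ := fun _ : Fin 2 => ℂ) i))).intervalIntegral_comp_comm
          (h.int.mono_set hI)
    have key2 : ∫ t in (0:ℝ)..x, (fun i => starRingEnd ℂ (u' t i)) =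
        fun i => starRingEnd ℂ ((∫ t in (0:ℝ)..x, u' t) i) := key
    rw [key2]
    ext i
    simp [h.eq x hx]
  ode := by
    filter_upwards [h.ode] with x hx hx'
    obtain ⟨e0, e1⟩ := hx hx'
    simp [e0, e1]

/-- Stability estimate. -/
theorem stab (hq1 : IntervalIntegrable q1 volume 0 1) (hq2 : IntervalIntegrable q2 volume 0 1)
    (h : S8Sol q1 q2 l u u') (h' : S8Sol q1 q2 m v v') (h0 : u 0 = v 0) {M : ℝ} (hM0 : 0 ≤ M)
    (hM : ∀ x ∈ Icc (0:ℝ) 1, ‖v x‖ ≤ M) {R : ℝ} (hR : ‖l‖ ≤ R) :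
    ∀ x ∈ Icc (0:ℝ) 1, ‖u x - v x‖ ≤
      (‖l - m‖ * M) * Real.exp (∫ t in (0:ℝ)..1, (|q1 t| + |q2 t| + R)) := by
  have hR0 : 0 ≤ R := (norm_nonneg _).trans hR
  refine s8_vec_gronwall (f := fun x => u x - v x) (f' := fun x => u' x - v' x)
    (by positivity) (h.int.sub h'.int) ?_
    ((hq1.abs.add hq2.abs).add intervalIntegrable_const) (fun x => by positivity) ?_
  · intro x hx
    have hI : uIcc (0:ℝ) x ⊆ uIcc (0:ℝ) 1 := by
      rw [uIcc_of_le hx.1, uIcc_of_le zero_le_one]; exact Icc_subset_Icc le_rfl hx.2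
    rw [intervalIntegral.integral_sub (h.int.mono_set hI) (h'.int.mono_set hI), h.eq x hx,
      h'.eq x hx, h0]
    abel
  · filter_upwards [h.ode, h'.ode] with x h1 h2 hx
    obtain ⟨a0, a1⟩ := h1 hx
    obtain ⟨b0, b1⟩ := h2 hx
    have w0 := norm_le_pi_norm (u x - v x) 0
    have w1 := norm_le_pi_norm (u x - v x) 1
    have v0 := (norm_le_pi_norm (v x) 0).trans (hM x (Ioo_subset_Icc_self hx))
    have v1 := (norm_le_pi_norm (v x) 1).trans (hM x (Ioo_subset_Icc_self hx))
    set W := ‖u x - v x‖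
    have hW : 0 ≤ W := norm_nonneg _
    simp only [Pi.sub_apply] at w0 w1
    have n1 : ‖(q1 x : ℂ)‖ = |q1 x| := by simp
    have n2 : ‖(q2 x : ℂ)‖ = |q2 x| := by simp
    have key : ∀ a b c d e y z t s: ℂ, ‖a‖ = |q1 x| → ‖b‖ = |q2 x| → ‖c‖ ≤ R → ‖d‖ ≤ ‖l - m‖ → 
        ‖y‖ ≤ W → ‖z‖ ≤ W → ‖t‖ ≤ W → ‖s‖ ≤ M → e = a * y + b * z + c * t + d * s →
        ‖e‖ ≤ (|q1 x| + |q2 x| + R) * W + ‖l - m‖ * M := by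
      intro a b c d e y z t s ha hb hc hd hy hz ht hs he
      rw [he]
      have t1 : ‖a * y‖ ≤ |q1 x| * W := by rw [norm_mul, ha]; gcongr
      have t2 : ‖b * z‖ ≤ |q2 x| * W := by rw [norm_mul, hb]; gcongr
      have t3 : ‖c * t‖ ≤ R * W := by rw [norm_mul]; gcongr
      have t4 : ‖d * s‖ ≤ ‖l - m‖ * M := by rw [norm_mul]; gcongr
      have := norm_add_le (a * y + b * z + c * t) (d * s)
      have := norm_add_le (a * y + b * z) (c * t)
      have := norm_add_le (a * y) (b * z)
      linarith
    rw [pi_norm_le_iff_of_nonneg (by positivity)]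
    intro i
    fin_cases i
    · refine key (-q1 x) (q2 x) (-l) (-(l - m)) _ (u x 1 - v x 1) (u x 0 - v x 0) (u x 1 - v x 1) (v x 1)
        (by simp) n2 (by simpa using hR) (by rw [norm_neg]) w1 w0 w1 v1 ?_
      simp [a0, b0]; ring
    · refine key (-q1 x) (-q2 x) l (l - m) _ (u x 0 - v x 0) (u x 1 - v x 1) (u x 0 - v x 0) (v x 0)
        (by simp) (by simp) hR le_rfl w0 w1 w0 v0 ?_
      simp [a1, b1]; ring

theorem bdd (h : S8Sol q1 q2 l u u') : ∃ M, 0 ≤ M ∧ ∀ x ∈ Icc (0:ℝ) 1, ‖u x‖ ≤ M := by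
  obtain ⟨M, hM⟩ := isCompact_Icc.exists_bound_of_continuousOn h.cont
  exact ⟨M, (norm_nonneg _).trans (hM 0 (by simp)), hM⟩

theorem unique (hq1 : IntervalIntegrable q1 volume 0 1) (hq2 : IntervalIntegrable q2 volume 0 1)
    (h : S8Sol q1 q2 l u u') (h' : S8Sol q1 q2 l v v') (h0 : u 0 = v 0) :
    ∀ x ∈ Icc (0:ℝ) 1, u x = v x := by
  obtain ⟨M, hM0, hM⟩ := h'.bdd
  intro x hx
  have := stab hq1 hq2 h h' h0 hM0 hM le_rfl x hx
  simp only [sub_self, norm_zero, zero_mul] at this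
  exact sub_eq_zero.mp (norm_le_zero_iff.mp this)

theorem smul (h : S8Sol q1 q2 l u u') (z : ℂ) :
    S8Sol q1 q2 l (fun x => z • u x) (fun x => z • u' x) where
  int := h.int.smul z
  eq := by
    intro x hx
    simp only [h.eq x hx, smul_add, intervalIntegral.integral_smul]
  ode := by
    filter_upwards [h.ode] with x hx hx'
    obtain ⟨e0, e1⟩ := hx hx'
    simp only [Pi.smul_apply, smul_eq_mul, e0, e1]
    constructor <;> ring

theorem lagrange (h : S8Sol q1 q2 l u u') (h' : S8Sol q1 q2 m v v') :
    (u 1 0 * v 1 1 - u 1 1 * v 1 0) - (u 0 0 * v 0 1 - u 0 1 * v 0 0) =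
      (m - l) * ∫ x in (0:ℝ)..1, (u x 0 * v x 0 + u x 1 * v x 1) := by
  obtain ⟨i1, e1⟩ := s8_mul (h.intc 0) (h'.intc 1) (h.eqc 0) (h'.eqc 1)
  obtain ⟨i2, e2⟩ := s8_mul (h.intc 1) (h'.intc 0) (h.eqc 1) (h'.eqc 0)
  rw [← intervalIntegral.integral_const_mul]
  have : ∫ x in (0:ℝ)..1, (m - l) * (u x 0 * v x 0 + u x 1 * v x 1) =
      ∫ x in (0:ℝ)..1, ((u' x 0 * v x 1 + u x 0 * v' x 1) - (u' x 1 * v x 0 + u x 1 * v' x 0)) := by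
    refine intervalIntegral.integral_congr_ae ?_
    have hne : ∀ᵐ x : ℝ, x ≠ 1 := by simp [ae_iff, measure_singleton]
    filter_upwards [h.ode, h'.ode, hne] with x h1 h2 h3 hx
    rw [uIoc_of_le zero_le_one] at hx
    have hx' : x ∈ Ioo (0:ℝ) 1 := ⟨hx.1, lt_of_le_of_ne hx.2 h3⟩
    obtain ⟨a0, a1⟩ := h1 hx'
    obtain ⟨b0, b1⟩ := h2 hx'
    rw [a0, a1, b0, b1]; ring
  rw [this, intervalIntegral.integral_sub i1 i2, ← e1, ← e2]
  ring

end S8Sol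

theorem s8_q_int {Q : ℝ → M2} {q1 q2 : ℝ → ℝ}
    (hQ : ∀ x, Q x = !![(q1 x : ℂ), (q2 x : ℂ); (q2 x : ℂ), -(q1 x : ℂ)])
    (h : IntegrableOn Q (Ioo 0 1) volume) :
    IntervalIntegrable q1 volume 0 1 ∧ IntervalIntegrable q2 volume 0 1 := by
  have entry : ∀ i j, IntegrableOn (fun x => Q x i j) (Ioo 0 1) volume := by
    intro i j
    exact (LinearMap.toContinuousLinearMap (Matrix.entryLinearMap ℂ ℂ i j : M2 →ₗ[ℂ] ℂ)).integrable_comp h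
  constructor
  · rw [intervalIntegrable_iff_integrableOn_Ioo_of_le zero_le_one]
    have := (entry 0 0).re
    simp [hQ] at this
    exact this
  · rw [intervalIntegrable_iff_integrableOn_Ioo_of_le zero_le_one]
    have := (entry 0 1).re
    simp [hQ] at this
    exact this

/-- The norming constants satisfy `α_n = -1/(φ'(λ_n) ψ(λ_n))`, where
`φ(λ) = c₁(1,λ)` and `ψ(λ) = c₂(1,λ)`. -/
theorem statement8 (p : ℝ≥0∞) (hp : 1 ≤ p) (hp' : p ≠ ∞)
    (Q : ℝ → M2) (hQform : IsRealDiracForm Q) (hQp : MemLp Q p μ01)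
    (lam : ℤ → ℝ)
    (hlam : ∀ l : ℝ, IsEigenvalue Q 0 l ↔ ∃ n : ℤ, lam n = l)
    (c : ℂ → ℝ → Fin 2 → ℂ)
    (hc : ∀ l : ℂ, IsVecSolution Q l (c l) ∧ c l 0 = ![1, 0]) :
    ∀ n : ℤ,
      (((hnormSq (c (lam n)))⁻¹ : ℝ) : ℂ) =
        -1 / (deriv (fun l : ℂ => c l 1 0) (lam n) * c (lam n) 1 1) := by
  obtain ⟨q1, q2, hQ⟩ := hQform
  have hQint : IntegrableOn Q (Ioo 0 1) volume := by
    haveI : IsFiniteMeasure μ01 := by unfold μ01; infer_instance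
    exact hQp.integrable hp
  obtain ⟨hq1, hq2⟩ := s8_q_int hQ hQint
  intro n
  obtain ⟨w, hw, ⟨x0, hx0, hwx⟩, hw0, hw1⟩ := (hlam (lam n)).mpr ⟨n, rfl⟩
  choose c' hc' using fun l => s8_sol_of hQ (hc l).1
  have hc0 : ∀ l, c l 0 = ![1, 0] := fun l => (hc l).2
  obtain ⟨w', hw'⟩ := s8_sol_of hQ hw
  set m : ℂ := (lam n : ℂ) with hm
  have one_mem : (1:ℝ) ∈ Icc (0:ℝ) 1 := by simp
  -- the eigenfunction is a multiple of `c m`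
  have hwc : ∀ x ∈ Icc (0:ℝ) 1, w x = w 0 0 • c m x :=
    S8Sol.unique hq1 hq2 hw' ((hc' m).smul (w 0 0)) (by
      ext i
      fin_cases i <;> simp [hc0, hw0])
  have hw00 : w 0 0 ≠ 0 := by
    intro h
    apply hwx
    rw [hwc x0 hx0, h, zero_smul]
  have hphi : c m 1 0 = 0 := by
    have := congrFun (hwc 1 one_mem) 0
    rw [hw1] at this
    simpa [hw00] using this
  -- reality
  have hreal : ∀ x ∈ Icc (0:ℝ) 1, ∀ i, starRingEnd ℂ (c m x i) = c m x i := by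
    intro x hx i
    have hs := (hc' m).star
    rw [hm, Complex.conj_ofReal, ← hm] at hs
    exact congrFun (S8Sol.unique hq1 hq2 hs (hc' m) (by
      ext i
      fin_cases i <;> simp [hc0]) x hx) i
  obtain ⟨M, hM0, hM⟩ := (hc' m).bdd
  set D : ℂ → ℂ := fun l => ∫ x in (0:ℝ)..1, (c l x 0 * c m x 0 + c l x 1 * c m x 1) with hD
  have hlag : ∀ l, c l 1 0 * c m 1 1 = (m - l) * D l := by
    intro l
    have := (hc' l).lagrange (hc' m)
    rw [hphi, hc0, hc0] at this
    simpa using this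
  have hcomp : ∀ l i, ContinuousOn (fun x => c l x i) (uIcc 0 1) := by
    intro l i
    rw [uIcc_of_le zero_le_one]
    exact (continuous_apply i).comp_continuousOn (hc' l).cont
  have hDint : ∀ l, IntervalIntegrable (fun x => c l x 0 * c m x 0 + c l x 1 * c m x 1) volume 0 1 :=
    fun l => (((hcomp l 0).mul (hcomp m 0)).add ((hcomp l 1).mul (hcomp m 1))).intervalIntegrable
  -- continuity of `D` at `m`
  have hDcont : Tendsto D (nhds m) (nhds (D m)) := by
    set C : ℝ := Real.exp (∫ t in (0:ℝ)..1, (|q1 t| + |q2 t| + (‖m‖ + 1)))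
    have hbound : ∀ᶠ l in nhds m, ‖D l - D m‖ ≤ 2 * (‖l - m‖ * M * C * M) := by
      filter_upwards [Metric.ball_mem_nhds m one_pos] with l hl
      rw [Metric.mem_ball, dist_eq_norm] at hl
      have hlR : ‖l‖ ≤ ‖m‖ + 1 := by
        have := norm_add_le (l - m) m
        rw [sub_add_cancel] at this
        linarith
      have hst := S8Sol.stab hq1 hq2 (hc' l) (hc' m) (by rw [hc0, hc0]) hM0 hM hlR
      rw [hD]
      simp only
      rw [← intervalIntegral.integral_sub (hDint l) (hDint m)]
      have := intervalIntegral.norm_integral_le_of_norm_le_const (a := (0:ℝ)) (b := 1)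
        (f := fun x => (c l x 0 * c m x 0 + c l x 1 * c m x 1) -
          (c m x 0 * c m x 0 + c m x 1 * c m x 1)) (C := 2 * (‖l - m‖ * M * C * M)) (by
          intro x hx
          rw [uIoc_of_le zero_le_one] at hx
          have hx' := Ioc_subset_Icc_self hx
          have a0 := (norm_le_pi_norm (c l x - c m x) 0).trans (hst x hx')
          have a1 := (norm_le_pi_norm (c l x - c m x) 1).trans (hst x hx')
          have b0 := (norm_le_pi_norm (c m x) 0).trans (hM x hx')
          have b1 := (norm_le_pi_norm (c m x) 1).trans (hM x hx')
          have e : (c l x 0 * c m x 0 + c l x 1 * c m x 1) -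
            (c m x 0 * c m x 0 + c m x 1 * c m x 1) =
            (c l x - c m x) 0 * c m x 0 + (c l x - c m x) 1 * c m x 1 := by
            simp only [Pi.sub_apply]; ring
          rw [e]
          refine (norm_add_le _ _).trans ?_
          rw [norm_mul, norm_mul, two_mul]
          have hC0 : 0 ≤ ‖l - m‖ * M * C := (norm_nonneg _).trans a0
          exact add_le_add (mul_le_mul a0 b0 (norm_nonneg _) hC0)
            (mul_le_mul a1 b1 (norm_nonneg _) hC0))
      simpa using this
    rw [tendsto_iff_norm_sub_tendsto_zero]
    refine squeeze_zero' (Eventually.of_forall fun _ => norm_nonneg _) hbound ?_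
    have : Continuous fun l : ℂ => 2 * (‖l - m‖ * M * C * M) := by fun_prop
    simpa using this.tendsto m
  -- value of `D m`
  have hN : D m = (hnormSq (c m) : ℂ) := by
    rw [hnormSq, ← integral_Ioc_eq_integral_Ioo, ← intervalIntegral.integral_of_le zero_le_one,
      ← intervalIntegral.integral_ofReal]
    refine intervalIntegral.integral_congr fun x hx => ?_
    rw [uIcc_of_le zero_le_one] at hx
    have k : ∀ i, c m x i * c m x i = ((‖c m x i‖ ^ 2 : ℝ) : ℂ) := by
      intro i
      have e := Complex.conj_mul' (c m x i)
      rw [hreal x hx i] at e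
      rw [e]
      push_cast; rfl
    simp only [k]
    push_cast; rfl
  have hpos : 0 < hnormSq (c m) := by
    rw [hnormSq, ← integral_Ioc_eq_integral_Ioo, ← intervalIntegral.integral_of_le zero_le_one]
    refine intervalIntegral.integral_pos zero_lt_one ?_ (fun x _ => by positivity)
      ⟨0, by simp, by simp [hc0]⟩
    have h0 := hcomp m 0
    have h1 := hcomp m 1
    rw [uIcc_of_le zero_le_one] at h0 h1
    exact (h0.norm.pow 2).add (h1.norm.pow 2)
  -- derivative
  have hder : HasDerivAt (fun l => c l 1 0 * c m 1 1) (-(D m)) m := by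
    rw [hasDerivAt_iff_tendsto_slope]
    refine ((hDcont.mono_left nhdsWithin_le_nhds).neg).congr' ?_
    filter_upwards [self_mem_nhdsWithin] with l hl
    have : l - m ≠ 0 := sub_ne_zero.mpr hl
    rw [slope_def_field, hphi, hlag l]
    field_simp
    ring
  have hN0 : (hnormSq (c m) : ℂ) ≠ 0 := by exact_mod_cast hpos.ne'
  have hpsi : c m 1 1 ≠ 0 := by
    intro h
    rw [h] at hder
    simp only [mul_zero] at hder
    have := hder.unique (hasDerivAt_const m 0)
    rw [hN, neg_eq_zero] at this
    exact hN0 this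
  have hder2 : HasDerivAt (fun l => c l 1 0) (-(D m) / c m 1 1) m := by
    have := hder.div_const (c m 1 1)
    refine this.congr_of_eventuallyEq (Eventually.of_forall fun l => ?_)
    simp only
    rw [mul_div_cancel_right₀ _ hpsi]
  rw [hder2.deriv, hN, div_mul_cancel₀ _ hpsi]
  push_cast
  rw [neg_div_neg_eq, one_div]
end
end
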